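/- Let (p,u,U) be a smooth solution of the incompressible Navier-Stokes equations on [0,T_0]×T^3 and let (p^{ε,δ},u^{ε,δ},U^{ε,δ}) solve the two-parameter relaxation system with smooth initial data. Define the rescaled residuals v = u^{ε,δ} − u, q = √ε (p^{ε,δ} − p), V = √δ (U^{ε,δ} − U), W = (q,v,V), and the energy E(t) = ‖W(t,·)‖²_{H¹(T³)} + (ε+δ)^a ‖∇²W(t,·)‖²_{L²(T³)} with a ∈ [0,2). Then there is a constant C > 0, depending only on (p,u,U) and the domain T³, such that for all sufficiently small ε+δ and all t at which both solutions exist, (d/dt)E(t) ≤ C ( √((ε+δ)E(t)) + E(t) + (ε+δ)^{−a/2} E(t)² ). -/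

import Mathlib

/-!
Common setup: fields on the torus `𝕋^d = ℝ^d/ℤ^d` are modelled as `ℤ^d`-periodic
functions on `ℝ^d`; all integrals are taken over the fundamental cell `[0,1]^d`.
-/

noncomputable section
open MeasureTheory Real
open scoped ENNReal

namespace NSRelax

/-- Spatial variable; fields on the torus are `ℤ^d`-periodic functions on `ℝ^d`. -/
abbrev Spc (d : ℕ) := Fin d → ℝ

/-- Vectors in `ℝ^m`. -/
abbrev Vec (m : ℕ) := Fin m → ℝ

/-- Fundamental cell `[0,1]^d` of the torus. -/
def cube (d : ℕ) : Set (Spc d) := Set.pi Set.univ fun _ => Set.Icc (0 : ℝ) 1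

/-- `ℤ^d`-periodicity. -/
def Per {d : ℕ} {E : Type*} (f : Spc d → E) : Prop :=
  ∀ (x : Spc d) (k : Fin d → ℤ), f (fun i => x i + (k i : ℝ)) = f x

/-- `i`-th spatial partial derivative of a scalar field. -/
def pd {d : ℕ} (i : Fin d) (f : Spc d → ℝ) (x : Spc d) : ℝ :=
  fderiv ℝ f x (Pi.single i 1)

/-- Time derivative of a time-dependent scalar field. -/
def dtS {d : ℕ} (p : ℝ → Spc d → ℝ) (t : ℝ) (x : Spc d) : ℝ :=
  deriv (fun s => p s x) t

/-- Time derivative of a time-dependent vector field. -/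
def dtV {d m : ℕ} (u : ℝ → Spc d → Vec m) (t : ℝ) (x : Spc d) : Vec m :=
  fun a => deriv (fun s => u s x a) t

/-- Time derivative of a time-dependent matrix field. -/
def dtM {d m : ℕ} (U : ℝ → Spc d → Fin m → Fin m → ℝ) (t : ℝ) (x : Spc d) :
    Fin m → Fin m → ℝ :=
  fun i j => deriv (fun s => U s x i j) t

section Norms

variable {d : ℕ} {ι : Type*} [Fintype ι]

/-- Pointwise squared Euclidean magnitude of an `ι`-indexed field. -/
def ptsq (v : Spc d → ι → ℝ) (x : Spc d) : ℝ := ∑ a, v x a ^ 2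

/-- Pointwise squared magnitude of the first derivatives. -/
def ptsqD1 (v : Spc d → ι → ℝ) (x : Spc d) : ℝ :=
  ∑ a, ∑ i, pd i (fun y => v y a) x ^ 2

/-- Pointwise squared magnitude of the second derivatives. -/
def ptsqD2 (v : Spc d → ι → ℝ) (x : Spc d) : ℝ :=
  ∑ a, ∑ i, ∑ j, pd i (pd j (fun y => v y a)) x ^ 2

/-- Pointwise squared magnitude of the third derivatives. -/
def ptsqD3 (v : Spc d → ι → ℝ) (x : Spc d) : ℝ :=
  ∑ a, ∑ i, ∑ j, ∑ k, pd i (pd j (pd k (fun y => v y a))) x ^ 2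

/-- Squared `L²(𝕋^d)` norm. -/
def L2sq (v : Spc d → ι → ℝ) : ℝ := ∫ x in cube d, ptsq v x

/-- Squared `L²(𝕋^d)` norm of the gradient. -/
def D1L2sq (v : Spc d → ι → ℝ) : ℝ := ∫ x in cube d, ptsqD1 v x

/-- Squared `L²(𝕋^d)` norm of the second derivatives. -/
def D2L2sq (v : Spc d → ι → ℝ) : ℝ := ∫ x in cube d, ptsqD2 v x

/-- Squared `L²(𝕋^d)` norm of the third derivatives. -/
def D3L2sq (v : Spc d → ι → ℝ) : ℝ := ∫ x in cube d, ptsqD3 v x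

/-- Squared `H¹(𝕋^d)` norm. -/
def H1sq (v : Spc d → ι → ℝ) : ℝ := L2sq v + D1L2sq v

/-- Squared `H²(𝕋^d)` norm. -/
def H2sq (v : Spc d → ι → ℝ) : ℝ := L2sq v + D1L2sq v + D2L2sq v

/-- Squared `H³(𝕋^d)` norm. -/
def H3sq (v : Spc d → ι → ℝ) : ℝ := L2sq v + D1L2sq v + D2L2sq v + D3L2sq v

/-- `L^p(𝕋^d)` norm. -/
def LpN (p : ℝ) (v : Spc d → ι → ℝ) : ℝ :=
  (∫ x in cube d, Real.sqrt (ptsq v x) ^ p) ^ (1 / p)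

/-- `L^∞(𝕋^d)` norm (for continuous periodic fields). -/
def LinfN (v : Spc d → ι → ℝ) : ℝ := ⨆ x : Spc d, Real.sqrt (ptsq v x)

end Norms

/-- View a scalar field as a one-component indexed field. -/
def sc {d : ℕ} (f : Spc d → ℝ) : Spc d → Vec 1 := fun x _ => f x

/-- View a matrix field as an indexed field. -/
def mtx {d m : ℕ} (U : Spc d → Fin m → Fin m → ℝ) : Spc d → Fin m × Fin m → ℝ :=
  fun x ij => U x ij.1 ij.2

/-- Divergence of a vector field. -/
def divv {d : ℕ} (v : Spc d → Vec d) (x : Spc d) : ℝ := ∑ i, pd i (fun y => v y i) x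

/-- Row-wise divergence of a matrix field. -/
def divM {d : ℕ} (U : Spc d → Fin d → Fin d → ℝ) (x : Spc d) : Vec d :=
  fun i => ∑ j, pd j (fun y => U y i j) x

/-- Laplacian of a scalar field. -/
def lapS {d : ℕ} (f : Spc d → ℝ) (x : Spc d) : ℝ := ∑ i, pd i (pd i f) x

/-- Componentwise Laplacian of a vector field. -/
def lapV {d m : ℕ} (v : Spc d → Vec m) (x : Spc d) : Vec m :=
  fun a => lapS (fun y => v y a) x

/-- Tensor product `u ⊗ v` of vector fields. -/
def tens {d : ℕ} (u v : Spc d → Vec d) (x : Spc d) : Fin d → Fin d → ℝ :=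
  fun i j => u x i * v x j

/-- Curl of a three-dimensional vector field. -/
def curl3 (v : Spc 3 → Vec 3) (x : Spc 3) : Vec 3 :=
  ![pd 1 (fun y => v y 2) x - pd 2 (fun y => v y 1) x,
    pd 2 (fun y => v y 0) x - pd 0 (fun y => v y 2) x,
    pd 0 (fun y => v y 1) x - pd 1 (fun y => v y 0) x]

/-- Scalar curl of a planar vector field. -/
def curl2 (v : Spc 2 → Vec 2) (x : Spc 2) : ℝ :=
  pd 0 (fun y => v y 1) x - pd 1 (fun y => v y 0) x

/-- Smoothness (jointly in time and space) of a scalar field. -/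
def SmoothS {d : ℕ} (p : ℝ → Spc d → ℝ) : Prop :=
  ContDiff ℝ (⊤ : ℕ∞) fun q : ℝ × Spc d => p q.1 q.2

/-- Smoothness (jointly in time and space) of a vector field. -/
def SmoothV {d m : ℕ} (u : ℝ → Spc d → Vec m) : Prop :=
  ContDiff ℝ (⊤ : ℕ∞) fun q : ℝ × Spc d => u q.1 q.2

/-- Smoothness (jointly in time and space) of a matrix field. -/
def SmoothM {d m : ℕ} (U : ℝ → Spc d → Fin m → Fin m → ℝ) : Prop :=
  ContDiff ℝ (⊤ : ℕ∞) fun q : ℝ × Spc d => U q.1 q.2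

/-- Stress tensor `U = u ⊗ u − ∇u` of a Navier–Stokes solution. -/
def stress {d : ℕ} (u : ℝ → Spc d → Vec d) (t : ℝ) (x : Spc d) : Fin d → Fin d → ℝ :=
  fun i j => u t x i * u t x j - pd j (fun y => u t y i) x

/-- Smooth solution of the incompressible Navier–Stokes equations on the time set `I`. -/
structure IsNS (d : ℕ) (I : Set ℝ) (p : ℝ → Spc d → ℝ) (u : ℝ → Spc d → Vec d) :
    Prop where
  smooth_p : SmoothS p
  smooth_u : SmoothV u
  per_p : ∀ t, Per (p t)
  per_u : ∀ t, Per (u t)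
  div_free : ∀ t ∈ I, ∀ x, divv (u t) x = 0
  momentum : ∀ t ∈ I, ∀ x a,
    dtV u t x a + divM (tens (u t) (u t)) x a = -pd a (p t) x + lapV (u t) x a
  mean_zero : ∀ t ∈ I, ∫ x in cube d, p t x = 0

/-- The time interval `[0, Tl)`. -/
def Itv (Tl : ℝ≥0∞) : Set ℝ := {t : ℝ | 0 ≤ t ∧ ENNReal.ofReal t < Tl}

/-- Solution of the two-parameter relaxation system on the time interval `[0, Tl)`,
with smooth initial data. -/
structure IsRelax (d : ℕ) (ε δ : ℝ) (Tl : ℝ≥0∞) (p : ℝ → Spc d → ℝ)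
    (u : ℝ → Spc d → Vec d) (U : ℝ → Spc d → Fin d → Fin d → ℝ) : Prop where
  pos : 0 < Tl
  init_smooth : ContDiff ℝ (⊤ : ℕ∞) fun x : Spc d => (p 0 x, u 0 x, U 0 x)
  per_p : ∀ t ∈ Itv Tl, Per (p t)
  per_u : ∀ t ∈ Itv Tl, Per (u t)
  per_U : ∀ t ∈ Itv Tl, Per (U t)
  cont : ContinuousOn (fun q : ℝ × Spc d => (p q.1 q.2, u q.1 q.2, U q.1 q.2))
    (Itv Tl ×ˢ (Set.univ : Set (Spc d)))
  smooth : ∀ t ∈ Itv Tl, 0 < t → ∀ x : Spc d,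
    ContDiffAt ℝ (⊤ : ℕ∞) (fun q : ℝ × Spc d => (p q.1 q.2, u q.1 q.2, U q.1 q.2)) (t, x)
  mass : ∀ t ∈ Itv Tl, 0 < t → ∀ x, ε * dtS p t x + divv (u t) x = 0
  momentum : ∀ t ∈ Itv Tl, 0 < t → ∀ x a,
    dtV u t x a + divM (U t) x a + pd a (p t) x = 0
  stress_eq : ∀ t ∈ Itv Tl, 0 < t → ∀ x i j,
    δ * dtM U t x i j + pd j (fun y => u t y i) x = u t x i * u t x j - U t x i j

/-- Relaxation solution whose lifespan `Tl` is maximal (among solutions with the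
same initial data). -/
def IsMaxRelax (d : ℕ) (ε δ : ℝ) (Tl : ℝ≥0∞) (p : ℝ → Spc d → ℝ)
    (u : ℝ → Spc d → Vec d) (U : ℝ → Spc d → Fin d → Fin d → ℝ) : Prop :=
  IsRelax d ε δ Tl p u U ∧
    ∀ (Tl' : ℝ≥0∞) (p' : ℝ → Spc d → ℝ) (u' : ℝ → Spc d → Vec d)
      (U' : ℝ → Spc d → Fin d → Fin d → ℝ),
      IsRelax d ε δ Tl' p' u' U' → p' 0 = p 0 → u' 0 = u 0 → U' 0 = U 0 → Tl' ≤ Tl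

/-- Smooth solution of the intermediate affine system on `[0,T]`. -/
structure IsAffine (ε δ T : ℝ) (u : ℝ → Spc 3 → Vec 3) (p' : ℝ → Spc 3 → ℝ)
    (u' : ℝ → Spc 3 → Vec 3) (U' : ℝ → Spc 3 → Fin 3 → Fin 3 → ℝ) : Prop where
  smooth_p : SmoothS p'
  smooth_u : SmoothV u'
  smooth_U : SmoothM U'
  per_p : ∀ t, Per (p' t)
  per_u : ∀ t, Per (u' t)
  per_U : ∀ t, Per (U' t)
  mass : ∀ t ∈ Set.Icc (0 : ℝ) T, ∀ x, ε * dtS p' t x + divv (u' t) x = 0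
  momentum : ∀ t ∈ Set.Icc (0 : ℝ) T, ∀ x a,
    dtV u' t x a + divM (U' t) x a + pd a (p' t) x = 0
  stress_eq : ∀ t ∈ Set.Icc (0 : ℝ) T, ∀ x i j,
    δ * dtM U' t x i j + pd j (fun y => u' t y i) x = u t x i * u t x j - U' t x i j

/-- `A = curl ∇·(v ⊗ v)`. -/
def Af (v : Spc 3 → Vec 3) (x : Spc 3) : Vec 3 :=
  curl3 (fun y => divM (tens v v) y) x

/-- `K = 1 + ‖(p,u,U)‖²_{C⁰H³}`. -/
def Kc (T0 : ℝ) (p : ℝ → Spc 3 → ℝ) (u : ℝ → Spc 3 → Vec 3) : ℝ :=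
  1 + ⨆ t ∈ Set.Icc (0 : ℝ) T0, (H3sq (sc (p t)) + H3sq (u t) + H3sq (mtx (stress u t)))

/-- `K = 1 + ‖u‖²_{C⁰H³}`. -/
def Ku (T0 : ℝ) (u : ℝ → Spc 3 → Vec 3) : ℝ :=
  1 + ⨆ t ∈ Set.Icc (0 : ℝ) T0, H3sq (u t)

/-- The energy `E(t) = ‖W(t,·)‖²_{H¹} + (ε+δ)^a ‖∇²W(t,·)‖²_{L²}` of the rescaled
residual `W = (q, v, V) = (√ε(p^{ε,δ}−p), u^{ε,δ}−u, √δ(U^{ε,δ}−U))`. -/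
def resEnergyH1 (a ε δ : ℝ) (p : ℝ → Spc 3 → ℝ) (u : ℝ → Spc 3 → Vec 3)
    (pe : ℝ → Spc 3 → ℝ) (ue : ℝ → Spc 3 → Vec 3)
    (Ue : ℝ → Spc 3 → Fin 3 → Fin 3 → ℝ) (t : ℝ) : ℝ :=
  (H1sq (sc fun x => Real.sqrt ε * (pe t x - p t x))
      + H1sq (fun x (b : Fin 3) => ue t x b - u t x b)
      + H1sq (mtx fun x i j => Real.sqrt δ * (Ue t x i j - stress u t x i j)))
    + (ε + δ) ^ a *
      (D2L2sq (sc fun x => Real.sqrt ε * (pe t x - p t x))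
        + D2L2sq (fun x (b : Fin 3) => ue t x b - u t x b)
        + D2L2sq (mtx fun x i j => Real.sqrt δ * (Ue t x i j - stress u t x i j)))

section

open Set Filter Topology

lemma two_le_infty : (2 : WithTop ℕ∞) ≤ ((⊤ : ℕ∞) : WithTop ℕ∞) :=
  WithTop.coe_le_coe.2 (le_top : (2 : ℕ∞) ≤ ⊤)

/-- The algebra of smooth `ℤ³`-periodic scalar fields on `ℝ³`. -/
def SPA : Subalgebra ℝ (Spc 3 → ℝ) where
  carrier := {f | ContDiff ℝ (⊤ : ℕ∞) f ∧ Per f}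
  mul_mem' := fun {f g} hf hg => ⟨hf.1.mul hg.1, fun x k => by
    simp only [Pi.mul_apply]; rw [hf.2 x k, hg.2 x k]⟩
  add_mem' := fun {f g} hf hg => ⟨hf.1.add hg.1, fun x k => by
    simp only [Pi.add_apply]; rw [hf.2 x k, hg.2 x k]⟩
  algebraMap_mem' := fun r => ⟨contDiff_const, fun _ _ => rfl⟩

namespace SPA

lemma contDiff (f : SPA) : ContDiff ℝ (⊤ : ℕ∞) f.1 := f.2.1

lemma per (f : SPA) : Per f.1 := f.2.2

lemma differentiable (f : SPA) : Differentiable ℝ f.1 := (SPA.contDiff f).differentiable (by simp)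

lemma continuous (f : SPA) : Continuous f.1 := (SPA.contDiff f).continuous

@[simp] lemma add_val (f g : SPA) (x : Spc 3) : (f + g).1 x = f.1 x + g.1 x := rfl
@[simp] lemma sub_val (f g : SPA) (x : Spc 3) : (f - g).1 x = f.1 x - g.1 x := rfl
@[simp] lemma neg_val (f : SPA) (x : Spc 3) : (-f).1 x = -f.1 x := rfl
@[simp] lemma mul_val (f g : SPA) (x : Spc 3) : (f * g).1 x = f.1 x * g.1 x := rfl
@[simp] lemma smul_val (c : ℝ) (f : SPA) (x : Spc 3) : (c • f).1 x = c * f.1 x := rfl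
@[simp] lemma one_val (x : Spc 3) : (1 : SPA).1 x = 1 := rfl
@[simp] lemma zero_val (x : Spc 3) : (0 : SPA).1 x = 0 := rfl

lemma sum_val {ι : Type*} (s : Finset ι) (f : ι → SPA) (x : Spc 3) :
    (∑ i ∈ s, f i).1 x = ∑ i ∈ s, (f i).1 x := by
  induction s using Finset.cons_induction with
  | empty => rfl
  | cons a s ha ih => rw [Finset.sum_cons, Finset.sum_cons, add_val, ih]

lemma ext' {f g : SPA} (h : ∀ x, f.1 x = g.1 x) : f = g := Subtype.ext (funext h)

end SPA

lemma per_pd {f : Spc 3 → ℝ} (hp : Per f) (i : Fin 3) : Per (pd i f) := by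
  intro x k
  have h : (fun y : Spc 3 => f (y + fun i => (k i : ℝ))) = f := funext fun y => hp y k
  have h2 := fderiv_comp_add_right (𝕜 := ℝ) (f := f) (x := x) (fun i => (k i : ℝ))
  rw [h] at h2
  unfold pd
  rw [h2]
  rfl

lemma contDiff_pd {f : Spc 3 → ℝ} (hf : ContDiff ℝ (⊤ : ℕ∞) f) (i : Fin 3) :
    ContDiff ℝ (⊤ : ℕ∞) (pd i f) :=
  (hf.fderiv_right (m := (⊤ : ℕ∞)) (by simp)).clm_apply contDiff_const

/-- Partial derivative as an operator on smooth periodic fields. -/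
def D (i : Fin 3) : SPA →ₗ[ℝ] SPA where
  toFun f := ⟨pd i f.1, contDiff_pd (SPA.contDiff f) i, per_pd (SPA.per f) i⟩
  map_add' f g := SPA.ext' fun x => by
    have := fderiv_add ((SPA.differentiable f) x) ((SPA.differentiable g) x)
    change fderiv ℝ (f.1 + g.1) x _ = fderiv ℝ f.1 x _ + fderiv ℝ g.1 x _
    rw [this]; rfl
  map_smul' c f := SPA.ext' fun x => by
    have := fderiv_const_smul ((SPA.differentiable f) x) c
    change fderiv ℝ (c • f.1) x _ = c * fderiv ℝ f.1 x _
    rw [this]; rfl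

lemma D_val (i : Fin 3) (f : SPA) : (D i f).1 = pd i f.1 := rfl

lemma D_mul (i : Fin 3) (f g : SPA) : D i (f * g) = D i f * g + f * D i g :=
  SPA.ext' fun x => by
    have := fderiv_mul ((SPA.differentiable f) x) ((SPA.differentiable g) x)
    change fderiv ℝ (f.1 * g.1) x _ = fderiv ℝ f.1 x _ * g.1 x + f.1 x * fderiv ℝ g.1 x _
    rw [this]
    simp only [add_apply, smul_apply, smul_eq_mul]
    ring

lemma D_one (i : Fin 3) : D i 1 = 0 := by
  have := D_mul i 1 1
  simpa using this

/-- Iterated directional derivatives along constant vectors commute. -/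
lemma fderiv_apply_comm {E : Type*} [NormedAddCommGroup E] [NormedSpace ℝ E] {f : E → ℝ} {x : E}
    (hf : ContDiffAt ℝ (⊤ : ℕ∞) f x) (a b : E) :
    fderiv ℝ (fun y => fderiv ℝ f y a) x b = fderiv ℝ (fun y => fderiv ℝ f y b) x a := by
  have hs : IsSymmSndFDerivAt ℝ f x := hf.isSymmSndFDerivAt (by simp; exact two_le_infty)
  have hd : DifferentiableAt ℝ (fderiv ℝ f) x :=
    (hf.fderiv_right (m := 1) (by norm_num; exact two_le_infty)).differentiableAt (by simp)
  have key : ∀ c d : E, fderiv ℝ (fun y => fderiv ℝ f y c) x d = fderiv ℝ (fderiv ℝ f) x d c := by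
    intro c d
    rw [fderiv_clm_apply hd (differentiableAt_const c)]
    simp
  rw [key, key]
  exact hs.eq b a

lemma D_comm (i j : Fin 3) (f : SPA) : D i (D j f) = D j (D i f) :=
  SPA.ext' fun _ => fderiv_apply_comm (SPA.contDiff f).contDiffAt _ _

lemma isCompact_cube : IsCompact (cube 3) := isCompact_univ_pi fun _ => isCompact_Icc

lemma measurableSet_cube : MeasurableSet (cube 3) :=
  MeasurableSet.univ_pi fun _ => measurableSet_Icc

lemma volume_cube : volume (cube 3) = 1 := by
  rw [cube, volume_pi_pi]; simp

lemma cube_eq_Icc : cube 3 = Set.Icc 0 1 := by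
  ext x; simp [cube, Pi.le_def]

instance : IsProbabilityMeasure (volume.restrict (cube 3)) :=
  ⟨by rw [Measure.restrict_apply_univ, volume_cube]⟩

lemma integrableOn_cube {f : Spc 3 → ℝ} (hf : Continuous f) :
    Integrable f (volume.restrict (cube 3)) :=
  hf.continuousOn.integrableOn_compact isCompact_cube

/-- Integral over the torus. -/
def I : SPA →ₗ[ℝ] ℝ where
  toFun f := ∫ x in cube 3, f.1 x
  map_add' f g := integral_add (integrableOn_cube (SPA.continuous f)) (integrableOn_cube (SPA.continuous g))
  map_smul' c _ := integral_const_mul c _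

lemma I_def (f : SPA) : I f = ∫ x in cube 3, f.1 x := rfl

lemma I_one : I 1 = 1 := by
  simp [I_def]

lemma I_mono {f g : SPA} (h : ∀ x, f.1 x ≤ g.1 x) : I f ≤ I g :=
  integral_mono (integrableOn_cube (SPA.continuous f)) (integrableOn_cube (SPA.continuous g)) h

lemma I_nonneg {f : SPA} (h : ∀ x, 0 ≤ f.1 x) : 0 ≤ I f := integral_nonneg h

/-- Translation of a smooth periodic field. -/
def shift (h : Spc 3) (f : SPA) : SPA :=
  ⟨fun x => f.1 (x + h), (SPA.contDiff f).comp (contDiff_id.add contDiff_const), fun x k => by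
    change f.1 _ = f.1 _
    rw [← (SPA.per f) (x + h) k]
    refine congrArg f.1 (funext fun i => ?_)
    simp only [Pi.add_apply]
    ring⟩

@[simp] lemma shift_val (h : Spc 3) (f : SPA) (x : Spc 3) : (shift h f).1 x = f.1 (x + h) := rfl

open scoped Pointwise in
lemma I_shift (h : Spc 3) (f : SPA) : I (shift h f) = I f := by
  set b := Pi.basisFun ℝ (Fin 3)
  have hD : IsAddFundamentalDomain (Submodule.span ℤ (Set.range b)).toAddSubgroup (ZSpan.fundamentalDomain b)
    (volume : Measure (Spc 3)) := ZSpan.isAddFundamentalDomain' b volume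
  have hcube : (cube 3) =ᵐ[volume] ZSpan.fundamentalDomain b := by
    rw [ZSpan.fundamentalDomain_pi_basisFun]
    rw [cube_eq_Icc]
    exact Measure.univ_pi_Ico_ae_eq_Icc.symm
  have hinv : ∀ (g : (Submodule.span ℤ (Set.range b)).toAddSubgroup) (x : Spc 3), f.1 (g +ᵥ x) = f.1 x := by
    intro g x
    have hg := (b.mem_span_iff_repr_mem ℤ g.1).1 g.2
    choose k hk using hg
    rw [← (SPA.per f) x k]
    refine congrArg f.1 (funext fun i => ?_)
    have := hk i
    simp [b] at this
    rw [this]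
    change g.1 i + x i = _
    ring
  have : Countable (Submodule.span ℤ (Set.range b)).toAddSubgroup :=
    inferInstanceAs (Countable (Submodule.span ℤ (Set.range b)))
  have h1 : ∫ x in ZSpan.fundamentalDomain b, f.1 x = ∫ x in h +ᵥ ZSpan.fundamentalDomain b, f.1 x :=
    hD.setIntegral_eq (hD.vadd_of_comm h) hinv
  have h2 : ∫ x in ZSpan.fundamentalDomain b, f.1 (x + h)
      = ∫ x in h +ᵥ ZSpan.fundamentalDomain b, f.1 x := by
    have hm := (measurePreserving_add_right (volume : Measure (Spc 3)) h).setIntegral_image_emb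
      (measurableEmbedding_addRight h) f.1 (ZSpan.fundamentalDomain b)
    rw [← hm]
    congr 2
    ext y
    simp only [Set.mem_image, Set.mem_vadd_set, vadd_eq_add, add_comm h]
  rw [I_def, I_def, setIntegral_congr_set hcube, setIntegral_congr_set hcube, h1, ← h2]
  rfl

/-- Differentiation under the integral over the cell. -/
lemma hasDerivAt_integral_cube {O : Set ℝ} (hO : IsOpen O) {G : ℝ → Spc 3 → ℝ}
    (hG : ContDiffOn ℝ 1 (Function.uncurry G) (O ×ˢ univ)) {t : ℝ} (ht : t ∈ O) :
    HasDerivAt (fun s => ∫ x in cube 3, G s x)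
      (∫ x in cube 3, deriv (fun s => G s x) t) t := by
  have hOpen : IsOpen (O ×ˢ (univ : Set (Spc 3))) := hO.prod isOpen_univ
  have hcd : ∀ s ∈ O, ∀ x, ContDiffAt ℝ 1 (Function.uncurry G) (s, x) := fun s hs x =>
    hG.contDiffAt (hOpen.mem_nhds ⟨hs, trivial⟩)
  have hder : ∀ s ∈ O, ∀ x, HasDerivAt (fun r => G r x)
      (fderiv ℝ (Function.uncurry G) (s, x) (1, 0)) s := by
    intro s hs x
    have h1 := ((hcd s hs x).differentiableAt one_ne_zero).hasFDerivAt
    have h2 : HasDerivAt (fun r : ℝ => (r, x)) ((1 : ℝ), (0 : Spc 3)) s :=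
      (hasDerivAt_id s).prodMk (hasDerivAt_const s x)
    exact h1.comp_hasDerivAt s h2
  have hdc : ContinuousOn (fun z : ℝ × Spc 3 => fderiv ℝ (Function.uncurry G) z (1, 0))
      (O ×ˢ univ) := by
    have := hG.continuousOn_fderiv_of_isOpen hOpen le_rfl
    exact this.clm_apply continuousOn_const
  have hcont : ∀ s ∈ O, Continuous (G s) := fun s hs => by
    rw [← continuousOn_univ]
    exact hG.continuousOn.comp (f := fun x => (s, x)) (by fun_prop) fun x _ => ⟨hs, trivial⟩
  obtain ⟨r, hr, hrO⟩ := Metric.isOpen_iff.1 hO t ht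
  set K := Metric.closedBall t (r / 2)
  have hKO : K ⊆ O := (Metric.closedBall_subset_ball (by linarith)).trans hrO
  have hKc : IsCompact (K ×ˢ cube 3) := (isCompact_closedBall t (r / 2)).prod isCompact_cube
  obtain ⟨M, hM⟩ := hKc.exists_bound_of_continuousOn
    (hdc.mono (Set.prod_mono hKO (Set.subset_univ _)))
  have key := hasDerivAt_integral_of_dominated_loc_of_deriv_le (μ := volume.restrict (cube 3))
    (F := G) (F' := fun s x => fderiv ℝ (Function.uncurry G) (s, x) (1, 0)) (x₀ := t)
    (s := K) (bound := fun _ => M) (Metric.closedBall_mem_nhds t (by linarith))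
    (by
      filter_upwards [hO.mem_nhds ht] with s hs
      exact (hcont s hs).aestronglyMeasurable)
    (integrableOn_cube (hcont t ht))
    (by
      refine Continuous.aestronglyMeasurable ?_
      rw [← continuousOn_univ]
      exact hdc.comp (f := fun x => (t, x)) (by fun_prop) fun x _ => ⟨ht, trivial⟩)
    (by
      filter_upwards [ae_restrict_mem measurableSet_cube] with x hx s hs
      exact hM (s, x) ⟨hs, hx⟩)
    (integrable_const M)
    (by
      filter_upwards with x s hs
      exact hder s (hKO hs) x)
  exact key.2.congr_deriv
    (integral_congr_ae (Eventually.of_forall fun x => (hder t ht x).deriv.symm))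

lemma fderiv_eq_sum_D (f : SPA) (x h : Spc 3) : fderiv ℝ f.1 x h = ∑ i, h i * (D i f).1 x := by
  have : h = ∑ i, h i • (Pi.single i (1 : ℝ) : Spc 3) := by
    funext j
    simp [Finset.sum_apply, Pi.single_apply]
  conv_lhs => rw [this]
  rw [map_sum]
  simp [D_val, pd]

lemma hasDerivAt_ray (f : SPA) (x h : Spc 3) (s : ℝ) :
    HasDerivAt (fun r : ℝ => f.1 (x + r • h)) (∑ i, h i * (D i f).1 (x + s • h)) s := by
  rw [← fderiv_eq_sum_D]
  have h1 := ((SPA.differentiable f) (x + s • h)).hasFDerivAt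
  have h2 : HasDerivAt (fun r : ℝ => x + r • h) h s := by
    simpa using ((hasDerivAt_id s).smul_const h).const_add x
  exact h1.comp_hasDerivAt s h2

lemma I_D (i : Fin 3) (f : SPA) : I (D i f) = 0 := by
  set e : Spc 3 := Pi.single i 1
  have h1 := hasDerivAt_integral_cube isOpen_univ (G := fun s x => f.1 (x + s • e)) (t := 0)
    (((SPA.contDiff f).of_le (by exact one_le_two.trans two_le_infty)).comp
      (by fun_prop : ContDiff ℝ 1 fun z : ℝ × Spc 3 => z.2 + z.1 • e)).contDiffOn trivial
  have h2 : (fun s : ℝ => ∫ x in cube 3, f.1 (x + s • e)) = fun _ => I f :=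
    funext fun s => I_shift (s • e) f
  rw [h2] at h1
  have h3 := h1.unique (hasDerivAt_const _ _)
  rw [← h3, I_def]
  congr 1
  funext x
  rw [(hasDerivAt_ray f x e 0).deriv]
  simp [e, Pi.single_apply]

lemma I_mul_D (i : Fin 3) (f g : SPA) : I (f * D i g) = -I (D i f * g) := by
  have := I_D i (f * g)
  rw [D_mul, map_add] at this
  linarith

lemma I_sq_nonneg (f : SPA) : 0 ≤ I (f * f) := I_nonneg fun _ => mul_self_nonneg _

lemma I_cauchy_schwarz (f g : SPA) : I (f * g) ^ 2 ≤ I (f * f) * I (g * g) := by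
  have key : ∀ s : ℝ, 0 ≤ I (g * g) * (s * s) + (2 * I (f * g)) * s + I (f * f) := by
    intro s
    have h := I_sq_nonneg (f + s • g)
    have e : (f + s • g) * (f + s • g) = f * f + (2 * s) • (f * g) + (s * s) • (g * g) :=
      SPA.ext' fun x => by simp; ring
    rw [e, map_add, map_add, map_smul, map_smul, smul_eq_mul, smul_eq_mul] at h
    linarith
  have := discrim_le_zero key
  unfold discrim at this
  nlinarith

/-- Poincaré inequality for mean-zero fields. -/
lemma poincare (f : SPA) (hf : I f = 0) : I (f * f) ≤ 3 * ∑ i, I (D i f * D i f) := by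
  set G := 3 * ∑ i, I (D i f * D i f) with hG
  have hshift : ∀ h ∈ cube 3, I ((shift h f - f) * (shift h f - f)) ≤ 2 * G := by
    intro h hh
    have hh' : ∀ i, |h i| ≤ 1 := fun i => by
      have := hh i trivial
      rw [abs_le]; constructor <;> linarith [this.1, this.2]
    set φ : ℝ → ℝ := fun s => ∫ x in cube 3, (f.1 (x + s • h) - f.1 x) ^ 2
    set φ' : ℝ → ℝ := fun s => ∫ x in cube 3,
      2 * (f.1 (x + s • h) - f.1 x) * ∑ i, h i * (D i f).1 (x + s • h)
    have hφ : ∀ s, HasDerivAt φ (φ' s) s := by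
      intro s
      have h1 := hasDerivAt_integral_cube isOpen_univ
        (G := fun s x => (f.1 (x + s • h) - f.1 x) ^ 2) (t := s)
        (by
          have hc : ContDiff ℝ 1 f.1 := (SPA.contDiff f).of_le (one_le_two.trans two_le_infty)
          have ha : ContDiff ℝ 1 fun z : ℝ × Spc 3 => f.1 (z.2 + z.1 • h) :=
            hc.comp (by fun_prop)
          have hb : ContDiff ℝ 1 fun z : ℝ × Spc 3 => f.1 z.2 := hc.comp (by fun_prop)
          exact ((ha.sub hb).pow 2).contDiffOn) trivial
      convert h1 using 3 with x
      have := ((hasDerivAt_ray f x h s).sub_const (f.1 x)).pow 2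
      refine Eq.symm ((HasDerivAt.deriv (f := fun s => (f.1 (x + s • h) - f.1 x) ^ 2) this).trans ?_)
      simp
    have hbd : ∀ s, φ' s ≤ φ s + G := by
      intro s
      have : G = I (shift (s • h) (3 * ∑ i, D i f * D i f)) := by
        rw [I_shift, hG]
        have : (3 : SPA) * ∑ i, D i f * D i f = (3 : ℝ) • ∑ i, D i f * D i f := by
          refine SPA.ext' fun x => ?_
          rfl
        rw [this, map_smul, map_sum, smul_eq_mul]
      have e : φ s = I ((shift (s • h) f - f) * (shift (s • h) f - f)) := by
        rw [I_def]
        refine integral_congr_ae (Eventually.of_forall fun x => ?_)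
        simp [pow_two]
      rw [this, e, ← map_add, I_def]
      refine integral_mono (integrableOn_cube ?_) (integrableOn_cube (SPA.continuous _)) ?_
      · have c1 := SPA.continuous f
        have c2 : ∀ i, Continuous (D i f).1 := fun i => SPA.continuous _
        fun_prop
      · intro x
        have c3 : (3 : SPA).1 (x + s • h) = 3 := rfl
        simp only [SPA.add_val, SPA.mul_val, SPA.sub_val, shift_val, SPA.sum_val, c3]
        have h0 := abs_le.1 (hh' 0)
        have h1 := abs_le.1 (hh' 1)
        have h2 := abs_le.1 (hh' 2)
        simp only [Fin.sum_univ_three]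
        set d0 := (D 0 f).1 (x + s • h)
        set d1 := (D 1 f).1 (x + s • h)
        set d2 := (D 2 f).1 (x + s • h)
        set w := f.1 (x + s • h) - f.1 x
        have q0 : (h 0) ^ 2 ≤ 1 := by nlinarith
        have q1 : (h 1) ^ 2 ≤ 1 := by nlinarith
        have q2 : (h 2) ^ 2 ≤ 1 := by nlinarith
        have a0 := mul_le_mul_of_nonneg_right q0 (sq_nonneg d0)
        have a1 := mul_le_mul_of_nonneg_right q1 (sq_nonneg d1)
        have a2 := mul_le_mul_of_nonneg_right q2 (sq_nonneg d2)
        nlinarith [sq_nonneg (w - (h 0 * d0 + h 1 * d1 + h 2 * d2)),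
          sq_nonneg (h 0 * d0 - h 1 * d1), sq_nonneg (h 0 * d0 - h 2 * d2),
          sq_nonneg (h 1 * d1 - h 2 * d2)]
    have hmono : Antitone fun s => (φ s + G) * Real.exp (-s) := by
      have hd : ∀ s, HasDerivAt (fun s => (φ s + G) * Real.exp (-s))
          (φ' s * Real.exp (-s) + (φ s + G) * (Real.exp (-s) * -1)) s := fun s =>
        ((hφ s).add_const G).mul ((Real.hasDerivAt_exp _).comp s (hasDerivAt_neg s))
      refine antitone_of_deriv_nonpos (fun s => (hd s).differentiableAt) fun s => ?_
      rw [(hd s).deriv]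
      nlinarith [Real.exp_pos (-s), hbd s]
    have h01 := hmono (zero_le_one : (0 : ℝ) ≤ 1)
    have hφ0 : φ 0 = 0 := by simp [φ]
    have hφ1 : φ 1 = I ((shift h f - f) * (shift h f - f)) := by
      rw [I_def]
      refine integral_congr_ae (Eventually.of_forall fun x => ?_)
      simp [pow_two]
    simp only [hφ0, hφ1, zero_add, neg_zero, Real.exp_zero, mul_one] at h01
    have hG0 : 0 ≤ G := by
      rw [hG]
      exact mul_nonneg (by norm_num) (Finset.sum_nonneg fun i _ => I_sq_nonneg _)
    rw [Real.exp_neg, ← div_eq_mul_inv, div_le_iff₀ (Real.exp_pos 1)] at h01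
    have := Real.exp_one_lt_d9
    nlinarith
  have hswap : ∫ x in cube 3, ∫ h in cube 3, (f.1 (x + h) - f.1 x) ^ 2
      = ∫ h in cube 3, ∫ x in cube 3, (f.1 (x + h) - f.1 x) ^ 2 := by
    refine integral_integral_swap ?_
    rw [Measure.prod_restrict]
    refine ContinuousOn.integrableOn_compact (isCompact_cube.prod isCompact_cube) ?_
    have c1 := SPA.continuous f
    refine Continuous.continuousOn ?_
    change Continuous fun z : Spc 3 × Spc 3 => (f.1 (z.1 + z.2) - f.1 z.1) ^ 2
    fun_prop
  have hleft : ∀ x, ∫ h in cube 3, (f.1 (x + h) - f.1 x) ^ 2 = I (f * f) + f.1 x ^ 2 := by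
    intro x
    have : ∫ h in cube 3, (f.1 (x + h) - f.1 x) ^ 2
        = I (shift x (f * f) - (2 * f.1 x) • shift x f + (f.1 x ^ 2) • 1) := by
      rw [I_def]
      refine integral_congr_ae (Eventually.of_forall fun h => ?_)
      simp only [SPA.add_val, SPA.sub_val, SPA.smul_val, SPA.one_val, shift_val, SPA.mul_val]
      rw [add_comm h x]
      ring
    rw [this, map_add, map_sub, map_smul, map_smul, I_shift, I_shift, hf, I_one]
    simp
  have hl : ∫ x in cube 3, ∫ h in cube 3, (f.1 (x + h) - f.1 x) ^ 2 = 2 * I (f * f) := by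
    simp_rw [hleft]
    have : ∫ x in cube 3, (I (f * f) + f.1 x ^ 2) = I (I (f * f) • 1 + f * f) := by
      rw [I_def]
      refine integral_congr_ae (Eventually.of_forall fun h => ?_)
      simp [pow_two]
    rw [this, map_add, map_smul, I_one]
    simp; ring
  have hr : ∫ h in cube 3, ∫ x in cube 3, (f.1 (x + h) - f.1 x) ^ 2 ≤ 2 * G := by
    have hc : Continuous fun h : Spc 3 => ∫ x in cube 3, (f.1 (x + h) - f.1 x) ^ 2 := by
      refine continuous_parametric_integral_of_continuous ?_ isCompact_cube
      have c1 := SPA.continuous f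
      change Continuous fun z : Spc 3 × Spc 3 => (f.1 (z.2 + z.1) - f.1 z.2) ^ 2
      fun_prop
    calc ∫ h in cube 3, ∫ x in cube 3, (f.1 (x + h) - f.1 x) ^ 2
        ≤ ∫ h in cube 3, 2 * G := by
          refine setIntegral_mono_on (integrableOn_cube hc) (integrable_const _)
            measurableSet_cube fun h hh => ?_
          have := hshift h hh
          rw [I_def] at this
          simpa [pow_two] using this
      _ = 2 * G := by simp
  rw [hswap] at hl
  linarith

lemma abs_le_of_deriv_le_rpow_neg_three_halves {A A' : ℝ → ℝ} {G : ℝ}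
    (hA : ∀ s ∈ Ioc (0 : ℝ) 1, HasDerivAt A (A' s) s)
    (hb : ∀ s ∈ Ioc (0 : ℝ) 1, |A' s| ≤ G / (s * √s)) {r : ℝ} (hr : r ∈ Ioc (0 : ℝ) 1) :
    |A r| ≤ |A 1| + 2 * G / √r := by
  have hG : 0 ≤ G := by
    have := (abs_nonneg _).trans (hb 1 ⟨one_pos, le_rfl⟩)
    simpa using this
  have hd : ∀ s ∈ Ioc (0 : ℝ) 1, HasDerivAt (fun s => 2 * G * (√s)⁻¹) (-(G / (s * √s))) s := by
    intro s hs
    have hs0 : 0 < √s := Real.sqrt_pos.2 hs.1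
    have := (((Real.hasDerivAt_sqrt hs.1.ne').inv hs0.ne').const_mul (2 * G))
    refine this.congr_deriv ?_
    have e : √s ^ 2 = s := Real.sq_sqrt hs.1.le
    rw [e]
    field_simp
  have aux : ∀ σ : ℝ, |σ| = 1 → σ * A r ≤ |A 1| + 2 * G / √r := by
    intro σ hσ
    have hder : ∀ s ∈ Ioc (0 : ℝ) 1, HasDerivAt (fun s => σ * A s - 2 * G * (√s)⁻¹)
        (σ * A' s - -(G / (s * √s))) s := fun s hs => ((hA s hs).const_mul σ).sub (hd s hs)
    have hmono : MonotoneOn (fun s => σ * A s - 2 * G * (√s)⁻¹) (Icc r 1) := by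
      refine monotoneOn_of_deriv_nonneg (convex_Icc _ _) ?_ ?_ ?_
      · exact fun s hs => (hder s ⟨hr.1.trans_le hs.1, hs.2⟩).continuousAt.continuousWithinAt
      · intro s hs
        rw [interior_Icc] at hs
        exact (hder s ⟨hr.1.trans hs.1, hs.2.le⟩).differentiableAt.differentiableWithinAt
      · intro s hs
        rw [interior_Icc] at hs
        have hs' : s ∈ Ioc (0 : ℝ) 1 := ⟨hr.1.trans hs.1, hs.2.le⟩
        rw [(hder s hs').deriv]
        have h1 := hb s hs'
        have h2 : |σ * A' s| ≤ G / (s * √s) := by rw [abs_mul, hσ, one_mul]; exact h1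
        linarith [neg_le_of_abs_le h2]
    have h := hmono ⟨le_rfl, hr.2⟩ ⟨hr.2, le_rfl⟩ hr.2
    have h3 : σ * A 1 ≤ |A 1| := by
      calc σ * A 1 ≤ |σ * A 1| := le_abs_self _
        _ = |A 1| := by rw [abs_mul, hσ, one_mul]
    simp only [Real.sqrt_one, inv_one, mul_one] at h
    rw [div_eq_mul_inv]
    linarith
  rw [abs_le]
  constructor
  · have := aux (-1) (by simp)
    linarith
  · have := aux 1 (by simp)
    linarith

lemma abs_le_of_deriv_le_rpow_neg_half {A A' : ℝ → ℝ} {G R : ℝ} (hR : 0 < R)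
    (hc : ContinuousOn A (Icc 0 R)) (hA : ∀ s ∈ Ioo (0 : ℝ) R, HasDerivAt A (A' s) s)
    (hb : ∀ s ∈ Ioo (0 : ℝ) R, |A' s| ≤ G / √s) :
    |A 0| ≤ |A R| + 2 * G * √R := by
  have hd : ∀ s ∈ Ioo (0 : ℝ) R, HasDerivAt (fun s => 2 * G * √s) (G / √s) s := by
    intro s hs
    have hs0 : 0 < √s := Real.sqrt_pos.2 hs.1
    refine ((Real.hasDerivAt_sqrt hs.1.ne').const_mul (2 * G)).congr_deriv ?_
    field_simp
  have aux : ∀ σ : ℝ, |σ| = 1 → σ * A 0 ≤ |A R| + 2 * G * √R := by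
    intro σ hσ
    have hder : ∀ s ∈ Ioo (0 : ℝ) R, HasDerivAt (fun s => σ * A s + 2 * G * √s)
        (σ * A' s + G / √s) s := fun s hs => ((hA s hs).const_mul σ).add (hd s hs)
    have hmono : MonotoneOn (fun s => σ * A s + 2 * G * √s) (Icc 0 R) := by
      refine monotoneOn_of_deriv_nonneg (convex_Icc _ _) ?_ ?_ ?_
      · exact (continuousOn_const.mul hc).add (by fun_prop)
      · intro s hs
        rw [interior_Icc] at hs
        exact (hder s hs).differentiableAt.differentiableWithinAt
      · intro s hs
        rw [interior_Icc] at hs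
        rw [(hder s hs).deriv]
        have h1 := hb s hs
        have h2 : |σ * A' s| ≤ G / √s := by rw [abs_mul, hσ, one_mul]; exact h1
        linarith [neg_le_of_abs_le h2]
    have h := hmono ⟨le_rfl, hR.le⟩ ⟨hR.le, le_rfl⟩ hR.le
    have h3 : σ * A R ≤ |A R| := by
      calc σ * A R ≤ |σ * A R| := le_abs_self _
        _ = |A R| := by rw [abs_mul, hσ, one_mul]
    simp only [Real.sqrt_zero, mul_zero, add_zero] at h
    linarith
  rw [abs_le]
  constructor
  · have := aux (-1) (by simp)
    linarith
  · have := aux 1 (by simp)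
    linarith

lemma abs_integral_cube_le_sqrt {h : Spc 3 → ℝ} (hc : Continuous h) :
    |∫ y in cube 3, h y| ≤ √(∫ y in cube 3, h y ^ 2) := by
  set m := ∫ y in cube 3, h y with hm
  have h0 : 0 ≤ ∫ y in cube 3, (h y - m) ^ 2 := integral_nonneg fun y => sq_nonneg _
  have e : ∫ y in cube 3, (h y - m) ^ 2 = (∫ y in cube 3, h y ^ 2) - m ^ 2 := by
    have : ∀ y, (h y - m) ^ 2 = h y ^ 2 - (2 * m) * h y + m ^ 2 := fun y => by ring
    simp_rw [this]
    rw [integral_add, integral_sub, integral_const_mul, ← hm]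
    · simp; ring
    · exact integrableOn_cube (by fun_prop)
    · exact integrableOn_cube (by fun_prop)
    · exact integrableOn_cube (by fun_prop)
    · exact integrableOn_cube (by fun_prop)
  exact Real.abs_le_sqrt (by linarith)

open scoped Pointwise in
lemma integral_sq_scaled_le (g : SPA) (x : Spc 3) {s : ℝ} (hs : s ∈ Ioc (0 : ℝ) 1) :
    ∫ y in cube 3, g.1 (x + s • y) ^ 2 ≤ I (g * g) / s ^ 3 := by
  have h1 := Measure.setIntegral_comp_smul_of_pos (volume : Measure (Spc 3))
    (fun y => g.1 (x + y) ^ 2) (cube 3) hs.1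
  rw [h1]
  have h2 : ∫ y in s • cube 3, g.1 (x + y) ^ 2 ≤ ∫ y in cube 3, g.1 (x + y) ^ 2 := by
    have c := SPA.continuous g
    refine setIntegral_mono_set (integrableOn_cube (by fun_prop))
      (Eventually.of_forall fun y => sq_nonneg _) (LE.le.eventuallyLE ?_)
    rintro _ ⟨y, hy, rfl⟩ i -
    have := hy i trivial
    simp only [Pi.smul_apply, smul_eq_mul]
    exact ⟨mul_nonneg hs.1.le this.1, mul_le_one₀ hs.2 this.1 this.2⟩
  have h3 : ∫ y in cube 3, g.1 (x + y) ^ 2 = I (g * g) := by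
    rw [← I_shift x (g * g), I_def]
    refine integral_congr_ae (Eventually.of_forall fun y => ?_)
    simp [pow_two, add_comm x]
  rw [h3] at h2
  simp only [Module.finrank_fintype_fun_eq_card, Fintype.card_fin, smul_eq_mul]
  rw [inv_mul_eq_div]
  exact div_le_div_of_nonneg_right h2 (pow_nonneg hs.1.le 3)

lemma abs_weighted_mean_le (g : SPA) (x : Spc 3) {φ : Spc 3 → ℝ} (hφ : Continuous φ)
    (hφ1 : ∀ y ∈ cube 3, |φ y| ≤ 1) {s : ℝ} (hs : s ∈ Ioc (0 : ℝ) 1) :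
    |∫ y in cube 3, φ y * g.1 (x + s • y)| ≤ √(I (g * g)) / (s * √s) := by
  have c := SPA.continuous g
  have h1 := abs_integral_cube_le_sqrt (h := fun y => φ y * g.1 (x + s • y)) (by fun_prop)
  have h2 : ∫ y in cube 3, (φ y * g.1 (x + s • y)) ^ 2 ≤ ∫ y in cube 3, g.1 (x + s • y) ^ 2 := by
    refine setIntegral_mono_on (integrableOn_cube (by fun_prop)) (integrableOn_cube (by fun_prop))
      measurableSet_cube fun y hy => ?_
    rw [mul_pow]
    have : φ y ^ 2 ≤ 1 := by rw [sq_le_one_iff_abs_le_one]; exact hφ1 y hy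
    nlinarith [sq_nonneg (g.1 (x + s • y))]
  have h3 := integral_sq_scaled_le g x hs
  have hs0 := hs.1
  calc _ ≤ √(I (g * g) / s ^ 3) := h1.trans (Real.sqrt_le_sqrt (h2.trans h3))
    _ = √(I (g * g)) / √(s ^ 3) := Real.sqrt_div (I_sq_nonneg g) _
    _ = _ := by
      congr 1
      rw [show s ^ 3 = s ^ 2 * s by ring, Real.sqrt_mul (by positivity), Real.sqrt_sq hs0.le]

lemma hasDerivAt_weighted_mean (g : SPA) (x : Spc 3) {φ : Spc 3 → ℝ} (hφ : ContDiff ℝ 1 φ)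
    (s : ℝ) : HasDerivAt (fun s => ∫ y in cube 3, φ y * g.1 (x + s • y))
      (∑ i, ∫ y in cube 3, (φ y * y i) * (D i g).1 (x + s • y)) s := by
  have h1 := hasDerivAt_integral_cube isOpen_univ
    (G := fun s y => φ y * g.1 (x + s • y)) (t := s)
    (by
      have hc : ContDiff ℝ 1 g.1 := (SPA.contDiff g).of_le (one_le_two.trans two_le_infty)
      have ha : ContDiff ℝ 1 fun z : ℝ × Spc 3 => g.1 (x + z.1 • z.2) := hc.comp (by fun_prop)
      have hb : ContDiff ℝ 1 fun z : ℝ × Spc 3 => φ z.2 := hφ.comp (by fun_prop)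
      exact (hb.mul ha).contDiffOn) trivial
  refine h1.congr_deriv ?_
  have cφ := hφ.continuous
  rw [← integral_finsetSum]
  · refine integral_congr_ae (Eventually.of_forall fun y => ?_)
    simp only
    rw [((hasDerivAt_ray g x y s).const_mul (φ y)).deriv, Finset.mul_sum]
    exact Finset.sum_congr rfl fun i _ => by ring
  · intro i _
    have c := SPA.continuous (D i g)
    exact integrableOn_cube (by fun_prop)

lemma abs_coord_le_one {y : Spc 3} (hy : y ∈ cube 3) (i : Fin 3) : |y i| ≤ 1 := by
  have := hy i trivial
  rw [abs_le]; constructor <;> linarith [this.1, this.2]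

lemma abs_weighted_mean_le_grad (g : SPA) (x : Spc 3) {φ : Spc 3 → ℝ} (hφ : ContDiff ℝ 1 φ)
    (hφ1 : ∀ y ∈ cube 3, |φ y| ≤ 1) {r : ℝ} (hr : r ∈ Ioc (0 : ℝ) 1) :
    |∫ y in cube 3, φ y * g.1 (x + r • y)|
      ≤ 2 * (√(I (g * g)) + ∑ i, √(I (D i g * D i g))) / √r := by
  have h := abs_le_of_deriv_le_rpow_neg_three_halves (G := ∑ i, √(I (D i g * D i g)))
    (fun s _ => hasDerivAt_weighted_mean g x hφ s)
    (fun s hs => by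
      rw [Finset.sum_div]
      refine (Finset.abs_sum_le_sum_abs _ _).trans (Finset.sum_le_sum fun i _ => ?_)
      refine abs_weighted_mean_le (D i g) x (by have := hφ.continuous; fun_prop)
        (fun y hy => ?_) hs
      rw [abs_mul]
      exact mul_le_one₀ (hφ1 y hy) (abs_nonneg _) (abs_coord_le_one hy i)) hr
  have h1 := abs_weighted_mean_le g x hφ.continuous hφ1 (s := 1) ⟨one_pos, le_rfl⟩
  have hr0 : 0 < √r := Real.sqrt_pos.2 hr.1
  have hr1 : √r ≤ 1 := Real.sqrt_le_one.2 hr.2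
  refine h.trans ?_
  have h0 : 0 ≤ √(I (g * g)) := Real.sqrt_nonneg _
  have h2 : √(I (g * g)) / (1 * √1) ≤ 2 * √(I (g * g)) / √r := by
    rw [Real.sqrt_one, one_mul, div_one, le_div_iff₀ hr0]
    nlinarith
  rw [mul_add, add_div]
  linarith

/-- Agmon-type inequality at scale `R`. -/
lemma sup_sq_le (f : SPA) (x : Spc 3) {R : ℝ} (hR : R ∈ Ioc (0 : ℝ) 1) :
    f.1 x ^ 2 ≤ 500 * (R⁻¹ * (I (f * f) + ∑ i, I (D i f * D i f))
      + R * ∑ i, ∑ j, I (D j (D i f) * D j (D i f))) := by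
  set H1 := √(I (f * f)) + ∑ i, √(I (D i f * D i f)) with hH1
  set H2 := ∑ i, (√(I (D i f * D i f)) + ∑ j, √(I (D j (D i f) * D j (D i f)))) with hH2
  have hone : ContDiff ℝ 1 fun _ : Spc 3 => (1 : ℝ) := contDiff_const
  have hd := hasDerivAt_weighted_mean f x hone
  have h := abs_le_of_deriv_le_rpow_neg_half (G := 2 * H2) hR.1
    (fun s _ => (hd s).continuousAt.continuousWithinAt) (fun s _ => hd s)
    (fun s hs => by
      rw [hH2, Finset.mul_sum, Finset.sum_div]
      refine (Finset.abs_sum_le_sum_abs _ _).trans (Finset.sum_le_sum fun i _ => ?_)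
      refine abs_weighted_mean_le_grad (D i f) x (by fun_prop)
        (fun y hy => ?_) ⟨hs.1, hs.2.le.trans hR.2⟩
      rw [one_mul]
      exact abs_coord_le_one hy i)
  have h1 := abs_weighted_mean_le_grad f x hone (fun _ _ => by simp) hR
  have e0 : ∫ y in cube 3, (1 : ℝ) * f.1 (x + (0 : ℝ) • y) = f.1 x := by simp
  rw [e0] at h
  have hR0 : 0 < √R := Real.sqrt_pos.2 hR.1
  have hRs : √R ^ 2 = R := Real.sq_sqrt hR.1.le
  have hb : |f.1 x| ≤ 2 * H1 / √R + 4 * H2 * √R := by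
    refine h.trans ?_
    linarith
  have hH1n : 0 ≤ H1 := add_nonneg (Real.sqrt_nonneg _)
    (Finset.sum_nonneg fun i _ => Real.sqrt_nonneg _)
  have hsq : f.1 x ^ 2 ≤ 8 * (H1 ^ 2 * R⁻¹) + 32 * (H2 ^ 2 * R) := by
    have : f.1 x ^ 2 ≤ (2 * H1 / √R + 4 * H2 * √R) ^ 2 := by
      rw [← sq_abs (f.1 x)]
      exact pow_le_pow_left₀ (abs_nonneg _) hb 2
    refine this.trans ((add_sq_le).trans (le_of_eq ?_))
    rw [div_pow, mul_pow (4 * H2), hRs]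
    ring
  have s0 : ∀ g : SPA, √(I (g * g)) ^ 2 = I (g * g) := fun g => Real.sq_sqrt (I_sq_nonneg g)
  have b1 : H1 ^ 2 ≤ 4 * (I (f * f) + ∑ i, I (D i f * D i f)) := by
    have e : H1 ^ 2 ≤ 2 * (√(I (f * f)) ^ 2 + (∑ i, √(I (D i f * D i f))) ^ 2) := add_sq_le
    have e2 := sq_sum_le_card_mul_sum_sq (s := (Finset.univ : Finset (Fin 3)))
      (f := fun i => √(I (D i f * D i f)))
    simp only [s0, Finset.card_univ, Fintype.card_fin, Nat.cast_ofNat] at e e2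
    have e3 : H1 ^ 2 ≤ (1 + 1 / 3) * √(I (f * f)) ^ 2 * 3
        + (4 / 3) * (∑ i, √(I (D i f * D i f))) ^ 2 := by
      rw [hH1]
      nlinarith [sq_nonneg (3 * √(I (f * f)) - (∑ i, √(I (D i f * D i f))))]
    rw [s0] at e3
    linarith
  have b2 : H2 ^ 2 ≤ 12 * (∑ i, I (D i f * D i f) + ∑ i, ∑ j, I (D j (D i f) * D j (D i f))) := by
    have e1 := sq_sum_le_card_mul_sum_sq (s := (Finset.univ : Finset (Fin 3)))
      (f := fun i => √(I (D i f * D i f)) + ∑ j, √(I (D j (D i f) * D j (D i f))))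
    refine e1.trans ?_
    rw [← Finset.sum_add_distrib, Finset.mul_sum, Finset.mul_sum]
    refine Finset.sum_le_sum fun i _ => ?_
    have e2 := sq_sum_le_card_mul_sum_sq (s := (Finset.univ : Finset (Fin 3)))
      (f := fun j => √(I (D j (D i f) * D j (D i f))))
    simp only [s0, Finset.card_univ, Fintype.card_fin, Nat.cast_ofNat] at e2 ⊢
    have e3 := sq_nonneg (3 * √(I (D i f * D i f)) - (∑ j, √(I (D j (D i f) * D j (D i f)))))
    have e4 := s0 (D i f)
    nlinarith
  have n0 : 0 ≤ I (f * f) := I_sq_nonneg _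
  have n1 : 0 ≤ ∑ i, I (D i f * D i f) := Finset.sum_nonneg fun i _ => I_sq_nonneg _
  have n2 : 0 ≤ ∑ i, ∑ j, I (D j (D i f) * D j (D i f)) :=
    Finset.sum_nonneg fun i _ => Finset.sum_nonneg fun j _ => I_sq_nonneg _
  have hRi : 1 ≤ R⁻¹ := (one_le_inv₀ hR.1).2 hR.2
  have hRR : R ≤ R⁻¹ := hR.2.trans hRi
  have hRp := hR.1
  have c1 := mul_le_mul_of_nonneg_right b1 (by positivity : 0 ≤ R⁻¹)
  have c2 := mul_le_mul_of_nonneg_right b2 hRp.le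
  have c3 := mul_le_mul_of_nonneg_right hRR n1
  have c4 : 0 ≤ R⁻¹ * I (f * f) := by positivity
  have c5 : 0 ≤ R⁻¹ * ∑ i, I (D i f * D i f) := by positivity
  have c6 : 0 ≤ R * ∑ i, ∑ j, I (D j (D i f) * D j (D i f)) := by positivity
  nlinarith

/-- Homogeneous Sobolev bilinear forms `⟨∇^m f, ∇^m g⟩_{L²}`. -/
def NB : ℕ → SPA →ₗ[ℝ] SPA →ₗ[ℝ] ℝ
  | 0 => (LinearMap.mul ℝ SPA).compr₂ I
  | m + 1 => ∑ i, (NB m).compl₁₂ (D i) (D i)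

/-- Homogeneous Sobolev squared seminorm `‖∇^m f‖²_{L²}`. -/
def nsq (m : ℕ) (f : SPA) : ℝ := NB m f f

lemma NB_zero (f g : SPA) : NB 0 f g = I (f * g) := rfl

lemma NB_succ (m : ℕ) (f g : SPA) : NB (m + 1) f g = ∑ i, NB m (D i f) (D i g) := by
  simp [NB]

lemma nsq_succ (m : ℕ) (f : SPA) : nsq (m + 1) f = ∑ i, nsq m (D i f) := NB_succ m f f

lemma nsq_zero (f : SPA) : nsq 0 f = I (f * f) := rfl

lemma nsq_one (f : SPA) : nsq 1 f = ∑ i, I (D i f * D i f) := nsq_succ 0 f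

lemma nsq_two (f : SPA) : nsq 2 f = ∑ i, ∑ j, I (D j (D i f) * D j (D i f)) := by
  rw [nsq_succ]; simp only [nsq_one]

lemma NB_symm (m : ℕ) (f g : SPA) : NB m f g = NB m g f := by
  induction m generalizing f g with
  | zero => rw [NB_zero, NB_zero, mul_comm]
  | succ m ih => simp only [NB_succ, ih (D _ f)]

lemma NB_D (m : ℕ) (j : Fin 3) (f g : SPA) : NB m f (D j g) = -NB m (D j f) g := by
  induction m generalizing f g with
  | zero => exact I_mul_D j f g
  | succ m ih => simp only [NB_succ, D_comm _ j, ih, Finset.sum_neg_distrib]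

lemma nsq_nonneg (m : ℕ) (f : SPA) : 0 ≤ nsq m f := by
  induction m generalizing f with
  | zero => exact I_sq_nonneg f
  | succ m ih => rw [nsq_succ]; exact Finset.sum_nonneg fun i _ => ih _

lemma nsq_smul (m : ℕ) (c : ℝ) (f : SPA) : nsq m (c • f) = c ^ 2 * nsq m f := by
  simp only [nsq, map_smul, LinearMap.smul_apply, smul_eq_mul]; ring

lemma nsq_add (m : ℕ) (f g : SPA) : nsq m (f + g) = nsq m f + 2 * NB m f g + nsq m g := by
  simp only [nsq, map_add, LinearMap.add_apply, NB_symm m g f]; ring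

lemma two_NB_le (m : ℕ) (f g : SPA) {s : ℝ} (hs : 0 < s) :
    2 * NB m f g ≤ s * nsq m f + s⁻¹ * nsq m g := by
  have h := nsq_nonneg m (s • f + (-1 : ℝ) • g)
  rw [nsq_add, nsq_smul, nsq_smul] at h
  simp only [map_smul, LinearMap.smul_apply, smul_eq_mul] at h
  have h2 : 0 ≤ s⁻¹ * (s ^ 2 * nsq m f + 2 * (-1 * (s * NB m f g)) + (-1) ^ 2 * nsq m g) := by
    refine mul_nonneg (by positivity) ?_
    linarith
  have h3 : s⁻¹ * (s ^ 2 * nsq m f + 2 * (-1 * (s * NB m f g)) + (-1) ^ 2 * nsq m g)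
    = s * nsq m f - 2 * NB m f g + s⁻¹ * nsq m g := by field_simp; ring
  linarith

lemma NB_sq_le (m : ℕ) (f g : SPA) : NB m f g ^ 2 ≤ nsq m f * nsq m g := by
  have key : ∀ s : ℝ, 0 ≤ nsq m g * (s * s) + (2 * NB m f g) * s + nsq m f := by
    intro s
    have h := nsq_nonneg m (f + s • g)
    rw [nsq_add, nsq_smul] at h
    simp only [map_smul, smul_eq_mul] at h
    nlinarith
  have := discrim_le_zero key
  unfold discrim at this
  nlinarith

lemma abs_NB_le (m : ℕ) (f g : SPA) : |NB m f g| ≤ √(nsq m f) * √(nsq m g) := by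
  rw [← Real.sqrt_mul (nsq_nonneg m f)]
  exact Real.abs_le_sqrt (NB_sq_le m f g)

lemma nsq_add_le (m : ℕ) (f g : SPA) : nsq m (f + g) ≤ 2 * (nsq m f + nsq m g) := by
  have := two_NB_le m f g one_pos
  rw [nsq_add]; linarith

lemma nsq_D_le (m : ℕ) (i : Fin 3) (f : SPA) : nsq m (D i f) ≤ nsq (m + 1) f := by
  rw [nsq_succ]
  exact Finset.single_le_sum (f := fun i => nsq m (D i f)) (fun i _ => nsq_nonneg m _)
    (Finset.mem_univ i)

lemma nsq_zero_le (f : SPA) (hf : I f = 0) : nsq 0 f ≤ 3 * nsq 1 f := by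
  rw [nsq_succ]; exact poincare f hf

lemma nsq_succ_le (m : ℕ) (f : SPA) : nsq (m + 1) f ≤ 3 * nsq (m + 2) f := by
  induction m generalizing f with
  | zero =>
    rw [nsq_succ, nsq_succ, Finset.mul_sum]
    exact Finset.sum_le_sum fun i _ => nsq_zero_le _ (I_D i f)
  | succ m ih =>
    rw [nsq_succ, nsq_succ (m + 2), Finset.mul_sum]
    exact Finset.sum_le_sum fun i _ => ih _

/-- Laplacian of a smooth periodic field. -/
def Lap : SPA →ₗ[ℝ] SPA := ∑ i, D i ∘ₗ D i

lemma Lap_apply (f : SPA) : Lap f = ∑ i, D i (D i f) := by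
  simp [Lap]

lemma D_Lap (i : Fin 3) (f : SPA) : D i (Lap f) = Lap (D i f) := by
  simp only [Lap_apply, map_sum]
  exact Finset.sum_congr rfl fun j _ => by rw [D_comm i j, D_comm i j]

lemma NB_Lap (m : ℕ) (f g : SPA) : NB m f (Lap g) = -NB (m + 1) f g := by
  rw [Lap_apply, map_sum, NB_succ, ← Finset.sum_neg_distrib]
  exact Finset.sum_congr rfl fun j _ => NB_D m j f _

lemma nsq_Lap (m : ℕ) (f : SPA) : nsq m (Lap f) = nsq (m + 2) f := by
  have h : nsq m (Lap f) = NB m (Lap f) (Lap f) := rfl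
  rw [h, NB_Lap, NB_symm]
  have e : ∀ g : SPA, NB (m + 1) f (Lap g) = -NB (m + 2) f g := fun g => NB_Lap _ _ _
  rw [e]
  simp [nsq]

/-- Inhomogeneous Sobolev squared norm. -/
def Sob (k : ℕ) (f : SPA) : ℝ := ∑ m ∈ Finset.range (k + 1), nsq m f

lemma Sob_nonneg (k : ℕ) (f : SPA) : 0 ≤ Sob k f := Finset.sum_nonneg fun _ _ => nsq_nonneg _ _

lemma Sob_two (f : SPA) : Sob 2 f = nsq 0 f + nsq 1 f + nsq 2 f := by
  simp [Sob, Finset.sum_range_succ]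

lemma Sob_succ (k : ℕ) (f : SPA) : Sob (k + 1) f = nsq 0 f + ∑ i, Sob k (D i f) := by
  unfold Sob
  rw [Finset.sum_range_succ', Finset.sum_comm, add_comm]
  simp only [nsq_succ]

lemma Sob_mono {k l : ℕ} (h : k ≤ l) (f : SPA) : Sob k f ≤ Sob l f :=
  Finset.sum_le_sum_of_subset_of_nonneg (Finset.range_mono (by omega)) fun _ _ _ => nsq_nonneg _ _

lemma nsq_le_Sob {m k : ℕ} (h : m ≤ k) (f : SPA) : nsq m f ≤ Sob k f :=
  Finset.single_le_sum (f := fun m => nsq m f) (fun _ _ => nsq_nonneg _ _)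
    (Finset.mem_range.2 (by omega))

lemma Sob_D_le (k : ℕ) (i : Fin 3) (f : SPA) : Sob k (D i f) ≤ Sob (k + 1) f := by
  rw [Sob_succ]
  have := Finset.single_le_sum (f := fun i => Sob k (D i f)) (fun i _ => Sob_nonneg k _)
    (Finset.mem_univ i)
  have := nsq_nonneg 0 f
  linarith

lemma Sob_add_le (k : ℕ) (f g : SPA) : Sob k (f + g) ≤ 2 * (Sob k f + Sob k g) := by
  unfold Sob
  rw [← Finset.sum_add_distrib, Finset.mul_sum]
  exact Finset.sum_le_sum fun m _ => nsq_add_le m f g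

lemma sq_le_nsq (f : SPA) (x : Spc 3) {R : ℝ} (hR : R ∈ Ioc (0 : ℝ) 1) :
    f.1 x ^ 2 ≤ 500 * (R⁻¹ * (nsq 0 f + nsq 1 f) + R * nsq 2 f) := by
  have := sup_sq_le f x hR
  rwa [nsq_zero, nsq_one, nsq_two]

lemma sq_le_Sob (f : SPA) (x : Spc 3) : f.1 x ^ 2 ≤ 500 * Sob 2 f := by
  have := sq_le_nsq f x (R := 1) ⟨one_pos, le_rfl⟩
  rw [Sob_two]; simpa using this

lemma I_pow_four_le (f : SPA) (i : Fin 3) {A : ℝ} (hA : ∀ x, |f.1 x| ≤ A) :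
    I ((D i f * D i f) * (D i f * D i f)) ≤ 9 * A ^ 2 * I (D i (D i f) * D i (D i f)) := by
  set h := D i f with hh
  set Q := I ((h * h) * (h * h)) with hQ
  have hQ0 : 0 ≤ Q := I_sq_nonneg _
  have e : Q = -(3 * I ((h * h) * (f * D i h))) := by
    have h1 := I_mul_D i (h * h * h) f
    have h2 : h * h * (h * h) = h * h * h * D i f := by rw [← hh]; ring
    have h3 : D i (h * h * h) * f = (3 : ℝ) • ((h * h) * (f * D i h)) := by
      rw [D_mul, D_mul]
      exact SPA.ext' fun x => by simp; ring
    rw [hQ, h2, h1, h3, map_smul, smul_eq_mul]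
  have hcs := I_cauchy_schwarz (h * h) (f * D i h)
  have hb : I ((f * D i h) * (f * D i h)) ≤ A ^ 2 * I (D i h * D i h) := by
    rw [← smul_eq_mul (A ^ 2), ← map_smul]
    refine I_mono fun x => ?_
    have := sq_le_sq' (neg_le_of_abs_le (hA x)) (le_of_abs_le (hA x))
    simp only [SPA.mul_val, SPA.smul_val]
    nlinarith [mul_self_nonneg ((D i h).1 x)]
  have hQ2 : Q ^ 2 ≤ 9 * (Q * (A ^ 2 * I (D i h * D i h))) := by
    rw [e, neg_sq, mul_pow]
    rw [← e]
    have := mul_le_mul_of_nonneg_left hb hQ0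
    nlinarith
  rcases hQ0.eq_or_lt with h0 | h0
  · rw [← h0]
    have := I_sq_nonneg (D i h)
    positivity
  · have : Q * Q ≤ Q * (9 * A ^ 2 * I (D i h * D i h)) := by nlinarith
    exact le_of_mul_le_mul_left this h0

lemma nsq_zero_mul_le (f g : SPA) {A : ℝ} (hA : ∀ x, |f.1 x| ≤ A) :
    nsq 0 (f * g) ≤ A ^ 2 * nsq 0 g := by
  rw [nsq_zero, nsq_zero, ← smul_eq_mul (A ^ 2), ← map_smul]
  refine I_mono fun x => ?_
  have := sq_le_sq' (neg_le_of_abs_le (hA x)) (le_of_abs_le (hA x))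
  simp only [SPA.mul_val, SPA.smul_val]
  nlinarith [mul_self_nonneg (g.1 x)]

lemma nsq_zero_mul_le' (f g : SPA) {B : ℝ} (hB : ∀ x, |g.1 x| ≤ B) :
    nsq 0 (f * g) ≤ B ^ 2 * nsq 0 f := by
  rw [mul_comm]; exact nsq_zero_mul_le g f hB

lemma nsq_one_mul_le (f g : SPA) {A B : ℝ} (hA : ∀ x, |f.1 x| ≤ A) (hB : ∀ x, |g.1 x| ≤ B) :
    nsq 1 (f * g) ≤ 2 * (A ^ 2 * nsq 1 g + B ^ 2 * nsq 1 f) := by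
  simp only [nsq_succ, Finset.mul_sum, ← Finset.sum_add_distrib]
  refine Finset.sum_le_sum fun i _ => ?_
  rw [D_mul]
  have h1 := nsq_add_le 0 (D i f * g) (f * D i g)
  have h2 := nsq_zero_mul_le f (D i g) hA
  have h3 := nsq_zero_mul_le' (D i f) g hB
  linarith

lemma nsq_zero_D_mul_D_le (f g : SPA) (i j : Fin 3) {A B : ℝ} (hA : ∀ x, |f.1 x| ≤ A)
    (hB : ∀ x, |g.1 x| ≤ B) :
    nsq 0 (D i f * D j g)
      ≤ 5 * (A ^ 2 * nsq 0 (D j (D j g)) + B ^ 2 * nsq 0 (D i (D i f))) := by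
  have hA0 : 0 ≤ A := (abs_nonneg _).trans (hA 0)
  have hB0 : 0 ≤ B := (abs_nonneg _).trans (hB 0)
  have h1 := I_pow_four_le f i hA
  have h2 := I_pow_four_le g j hB
  have h3 := I_cauchy_schwarz (D i f * D i f) (D j g * D j g)
  have e : nsq 0 (D i f * D j g) = I ((D i f * D i f) * (D j g * D j g)) := by
    rw [nsq_zero]
    congr 1; ring
  have p0 := I_sq_nonneg (D i f * D i f)
  have q0 := I_sq_nonneg (D j g * D j g)
  have p1 := nsq_nonneg 0 (D j (D j g))
  have q1 := nsq_nonneg 0 (D i (D i f))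
  change _ ≤ 9 * A ^ 2 * nsq 0 (D i (D i f)) at h1
  change _ ≤ 9 * B ^ 2 * nsq 0 (D j (D j g)) at h2
  rw [e]
  set X := nsq 0 (D j (D j g))
  set Y := nsq 0 (D i (D i f))
  refine abs_le_of_sq_le_sq' ?_ (by positivity) |>.2
  calc _ ≤ _ := h3
    _ ≤ (9 * A ^ 2 * Y) * (9 * B ^ 2 * X) := by gcongr
    _ ≤ _ := by nlinarith [sq_nonneg (A ^ 2 * X - B ^ 2 * Y), sq_nonneg (A ^ 2 * X + B ^ 2 * Y)]

lemma nsq_zero_D_D_le (i j : Fin 3) (f : SPA) : nsq 0 (D i (D j f)) ≤ nsq 2 f :=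
  (nsq_D_le 0 i _).trans (nsq_D_le 1 j _)

lemma nsq_two_mul_le (f g : SPA) {A B : ℝ} (hA : ∀ x, |f.1 x| ≤ A) (hB : ∀ x, |g.1 x| ≤ B) :
    nsq 2 (f * g) ≤ 400 * (A ^ 2 * nsq 2 g + B ^ 2 * nsq 2 f) := by
  have key : ∀ i j, nsq 0 (D j (D i (f * g)))
      ≤ 44 * (A ^ 2 * nsq 2 g + B ^ 2 * nsq 2 f) := by
    intro i j
    have e : D j (D i (f * g)) = (D j (D i f) * g + f * D j (D i g))
        + (D i f * D j g + D j f * D i g) := by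
      rw [D_mul, map_add, D_mul, D_mul]; ring
    rw [e]
    have a0 := nsq_add_le 0 (D j (D i f) * g + f * D j (D i g)) (D i f * D j g + D j f * D i g)
    have a1 := nsq_add_le 0 (D j (D i f) * g) (f * D j (D i g))
    have a2 := nsq_add_le 0 (D i f * D j g) (D j f * D i g)
    have b1 := nsq_zero_mul_le' (D j (D i f)) g hB
    have b2 := nsq_zero_mul_le f (D j (D i g)) hA
    have b3 := nsq_zero_D_mul_D_le f g i j hA hB
    have b4 := nsq_zero_D_mul_D_le f g j i hA hB
    have m : ∀ (C : ℝ) (a b : Fin 3) (h : SPA), C ^ 2 * nsq 0 (D a (D b h)) ≤ C ^ 2 * nsq 2 h :=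
      fun C a b h => mul_le_mul_of_nonneg_left (nsq_zero_D_D_le a b h) (sq_nonneg C)
    linarith [m B j i f, m A j i g, m A i i g, m A j j g, m B i i f, m B j j f]
  have e : nsq 2 (f * g) = ∑ i, ∑ j, nsq 0 (D j (D i (f * g))) := by
    rw [nsq_succ]; simp only [nsq_succ 0]
  rw [e]
  have hX : 0 ≤ A ^ 2 * nsq 2 g + B ^ 2 * nsq 2 f := by
    have := nsq_nonneg 2 g
    have := nsq_nonneg 2 f
    positivity
  calc _ ≤ ∑ _i : Fin 3, ∑ _j : Fin 3, 44 * (A ^ 2 * nsq 2 g + B ^ 2 * nsq 2 f) :=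
        Finset.sum_le_sum fun i _ => Finset.sum_le_sum fun j _ => key i j
    _ ≤ _ := by simp; linarith

lemma nsq_mul_le {m : ℕ} (hm : m ≤ 2) (f g : SPA) {A B : ℝ} (hA : ∀ x, |f.1 x| ≤ A)
    (hB : ∀ x, |g.1 x| ≤ B) :
    nsq m (f * g) ≤ 400 * (A ^ 2 * nsq m g + B ^ 2 * nsq m f) := by
  have p : 0 ≤ A ^ 2 * nsq m g := mul_nonneg (sq_nonneg _) (nsq_nonneg _ _)
  have q : 0 ≤ B ^ 2 * nsq m f := mul_nonneg (sq_nonneg _) (nsq_nonneg _ _)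
  interval_cases m
  · linarith [nsq_zero_mul_le f g hA]
  · linarith [nsq_one_mul_le f g hA hB]
  · exact nsq_two_mul_le f g hA hB

lemma Sob_two_mul_le (f g : SPA) {A B : ℝ} (hA : ∀ x, |f.1 x| ≤ A) (hB : ∀ x, |g.1 x| ≤ B) :
    Sob 2 (f * g) ≤ 400 * (A ^ 2 * Sob 2 g + B ^ 2 * Sob 2 f) := by
  rw [Sob_two, Sob_two, Sob_two]
  linarith [nsq_mul_le (m := 0) (by norm_num) f g hA hB,
    nsq_mul_le (m := 1) (by norm_num) f g hA hB, nsq_mul_le (m := 2) (by norm_num) f g hA hB]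

lemma abs_le_sqrt_Sob (f : SPA) (x : Spc 3) : |f.1 x| ≤ √(500 * Sob 2 f) :=
  Real.abs_le_sqrt (sq_le_Sob f x)

lemma exists_Sob_mul_le (k : ℕ) : ∃ C > 0, ∀ f g : SPA,
    Sob (k + 2) (f * g) ≤ C * (Sob (k + 2) f * Sob (k + 2) g) ∧
    Sob (k + 3) (f * g) ≤ C * (Sob (k + 3) f * Sob (k + 2) g + Sob (k + 2) f * Sob (k + 3) g) := by
  have tame : ∀ k : ℕ, ∀ C > 0, (∀ f g : SPA,
      Sob (k + 2) (f * g) ≤ C * (Sob (k + 2) f * Sob (k + 2) g)) → ∀ f g : SPA,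
      Sob (k + 3) (f * g)
        ≤ (7 * C) * (Sob (k + 3) f * Sob (k + 2) g + Sob (k + 2) f * Sob (k + 3) g) := by
    intro k C hC h f g
    rw [Sob_succ]
    have h0 : nsq 0 (f * g) ≤ C * (Sob (k + 3) f * Sob (k + 2) g) :=
      ((nsq_le_Sob (Nat.zero_le _) _).trans (h f g)).trans (by
        have := Sob_nonneg (k + 2) g
        have := Sob_mono (show k + 2 ≤ k + 3 by omega) f
        gcongr)
    have hi : ∀ i, Sob (k + 2) (D i (f * g))
        ≤ 2 * C * (Sob (k + 3) f * Sob (k + 2) g + Sob (k + 2) f * Sob (k + 3) g) := by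
      intro i
      rw [D_mul]
      refine (Sob_add_le _ _ _).trans ?_
      have a := h (D i f) g
      have b := h f (D i g)
      have a' : C * (Sob (k + 2) (D i f) * Sob (k + 2) g) ≤ C * (Sob (k + 3) f * Sob (k + 2) g) := by
        have := Sob_nonneg (k + 2) g
        have := Sob_D_le (k + 2) i f
        gcongr
      have b' : C * (Sob (k + 2) f * Sob (k + 2) (D i g)) ≤ C * (Sob (k + 2) f * Sob (k + 3) g) := by
        have := Sob_nonneg (k + 2) f
        have := Sob_D_le (k + 2) i g
        gcongr
      linarith
    have hs := Finset.sum_le_sum fun (i : Fin 3) (_ : i ∈ Finset.univ) => hi i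
    simp only [Finset.sum_const, Finset.card_univ, Fintype.card_fin, nsmul_eq_mul] at hs
    have : 0 ≤ C * (Sob (k + 2) f * Sob (k + 3) g) := by
      have := Sob_nonneg (k + 2) f
      have := Sob_nonneg (k + 3) g
      positivity
    push_cast at hs
    linarith
  have key : ∃ C > 0, ∀ f g : SPA, Sob (k + 2) (f * g) ≤ C * (Sob (k + 2) f * Sob (k + 2) g) := by
    induction k with
    | zero =>
      refine ⟨400000, by norm_num, fun f g => ?_⟩
      have := Sob_two_mul_le f g (abs_le_sqrt_Sob f) (abs_le_sqrt_Sob g)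
      rw [Real.sq_sqrt (by linarith [Sob_nonneg 2 f]),
        Real.sq_sqrt (by linarith [Sob_nonneg 2 g])] at this
      simp only [zero_add]
      linarith
    | succ k ih =>
      obtain ⟨C, hC, h⟩ := ih
      refine ⟨14 * C, by positivity, fun f g => ?_⟩
      refine (tame k C hC h f g).trans ?_
      have a : Sob (k + 3) f * Sob (k + 2) g ≤ Sob (k + 3) f * Sob (k + 3) g :=
        mul_le_mul_of_nonneg_left (Sob_mono (by omega) g) (Sob_nonneg _ _)
      have b : Sob (k + 2) f * Sob (k + 3) g ≤ Sob (k + 3) f * Sob (k + 3) g :=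
        mul_le_mul_of_nonneg_right (Sob_mono (by omega) f) (Sob_nonneg _ _)
      change _ ≤ 14 * C * (Sob (k + 3) f * Sob (k + 3) g)
      nlinarith
  obtain ⟨C, hC, h⟩ := key
  refine ⟨7 * C, by positivity, fun f g => ⟨(h f g).trans ?_, tame k C hC h f g⟩⟩
  have := mul_nonneg (Sob_nonneg (k + 2) f) (Sob_nonneg (k + 2) g)
  nlinarith

open Classical in
/-- Bundle a function into `SPA`, with junk value `0`. -/
def toA (f : Spc 3 → ℝ) : SPA := if h : ContDiff ℝ (⊤ : ℕ∞) f ∧ Per f then ⟨f, h⟩ else 0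

lemma toA_val {f : Spc 3 → ℝ} (h : ContDiff ℝ (⊤ : ℕ∞) f) (h' : Per f) : (toA f).1 = f := by
  rw [toA, dif_pos ⟨h, h'⟩]

/-- Joint smoothness in time and space of a family of fields. -/
def JS (O : Set ℝ) (F : ℝ → SPA) : Prop :=
  ContDiffOn ℝ (⊤ : ℕ∞) (fun z : ℝ × Spc 3 => (F z.1).1 z.2) (O ×ˢ univ)

/-- Time derivative of a family of fields. -/
def dt (F : ℝ → SPA) (t : ℝ) : SPA := toA fun x => deriv (fun s => (F s).1 x) t

section JS

variable {O : Set ℝ} {F G : ℝ → SPA} {t : ℝ}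

lemma JS.mono {O' : Set ℝ} (h : JS O F) (hO : O' ⊆ O) : JS O' F :=
  ContDiffOn.mono h (prod_mono_left hO)

lemma JS.contDiffAt (h : JS O F) (hO : IsOpen O) (ht : t ∈ O) (x : Spc 3) :
    ContDiffAt ℝ (⊤ : ℕ∞) (fun z : ℝ × Spc 3 => (F z.1).1 z.2) (t, x) :=
  ContDiffOn.contDiffAt h ((hO.prod isOpen_univ).mem_nhds ⟨ht, trivial⟩)

lemma JS.differentiableAt (h : JS O F) (hO : IsOpen O) (ht : t ∈ O) (x : Spc 3) :
    DifferentiableAt ℝ (fun z : ℝ × Spc 3 => (F z.1).1 z.2) (t, x) :=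
  (h.contDiffAt hO ht x).differentiableAt (by simp)

lemma JS.hasDerivAt_fderiv (h : JS O F) (hO : IsOpen O) (ht : t ∈ O) (x : Spc 3) :
    HasDerivAt (fun s => (F s).1 x)
      (fderiv ℝ (fun z : ℝ × Spc 3 => (F z.1).1 z.2) (t, x) (1, 0)) t := by
  have h2 : HasDerivAt (fun s : ℝ => (s, x)) ((1 : ℝ), (0 : Spc 3)) t :=
    (hasDerivAt_id t).prodMk (hasDerivAt_const t x)
  exact (h.differentiableAt hO ht x).hasFDerivAt.comp_hasDerivAt t h2

lemma JS.fderiv_space (h : JS O F) (hO : IsOpen O) (ht : t ∈ O) (x v : Spc 3) :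
    fderiv ℝ (F t).1 x v
      = fderiv ℝ (fun z : ℝ × Spc 3 => (F z.1).1 z.2) (t, x) (0, v) := by
  have h2 : HasFDerivAt (fun y : Spc 3 => (t, y)) (ContinuousLinearMap.inr ℝ ℝ (Spc 3)) x :=
    (hasFDerivAt_const t x).prodMk (hasFDerivAt_id x)
  have h3 := (h.differentiableAt hO ht x).hasFDerivAt.comp x h2
  have h4 : fderiv ℝ (F t).1 x = _ := h3.fderiv
  rw [h4]; simp

lemma JS.contDiffOn_fderiv_apply (h : JS O F) (hO : IsOpen O) (c : ℝ × Spc 3) :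
    ContDiffOn ℝ (⊤ : ℕ∞)
      (fun z => fderiv ℝ (fun z : ℝ × Spc 3 => (F z.1).1 z.2) z c) (O ×ˢ univ) :=
  (ContDiffOn.fderiv_of_isOpen h (hO.prod isOpen_univ) (m := (⊤ : ℕ∞)) (by simp)).clm_apply
    contDiffOn_const

lemma JS.dt_val_fun (h : JS O F) (hO : IsOpen O) (ht : t ∈ O) :
    (dt F t).1 = fun x => deriv (fun s => (F s).1 x) t := by
  refine toA_val ?_ fun x k => ?_
  · have e : (fun x => deriv (fun s => (F s).1 x) t)
        = fun x => fderiv ℝ (fun z : ℝ × Spc 3 => (F z.1).1 z.2) (t, x) (1, 0) :=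
      funext fun x => (h.hasDerivAt_fderiv hO ht x).deriv
    rw [e, ← contDiffOn_univ]
    exact (h.contDiffOn_fderiv_apply hO (1, 0)).comp
      (contDiff_const.prodMk contDiff_id).contDiffOn fun x _ => ⟨ht, trivial⟩
  · congr 1
    exact funext fun s => SPA.per (F s) x k

lemma JS.dt_val (h : JS O F) (hO : IsOpen O) (ht : t ∈ O) (x : Spc 3) :
    (dt F t).1 x = deriv (fun s => (F s).1 x) t := congrFun (h.dt_val_fun hO ht) x

lemma JS.dt_val' (h : JS O F) (hO : IsOpen O) (ht : t ∈ O) (x : Spc 3) :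
    (dt F t).1 x = fderiv ℝ (fun z : ℝ × Spc 3 => (F z.1).1 z.2) (t, x) (1, 0) := by
  rw [h.dt_val hO ht, (h.hasDerivAt_fderiv hO ht x).deriv]

lemma JS.hasDerivAt (h : JS O F) (hO : IsOpen O) (ht : t ∈ O) (x : Spc 3) :
    HasDerivAt (fun s => (F s).1 x) ((dt F t).1 x) t := by
  rw [h.dt_val' hO ht]; exact h.hasDerivAt_fderiv hO ht x

lemma JS.dt_eq (h : JS O F) (hO : IsOpen O) (ht : t ∈ O) {g : SPA}
    (hg : ∀ x, HasDerivAt (fun s => (F s).1 x) (g.1 x) t) : dt F t = g :=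
  SPA.ext' fun x => by rw [h.dt_val hO ht, (hg x).deriv]

lemma JS.dt (h : JS O F) (hO : IsOpen O) : JS O (dt F) :=
  (h.contDiffOn_fderiv_apply hO (1, 0)).congr fun z hz => h.dt_val' hO hz.1 z.2

lemma JS.D (h : JS O F) (hO : IsOpen O) (i : Fin 3) : JS O (fun t => D i (F t)) :=
  (h.contDiffOn_fderiv_apply hO (0, Pi.single i 1)).congr fun z hz =>
    h.fderiv_space hO hz.1 z.2 _

lemma JS.sub (h : JS O F) (h' : JS O G) : JS O (fun t => F t - G t) := ContDiffOn.sub h h'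
lemma JS.mul (h : JS O F) (h' : JS O G) : JS O (fun t => F t * G t) := ContDiffOn.mul h h'
lemma JS.smul (h : JS O F) (c : ℝ) : JS O (fun t => c • F t) := ContDiffOn.const_smul c h
lemma JS.const (f : SPA) : JS O (fun _ => f) :=
  ((SPA.contDiff f).comp contDiff_snd).contDiffOn

lemma JS.sum {ι : Type*} {s : Finset ι} {F : ι → ℝ → SPA} (h : ∀ i, JS O (F i)) :
    JS O (fun t => ∑ i ∈ s, F i t) := by
  have : ContDiffOn ℝ (⊤ : ℕ∞) (fun z : ℝ × Spc 3 => ∑ i ∈ s, (F i z.1).1 z.2) (O ×ˢ univ) :=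
    ContDiffOn.sum fun i _ => h i
  refine ContDiffOn.congr this fun z _ => ?_
  exact SPA.sum_val _ _ _

lemma JS.dt_sub (h : JS O F) (h' : JS O G) (hO : IsOpen O) (ht : t ∈ O) :
    NSRelax.dt (fun t => F t - G t) t = NSRelax.dt F t - NSRelax.dt G t :=
  (h.sub h').dt_eq hO ht fun x => (h.hasDerivAt hO ht x).sub (h'.hasDerivAt hO ht x)

lemma JS.dt_mul (h : JS O F) (h' : JS O G) (hO : IsOpen O) (ht : t ∈ O) :
    NSRelax.dt (fun t => F t * G t) t = NSRelax.dt F t * G t + F t * NSRelax.dt G t :=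
  (h.mul h').dt_eq hO ht fun x => (h.hasDerivAt hO ht x).mul (h'.hasDerivAt hO ht x)

lemma JS.dt_smul (h : JS O F) (c : ℝ) (hO : IsOpen O) (ht : t ∈ O) :
    NSRelax.dt (fun t => c • F t) t = c • NSRelax.dt F t :=
  (h.smul c).dt_eq hO ht fun x => (h.hasDerivAt hO ht x).const_mul c

lemma JS.dt_sum {ι : Type*} {s : Finset ι} {F : ι → ℝ → SPA} (h : ∀ i, JS O (F i))
    (hO : IsOpen O) (ht : t ∈ O) :
    NSRelax.dt (fun t => ∑ i ∈ s, F i t) t = ∑ i ∈ s, NSRelax.dt (F i) t :=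
  (JS.sum h).dt_eq hO ht fun x => by
    simp only [SPA.sum_val]
    exact HasDerivAt.fun_sum fun i _ => (h i).hasDerivAt hO ht x

lemma JS.dt_D (h : JS O F) (hO : IsOpen O) (ht : t ∈ O) (i : Fin 3) :
    NSRelax.dt (fun t => NSRelax.D i (F t)) t = NSRelax.D i (NSRelax.dt F t) := by
  refine SPA.ext' fun x => ?_
  have hn : O ×ˢ (univ : Set (Spc 3)) ∈ 𝓝 (t, x) := (hO.prod isOpen_univ).mem_nhds ⟨ht, trivial⟩
  rw [(h.D hO i).dt_val' hO ht]
  have e2 : (NSRelax.D i (NSRelax.dt F t)).1 x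
      = fderiv ℝ (fun z : ℝ × Spc 3 => (NSRelax.dt F z.1).1 z.2) (t, x) (0, Pi.single i 1) :=
    (h.dt hO).fderiv_space hO ht x _
  rw [e2]
  have e3 : (fun z : ℝ × Spc 3 => (NSRelax.D i (F z.1)).1 z.2) =ᶠ[𝓝 (t, x)]
      fun z => fderiv ℝ (fun z : ℝ × Spc 3 => (F z.1).1 z.2) z (0, Pi.single i 1) := by
    filter_upwards [hn] with z hz
    exact h.fderiv_space hO hz.1 z.2 _
  have e4 : (fun z : ℝ × Spc 3 => (NSRelax.dt F z.1).1 z.2) =ᶠ[𝓝 (t, x)]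
      fun z => fderiv ℝ (fun z : ℝ × Spc 3 => (F z.1).1 z.2) z (1, 0) := by
    filter_upwards [hn] with z hz
    exact h.dt_val' hO hz.1 z.2
  rw [e3.fderiv_eq, e4.fderiv_eq]
  exact fderiv_apply_comm (h.contDiffAt hO ht x) _ _

lemma JS.hasDerivAt_I (h : JS O F) (hO : IsOpen O) (ht : t ∈ O) :
    HasDerivAt (fun s => I (F s)) (I (NSRelax.dt F t)) t := by
  have := hasDerivAt_integral_cube hO (G := fun s x => (F s).1 x)
    (ContDiffOn.of_le h (one_le_two.trans two_le_infty)) ht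
  rw [I_def, h.dt_val_fun hO ht]
  exact this

lemma JS.hasDerivAt_NB (m : ℕ) (h : JS O F) (h' : JS O G) (hO : IsOpen O) (ht : t ∈ O) :
    HasDerivAt (fun s => NB m (F s) (G s))
      (NB m (NSRelax.dt F t) (G t) + NB m (F t) (NSRelax.dt G t)) t := by
  induction m generalizing F G with
  | zero =>
    have := (h.mul h').hasDerivAt_I hO ht
    rw [h.dt_mul h' hO ht, map_add] at this
    exact this
  | succ m ih =>
    simp only [NB_succ, ← Finset.sum_add_distrib]
    refine HasDerivAt.fun_sum fun i _ => ?_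
    have := ih (h.D hO i) (h'.D hO i)
    rwa [h.dt_D hO ht, h'.dt_D hO ht] at this

lemma JS.hasDerivAt_nsq (m : ℕ) (h : JS O F) (hO : IsOpen O) (ht : t ∈ O) :
    HasDerivAt (fun s => nsq m (F s)) (2 * NB m (F t) (NSRelax.dt F t)) t := by
  have := h.hasDerivAt_NB m h hO ht
  rw [NB_symm m (NSRelax.dt F t), ← two_mul] at this
  exact this

end JS

lemma dt_congr {F G : ℝ → SPA} {t : ℝ} (h : F =ᶠ[𝓝 t] G) : dt F t = dt G t := by
  unfold dt
  congr 1
  funext x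
  exact Filter.EventuallyEq.deriv_eq (h.mono fun s hs => by simp only [hs])

/-- Iterated partial derivatives. -/
def ds : List (Fin 3) → SPA →ₗ[ℝ] SPA
  | [] => LinearMap.id
  | i :: l => D i ∘ₗ ds l

lemma ds_nil (f : SPA) : ds [] f = f := rfl

lemma ds_cons (i : Fin 3) (l : List (Fin 3)) (f : SPA) : ds (i :: l) f = D i (ds l f) := rfl

lemma ds_D (i : Fin 3) (l : List (Fin 3)) (f : SPA) : ds l (D i f) = D i (ds l f) := by
  induction l with
  | nil => rfl
  | cons j l ih => rw [ds_cons, ds_cons, ih, D_comm]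

/-- Uniform boundedness, on a set of times, of all spatial derivatives. -/
def Bd (S : Set ℝ) (F : ℝ → SPA) : Prop :=
  ∀ l, ∃ M, ∀ t ∈ S, ∀ x, |(ds l (F t)).1 x| ≤ M

/-- Joint continuity of all spatial derivatives. -/
def Cj (S : Set ℝ) (F : ℝ → SPA) : Prop :=
  ∀ l, ContinuousOn (fun z : ℝ × Spc 3 => (ds l (F z.1)).1 z.2) (S ×ˢ univ)

section Bd

variable {S : Set ℝ} {F G : ℝ → SPA}

lemma Bd.mono {S' : Set ℝ} (h : Bd S F) (hS : S' ⊆ S) : Bd S' F := fun l => by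
  obtain ⟨M, hM⟩ := h l
  exact ⟨M, fun t ht => hM t (hS ht)⟩

lemma Bd.union {S' : Set ℝ} (h : Bd S F) (h' : Bd S' F) : Bd (S ∪ S') F := fun l => by
  obtain ⟨M, hM⟩ := h l
  obtain ⟨M', hM'⟩ := h' l
  refine ⟨max M M', fun t ht x => ?_⟩
  rcases ht with ht | ht
  · exact (hM t ht x).trans (le_max_left _ _)
  · exact (hM' t ht x).trans (le_max_right _ _)

lemma Bd.congr (h : Bd S F) (e : ∀ t ∈ S, G t = F t) : Bd S G := fun l => by
  obtain ⟨M, hM⟩ := h l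
  exact ⟨M, fun t ht => by rw [e t ht]; exact hM t ht⟩

lemma Bd.D (h : Bd S F) (i : Fin 3) : Bd S (fun t => D i (F t)) := fun l => by
  obtain ⟨M, hM⟩ := h (i :: l)
  exact ⟨M, fun t ht x => by rw [ds_D]; exact hM t ht x⟩

lemma Bd.add (h : Bd S F) (h' : Bd S G) : Bd S (fun t => F t + G t) := fun l => by
  obtain ⟨M, hM⟩ := h l
  obtain ⟨M', hM'⟩ := h' l
  refine ⟨M + M', fun t ht x => ?_⟩
  rw [map_add]
  exact (abs_add_le _ _).trans (add_le_add (hM t ht x) (hM' t ht x))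

lemma Bd.smul (h : Bd S F) (c : ℝ) : Bd S (fun t => c • F t) := fun l => by
  obtain ⟨M, hM⟩ := h l
  refine ⟨|c| * M, fun t ht x => ?_⟩
  rw [map_smul, SPA.smul_val, abs_mul]
  exact mul_le_mul_of_nonneg_left (hM t ht x) (abs_nonneg _)

lemma Bd.neg (h : Bd S F) : Bd S (fun t => -F t) := by
  simpa using h.smul (-1)

lemma Bd.sub (h : Bd S F) (h' : Bd S G) : Bd S (fun t => F t - G t) := by
  simpa [sub_eq_add_neg] using h.add h'.neg

lemma Bd.zero : Bd S (fun _ => 0) := fun l => ⟨0, fun t _ x => by simp⟩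

lemma Bd.sum {ι : Type*} {s : Finset ι} {F : ι → ℝ → SPA} (h : ∀ i, Bd S (F i)) :
    Bd S (fun t => ∑ i ∈ s, F i t) := by
  classical
  induction s using Finset.induction_on with
  | empty => simpa using Bd.zero
  | insert i s hi ih => simpa only [Finset.sum_insert hi] using (h i).add ih

lemma Bd.mul (h : Bd S F) (h' : Bd S G) : Bd S (fun t => F t * G t) := by
  intro l
  induction l generalizing F G with
  | nil =>
    obtain ⟨M, hM⟩ := h []
    obtain ⟨M', hM'⟩ := h' []
    refine ⟨M * M', fun t ht x => ?_⟩
    rw [ds_nil, SPA.mul_val, abs_mul]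
    exact mul_le_mul (hM t ht x) (hM' t ht x) (abs_nonneg _) ((abs_nonneg _).trans (hM t ht x))
  | cons i l ih =>
    obtain ⟨M, hM⟩ := ih (h.D i) h'
    obtain ⟨M', hM'⟩ := ih h (h'.D i)
    refine ⟨M + M', fun t ht x => ?_⟩
    rw [ds_cons, ← ds_D, D_mul, map_add]
    exact (abs_add_le _ _).trans (add_le_add (hM t ht x) (hM' t ht x))

lemma Bd.nsq_le (h : Bd S F) (m : ℕ) : ∃ M, ∀ t ∈ S, nsq m (F t) ≤ M := by
  induction m generalizing F with
  | zero =>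
    obtain ⟨M, hM⟩ := h []
    refine ⟨M ^ 2, fun t ht => ?_⟩
    have := nsq_zero_mul_le (F t) 1 (hM t ht)
    rwa [mul_one, nsq_zero 1, mul_one, I_one, mul_one] at this
  | succ m ih =>
    choose M hM using fun i => ih (h.D i)
    refine ⟨∑ i, M i, fun t ht => ?_⟩
    rw [nsq_succ]
    exact Finset.sum_le_sum fun i _ => hM i t ht

lemma Bd.Sob_le (h : Bd S F) (k : ℕ) : ∃ M, ∀ t ∈ S, Sob k (F t) ≤ M := by
  choose M hM using fun m => h.nsq_le m
  exact ⟨∑ m ∈ Finset.range (k + 1), M m, fun t ht => Finset.sum_le_sum fun m _ => hM m t ht⟩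

lemma Sob_ds_le (k : ℕ) (l : List (Fin 3)) (f : SPA) : Sob k (ds l f) ≤ Sob (k + l.length) f := by
  induction l generalizing f with
  | nil => exact le_rfl
  | cons i l ih =>
    rw [ds_cons, ← ds_D]
    exact (ih _).trans (Sob_D_le _ _ _)

lemma Bd.of_Sob (h : ∀ k, ∃ M, ∀ t ∈ S, Sob k (F t) ≤ M) : Bd S F := by
  intro l
  obtain ⟨M, hM⟩ := h (2 + l.length)
  refine ⟨√(500 * M), fun t ht x => (abs_le_sqrt_Sob _ x).trans (Real.sqrt_le_sqrt ?_)⟩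
  have := (Sob_ds_le 2 l (F t)).trans (hM t ht)
  linarith

lemma Bd.of_nsq (h : ∀ m, ∃ M, ∀ t ∈ S, nsq m (F t) ≤ M) : Bd S F := by
  refine Bd.of_Sob fun k => ?_
  choose M hM using h
  exact ⟨∑ m ∈ Finset.range (k + 1), M m, fun t ht => Finset.sum_le_sum fun m _ => hM m t ht⟩

lemma SPA.exists_mem_cube (x : Spc 3) : ∃ y ∈ cube 3, ∀ f : SPA, f.1 x = f.1 y := by
  refine ⟨fun i => Int.fract (x i), fun i _ => ⟨Int.fract_nonneg _, (Int.fract_lt_one _).le⟩,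
    fun f => ?_⟩
  rw [← SPA.per f (fun i => Int.fract (x i)) (fun i => ⌊x i⌋)]
  simp [Int.fract_add_floor]

lemma JS.ds {O : Set ℝ} (h : JS O F) (hO : IsOpen O) (l : List (Fin 3)) :
    JS O (fun t => ds l (F t)) := by
  induction l with
  | nil => exact h
  | cons i l ih => exact ih.D hO i

lemma JS.cj {O : Set ℝ} (h : JS O F) (hO : IsOpen O) : Cj O F := fun l =>
  ContDiffOn.continuousOn (h.ds hO l)

lemma Cj.mono {S' : Set ℝ} (h : Cj S F) (hS : S' ⊆ S) : Cj S' F := fun l =>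
  (h l).mono (prod_mono_left hS)

lemma Cj.bd (h : Cj S F) (hS : IsCompact S) : Bd S F := fun l => by
  obtain ⟨M, hM⟩ := (hS.prod isCompact_cube).exists_bound_of_continuousOn
    ((h l).mono (prod_mono_right (subset_univ _)))
  refine ⟨M, fun t ht x => ?_⟩
  obtain ⟨y, hy, e⟩ := SPA.exists_mem_cube x
  rw [e]
  exact hM (t, y) ⟨ht, hy⟩

lemma Bd.const (f : SPA) : Bd S (fun _ => f) := fun l => by
  obtain ⟨M, hM⟩ := isCompact_cube.exists_bound_of_continuousOn
    (SPA.continuous (NSRelax.ds l f)).continuousOn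
  refine ⟨M, fun t _ x => ?_⟩
  obtain ⟨y, hy, e⟩ := SPA.exists_mem_cube x
  rw [e]
  exact hM y hy

lemma Cj.D (h : Cj S F) (i : Fin 3) : Cj S (fun t => D i (F t)) := fun l => by
  simp only [ds_D]; exact h (i :: l)

lemma Cj.add (h : Cj S F) (h' : Cj S G) : Cj S (fun t => F t + G t) := fun l => by
  simp only [map_add, SPA.add_val]; exact (h l).add (h' l)

lemma Cj.smul (h : Cj S F) (c : ℝ) : Cj S (fun t => c • F t) := fun l => by
  simp only [map_smul, SPA.smul_val]; exact continuousOn_const.mul (h l)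

lemma Cj.neg (h : Cj S F) : Cj S (fun t => -F t) := by
  simpa using h.smul (-1)

lemma Cj.sub (h : Cj S F) (h' : Cj S G) : Cj S (fun t => F t - G t) := by
  simpa [sub_eq_add_neg] using h.add h'.neg

lemma Cj.mul (h : Cj S F) (h' : Cj S G) : Cj S (fun t => F t * G t) := by
  intro l
  induction l generalizing F G with
  | nil => exact (h []).mul (h' [])
  | cons i l ih =>
    have := (ih (h.D i) h').add (ih h (h'.D i))
    simp only [ds_cons, ← ds_D, D_mul, map_add, SPA.add_val]
    exact this

lemma Cj.continuousOn_I (h : Cj S F) : ContinuousOn (fun t => I (F t)) S := by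
  intro t ht
  rw [ContinuousWithinAt, Metric.tendsto_nhds]
  intro e he
  obtain ⟨v, hv, hv'⟩ := isCompact_cube.mem_uniformity_of_prod
    (f := fun t x => (F t).1 x) (s := S) (q := t)
    ((h []).mono (prod_mono_right (subset_univ _))) ht (Metric.dist_mem_uniformity (half_pos he))
  filter_upwards [hv] with s hs
  have hb : ∀ x, |(F s - F t).1 x| ≤ e / 2 := fun x => by
    obtain ⟨y, hy, hxy⟩ := SPA.exists_mem_cube x
    rw [hxy]
    exact (show dist _ _ < _ from hv' s hs y hy).le
  rw [Real.dist_eq, ← map_sub]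
  have h1 : I (F s - F t) ≤ I ((e / 2) • (1 : SPA)) := I_mono fun x => by
    simpa using (abs_le.1 (hb x)).2
  have h2 : I ((-(e / 2)) • (1 : SPA)) ≤ I (F s - F t) := I_mono fun x => by
    simpa using (abs_le.1 (hb x)).1
  rw [map_smul, I_one] at h1 h2
  simp only [smul_eq_mul, mul_one] at h1 h2
  refine (abs_le.2 ⟨h2, h1⟩).trans_lt (half_lt_self he)

lemma Cj.continuousOn_NB (m : ℕ) (h : Cj S F) (h' : Cj S G) :
    ContinuousOn (fun t => NB m (F t) (G t)) S := by
  induction m generalizing F G with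
  | zero => exact (h.mul h').continuousOn_I
  | succ m ih =>
    simp only [NB_succ]
    exact continuousOn_finsetSum _ fun i _ => ih (h.D i) (h'.D i)

end Bd

lemma antitoneOn_Ici_of_hasDerivAt_nonpos {f f' : ℝ → ℝ} {a : ℝ}
    (hf : ∀ t, a ≤ t → HasDerivAt f (f' t) t) (h : ∀ t, a ≤ t → f' t ≤ 0) :
    AntitoneOn f (Ici a) := by
  refine antitoneOn_of_deriv_nonpos (convex_Ici a)
    (fun t ht => (hf t ht).continuousAt.continuousWithinAt)
    (fun t ht => ?_) (fun t ht => ?_)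
  · rw [interior_Ici] at ht
    exact (hf t ht.le).differentiableAt.differentiableWithinAt
  · rw [interior_Ici] at ht
    rw [(hf t ht.le).deriv]
    exact h t ht.le

/-- Eventual boundedness for a dissipative hierarchy of differential inequalities. -/
lemma exists_bound_of_hierarchy {y dy : ℕ → ℝ → ℝ} {K : ℕ → ℝ}
    (hK : ∀ m, 0 < K m) (h0 : ∀ m t, 0 ≤ y m t)
    (hd : ∀ m t, 0 ≤ t → HasDerivAt (y m) (dy m t) t)
    (hy0 : ∀ t, 0 ≤ t → dy 0 t ≤ -(2 * y 1 t))
    (hy1 : ∀ t, 0 ≤ t → dy 1 t ≤ -(3 / 2 * y 2 t) + K 1 * (y 1 t * y 2 t))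
    (hP : ∀ t, 0 ≤ t → y 1 t ≤ 3 * y 2 t)
    (hy : ∀ m t, 0 ≤ t → dy (m + 2) t ≤ -y (m + 3) t + K (m + 2) * y (m + 2) t ^ 2) :
    ∃ t1 ≥ 0, ∀ m, ∃ M, ∀ t ≥ t1, y (m + 2) t ≤ M := by
  set η := (4 * K 1)⁻¹ with hη
  have hK1 := hK 1
  have hη0 : 0 < η := by positivity
  have hηK : K 1 * η = 1 / 4 := by rw [hη]; field_simp
  obtain ⟨t1, ht1, hsmall⟩ : ∃ t1 ≥ 0, y 1 t1 < η := by
    by_contra! hcon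
    have ha := antitoneOn_Ici_of_hasDerivAt_nonpos (a := 0) (f := fun t => y 0 t + 2 * η * t)
      (fun t ht => (hd 0 t ht).add ((hasDerivAt_id t).const_mul (2 * η)))
      (fun t ht => by
        have := hy0 t ht
        have := hcon t ht
        linarith)
    set s := (y 0 0 + 1) / (2 * η)
    have hs : 0 ≤ s := div_nonneg (by linarith [h0 0 0]) (by positivity)
    have := ha (mem_Ici.2 le_rfl) (mem_Ici.2 hs) hs
    simp only [mul_zero, add_zero] at this
    have e : 2 * η * s = y 0 0 + 1 := mul_div_cancel₀ _ (by positivity)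
    linarith [h0 0 s]
  have hstay : ∀ t ≥ t1, y 1 t ≤ η := by
    intro t ht
    refine image_le_of_deriv_right_lt_deriv_boundary (f := y 1) (f' := dy 1) (a := t1) (b := t)
      (B := fun _ => η) (B' := fun _ => 0)
      (fun s hs => (hd 1 s (ht1.trans hs.1)).continuousAt.continuousWithinAt)
      (fun s hs => (hd 1 s (ht1.trans hs.1)).hasDerivWithinAt) hsmall.le
      (fun s => hasDerivAt_const s η) (fun s hs he => ?_) ⟨ht, le_rfl⟩
    have a := hy1 s (ht1.trans hs.1)
    have b := hP s (ht1.trans hs.1)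
    rw [he, ← mul_assoc, hηK] at a
    rw [he] at b
    linarith
  have hpot : ∀ m, ∃ Φ Φ' : ℝ → ℝ, (∀ t ≥ t1, 0 ≤ Φ t) ∧ (∀ t ≥ t1, HasDerivAt Φ (Φ' t) t) ∧
      ∀ t ≥ t1, Φ' t ≤ -y (m + 2) t := by
    intro m
    induction m with
    | zero =>
      refine ⟨y 1, dy 1, fun t _ => h0 1 t, fun t ht => hd 1 t (ht1.trans ht), fun t ht => ?_⟩
      have a := hy1 t (ht1.trans ht)
      have b := h0 2 t
      have c : K 1 * (y 1 t * y 2 t) ≤ 1 / 4 * y 2 t := by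
        rw [← mul_assoc, ← hηK]
        have := hstay t ht
        gcongr
      simp only [zero_add]
      linarith
    | succ m ih =>
      obtain ⟨Φ, Φ', hΦ0, hΦd, hΦ⟩ := ih
      refine ⟨fun t => y (m + 2) t * Real.exp (K (m + 2) * Φ t),
        fun t => dy (m + 2) t * Real.exp (K (m + 2) * Φ t)
          + y (m + 2) t * (Real.exp (K (m + 2) * Φ t) * (K (m + 2) * Φ' t)),
        fun t _ => mul_nonneg (h0 _ _) (Real.exp_pos _).le,
        fun t ht => (hd _ t (ht1.trans ht)).mul ((hΦd t ht).const_mul _).exp, fun t ht => ?_⟩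
      set e := Real.exp (K (m + 2) * Φ t)
      have he : 1 ≤ e := Real.one_le_exp (mul_nonneg (hK _).le (hΦ0 t ht))
      have a := hy m t (ht1.trans ht)
      have b := hΦ t ht
      have c := h0 (m + 2) t
      have d := h0 (m + 3) t
      have f := (hK (m + 2)).le
      have g : K (m + 2) * y (m + 2) t * Φ' t ≤ K (m + 2) * y (m + 2) t * (-y (m + 2) t) := by
        gcongr
      have h : dy (m + 2) t + K (m + 2) * y (m + 2) t * Φ' t ≤ -y (m + 3) t := by nlinarith
      calc dy (m + 2) t * e + y (m + 2) t * (e * (K (m + 2) * Φ' t))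
          = (dy (m + 2) t + K (m + 2) * y (m + 2) t * Φ' t) * e := by ring
        _ ≤ -y (m + 3) t * e := by gcongr
        _ ≤ -y (m + 3) t := by nlinarith
  refine ⟨t1, ht1, fun m => ?_⟩
  obtain ⟨Φ, Φ', hΦ0, hΦd, hΦ⟩ := hpot (m + 1)
  obtain ⟨Ψ, Ψ', hΨ0, hΨd, hΨ⟩ := hpot m
  have hΨa := antitoneOn_Ici_of_hasDerivAt_nonpos hΨd fun t ht =>
    (hΨ t ht).trans (neg_nonpos.2 (h0 _ _))
  set X := fun t => y (m + 2) t * Real.exp (K (m + 2) * Ψ t)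
  have hXa : AntitoneOn X (Ici t1) := by
    refine antitoneOn_Ici_of_hasDerivAt_nonpos (f' := fun t =>
      dy (m + 2) t * Real.exp (K (m + 2) * Ψ t)
          + y (m + 2) t * (Real.exp (K (m + 2) * Ψ t) * (K (m + 2) * Ψ' t)))
      (fun t ht => (hd _ t (ht1.trans ht)).mul ((hΨd t ht).const_mul _).exp) fun t ht => ?_
    have a := hy m t (ht1.trans ht)
    have b := hΨ t ht
    have c := h0 (m + 2) t
    have d := h0 (m + 3) t
    have f := (hK (m + 2)).le
    have g : K (m + 2) * y (m + 2) t * Ψ' t ≤ K (m + 2) * y (m + 2) t * (-y (m + 2) t) := by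
      gcongr
    have h : dy (m + 2) t + K (m + 2) * y (m + 2) t * Ψ' t ≤ 0 := by nlinarith
    have := mul_nonpos_of_nonpos_of_nonneg h (Real.exp_pos (K (m + 2) * Ψ t)).le
    linarith
  refine ⟨X t1, fun t ht => le_trans ?_ (hXa (mem_Ici.2 le_rfl) ht ht)⟩
  exact le_mul_of_one_le_right (h0 _ _) (Real.one_le_exp (mul_nonneg (hK _).le (hΨ0 t ht)))

/-- Navier–Stokes solution in terms of bundled fields. -/
structure NSA (S : Set ℝ) (P : ℝ → SPA) (u : Fin 3 → ℝ → SPA) : Prop where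
  jsP : JS univ P
  jsu : ∀ a, JS univ (u a)
  div : ∀ t ∈ S, ∑ a, D a (u a t) = 0
  mom : ∀ t ∈ S, ∀ a, dt (u a) t = -∑ j, D j (u a t * u j t) - D a (P t) + Lap (u a t)
  mean : ∀ t ∈ S, I (P t) = 0

lemma Bd.Lap {S : Set ℝ} {F : ℝ → SPA} (h : Bd S F) :
    Bd S (fun t => NSRelax.Lap (F t)) := by
  simp only [Lap_apply]
  exact Bd.sum fun i => (h.D i).D i

lemma Bd.of_Lap {S : Set ℝ} {F : ℝ → SPA} (h : Bd S (fun t => NSRelax.Lap (F t)))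
    (hI : ∀ t ∈ S, I (F t) = 0) : Bd S F := by
  have h2 : ∀ m, ∃ M, ∀ t ∈ S, nsq (m + 2) (F t) ≤ M := fun m => by
    obtain ⟨M, hM⟩ := h.nsq_le m
    exact ⟨M, fun t ht => by rw [← nsq_Lap]; exact hM t ht⟩
  have h1 : ∃ M, ∀ t ∈ S, nsq 1 (F t) ≤ M := by
    obtain ⟨M, hM⟩ := h2 0
    exact ⟨3 * M, fun t ht => (nsq_succ_le 0 _).trans (by have := hM t ht; linarith)⟩
  refine Bd.of_nsq fun m => ?_
  match m with
  | 0 =>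
    obtain ⟨M, hM⟩ := h1
    exact ⟨3 * M, fun t ht => (nsq_zero_le _ (hI t ht)).trans (by have := hM t ht; linarith)⟩
  | 1 => exact h1
  | m + 2 => exact h2 m

lemma I_Lap (f : SPA) : I (Lap f) = 0 := by
  rw [Lap_apply, map_sum]; exact Finset.sum_eq_zero fun i _ => I_D i _

namespace NSA

variable {S : Set ℝ} {P : ℝ → SPA} {u : Fin 3 → ℝ → SPA}

lemma jsStress (h : NSA S P u) (i j : Fin 3) : JS univ (fun t => u i t * u j t - D j (u i t)) :=
  ((h.jsu i).mul (h.jsu j)).sub ((h.jsu i).D isOpen_univ j)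

lemma I_dt_u (h : NSA S P u) {t : ℝ} (ht : t ∈ S) (a : Fin 3) : I (dt (u a) t) = 0 := by
  rw [h.mom t ht a, map_add, map_sub, map_neg, map_sum, I_D, I_Lap,
    Finset.sum_eq_zero fun j _ => I_D j _]
  simp

lemma mean_u (h : NSA (Ici 0) P u) (a : Fin 3) {t : ℝ} (ht : 0 ≤ t) :
    I (u a t) = I (u a 0) := by
  have hd : ∀ s, HasDerivAt (fun s => I (u a s)) (I (dt (u a) s)) s := fun s =>
    (h.jsu a).hasDerivAt_I isOpen_univ trivial
  refine constant_of_has_deriv_right_zero (f := fun s => I (u a s)) (a := 0) (b := t)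
    (fun s _ => (hd s).continuousAt.continuousWithinAt) (fun s hs => ?_) t ⟨ht, le_rfl⟩
  rw [← h.I_dt_u (mem_Ici.2 hs.1) a]
  exact (hd s).hasDerivWithinAt

end NSA

lemma NB_D_self (m : ℕ) (j : Fin 3) (f : SPA) : NB m (D j f) f = 0 := by
  have := NB_D m j f f
  rw [NB_symm] at this
  linarith

lemma NB_D_one (m : ℕ) (j : Fin 3) (f : SPA) : NB m (D j f) 1 = 0 := by
  have := NB_D m j f 1
  rw [D_one, map_zero] at this
  linarith

lemma sum_NB_flux (m : ℕ) (w : Fin 3 → SPA) (c : Fin 3 → ℝ) (P : SPA)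
    (hw : ∑ a, D a (w a) = 0) :
    ∑ a, NB m (w a) (-∑ j, D j ((w a + c a • 1) * (w j + c j • 1)) - D a P + Lap (w a))
      = -∑ a, nsq (m + 1) (w a) + ∑ a, ∑ j, NB m (D j (w a)) (w a * w j) := by
  have e1 : ∀ a, NB m (w a) (-∑ j, D j ((w a + c a • 1) * (w j + c j • 1)) - D a P + Lap (w a))
      = ∑ j, NB m (D j (w a)) (w a * w j) + NB m (D a (w a)) P - nsq (m + 1) (w a) := by
    intro a
    have hj : ∀ j, NB m (w a) (D j ((w a + c a • 1) * (w j + c j • 1)))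
        = -NB m (D j (w a)) (w a * w j) + c a * NB m (w a) (D j (w j)) := by
      intro j
      have ex : (w a + c a • 1) * (w j + c j • 1)
          = w a * w j + c j • w a + c a • w j + (c a * c j) • (1 : SPA) :=
        SPA.ext' fun x => by simp; ring
      rw [NB_D, ex]
      simp only [map_add, map_smul, smul_eq_mul, NB_D_self, NB_D_one, NB_D m j (w a) (w j)]
      ring
    have h0 : ∑ j, NB m (w a) (D j (w j)) = 0 := by rw [← map_sum, hw, map_zero]
    rw [map_add, map_sub, map_neg, map_sum, NB_Lap, NB_D m a (w a) P,
      Finset.sum_congr rfl fun j _ => hj j, Finset.sum_add_distrib, ← Finset.mul_sum, h0,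
      Finset.sum_neg_distrib]
    change _ = _ - NB (m + 1) (w a) (w a)
    ring
  rw [Finset.sum_congr rfl fun a _ => e1 a]
  have h0 : ∑ a, NB m (D a (w a)) P = 0 := by
    rw [← LinearMap.sum_apply, ← map_sum, hw, map_zero, LinearMap.zero_apply]
  rw [Finset.sum_sub_distrib, Finset.sum_add_distrib, h0]
  ring

lemma sum_I_transport (w : Fin 3 → SPA) (hw : ∑ a, D a (w a) = 0) :
    ∑ a, ∑ j, NB 0 (D j (w a)) (w a * w j) = 0 := by
  refine Finset.sum_eq_zero fun a _ => ?_
  have h : ∀ j, NB 0 (D j (w a)) (w a * w j) = -(1 / 2 * I ((w a * w a) * D j (w j))) := by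
    intro j
    have h1 := I_mul_D j (w a * w a) (w j)
    have h2 : D j (w a * w a) * w j = (2 : ℝ) • (D j (w a) * (w a * w j)) := by
      rw [D_mul]; exact SPA.ext' fun x => by simp; ring
    rw [h2, map_smul, smul_eq_mul] at h1
    rw [NB_zero]; linarith
  rw [Finset.sum_congr rfl fun j _ => h j, Finset.sum_neg_distrib, ← Finset.mul_sum, ← map_sum,
    ← Finset.mul_sum, hw, mul_zero, map_zero]
  simp

lemma two_sum_NB_le (m : ℕ) (w : Fin 3 → SPA) {s : ℝ} (hs : 0 < s) :
    2 * ∑ a, ∑ j, NB m (D j (w a)) (w a * w j)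
      ≤ s * ∑ a, nsq (m + 1) (w a) + s⁻¹ * ∑ a, ∑ j, nsq m (w a * w j) := by
  simp only [nsq_succ, Finset.mul_sum, ← Finset.sum_add_distrib]
  exact Finset.sum_le_sum fun a _ => Finset.sum_le_sum fun j _ => two_NB_le m _ _ hs

lemma nsq_le_pow (m k : ℕ) (f : SPA) : nsq (m + 1) f ≤ 3 ^ k * nsq (m + 1 + k) f := by
  induction k with
  | zero => simp
  | succ k ih =>
    refine ih.trans ?_
    rw [pow_succ, mul_assoc]
    have : nsq (m + 1 + k) f ≤ 3 * nsq (m + 1 + (k + 1)) f := by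
      have := nsq_succ_le (m + k) f
      rwa [show m + 1 + (k + 1) = m + k + 2 by ring, show m + 1 + k = m + k + 1 by ring]
    gcongr

lemma Sob_le_nsq_of_mean_zero (k : ℕ) (f : SPA) (hf : I f = 0) :
    Sob (k + 1) f ≤ (k + 2) * 3 ^ (k + 1) * nsq (k + 1) f := by
  have h : ∀ m ∈ Finset.range (k + 2), nsq m f ≤ 3 ^ (k + 1) * nsq (k + 1) f := by
    intro m hm
    have hm' := Finset.mem_range.1 hm
    have p := nsq_nonneg (k + 1) f
    match m with
    | 0 =>
      refine (nsq_zero_le f hf).trans ?_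
      have := nsq_le_pow 0 k f
      rw [show 0 + 1 + k = k + 1 by ring] at this
      rw [pow_succ]
      simp only [zero_add] at this
      linarith
    | m + 1 =>
      obtain ⟨l, rfl⟩ : ∃ l, k = m + l := ⟨k - m, by omega⟩
      have := nsq_le_pow m l f
      rw [show m + 1 + l = m + l + 1 by ring] at this
      refine this.trans ?_
      have : (3 : ℝ) ^ l ≤ 3 ^ (m + l + 1) := pow_le_pow_right₀ (by norm_num) (by omega)
      gcongr
  have := Finset.sum_le_sum h
  simp only [Finset.sum_const, Finset.card_range, nsmul_eq_mul] at this
  unfold Sob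
  refine this.trans (le_of_eq ?_)
  push_cast
  ring

lemma sum_nsq_one_mul_le (w : Fin 3 → SPA) (hw : ∀ a, I (w a) = 0) :
    ∑ a, ∑ j, nsq 1 (w a * w j)
      ≤ 70000000 * ((∑ a, nsq 1 (w a)) * ∑ a, nsq 2 (w a)) := by
  set y1 := ∑ a, nsq 1 (w a)
  set y2 := ∑ a, nsq 2 (w a)
  have hy1 : 0 ≤ y1 := Finset.sum_nonneg fun _ _ => nsq_nonneg _ _
  have hy2 : 0 ≤ y2 := Finset.sum_nonneg fun _ _ => nsq_nonneg _ _
  have l1 : ∀ a, nsq 1 (w a) ≤ y1 := fun a =>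
    Finset.single_le_sum (f := fun a => nsq 1 (w a)) (fun _ _ => nsq_nonneg _ _) (Finset.mem_univ a)
  have l2 : ∀ a, nsq 2 (w a) ≤ y2 := fun a =>
    Finset.single_le_sum (f := fun a => nsq 2 (w a)) (fun _ _ => nsq_nonneg _ _) (Finset.mem_univ a)
  clear_value y1 y2
  obtain ⟨A, hA2, hA⟩ : ∃ A, A ^ 2 = 6500 * y2 ∧ ∀ a x, |(w a).1 x| ≤ A := by
    refine ⟨√(6500 * y2), Real.sq_sqrt (mul_nonneg (by norm_num) hy2), fun a x => ?_⟩
    refine Real.abs_le_sqrt ((sq_le_Sob (w a) x).trans ?_)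
    rw [Sob_two]
    have h0 := nsq_zero_le (w a) (hw a)
    have h1 : nsq 1 (w a) ≤ 3 * nsq 2 (w a) := nsq_succ_le 0 (w a)
    linarith [l2 a]
  have h : ∀ a j, nsq 1 (w a * w j) ≤ 5200000 * (y1 * y2) := by
    intro a j
    have h1 := nsq_mul_le (m := 1) one_le_two (w a) (w j) (hA a) (hA j)
    rw [hA2] at h1
    have h2 := mul_le_mul_of_nonneg_right (l1 a) hy2
    have h3 := mul_le_mul_of_nonneg_right (l1 j) hy2
    linarith
  refine (Finset.sum_le_sum fun a _ => Finset.sum_le_sum fun j _ => h a j).trans ?_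
  simp only [Finset.sum_const, Finset.card_univ, Fintype.card_fin, nsmul_eq_mul]
  push_cast
  linarith [mul_nonneg hy1 hy2]

lemma exists_sum_nsq_mul_le (m : ℕ) : ∃ C > 0, ∀ w : Fin 3 → SPA, (∀ a, I (w a) = 0) →
    ∑ a, ∑ j, nsq (m + 2) (w a * w j) ≤ C * (∑ a, nsq (m + 2) (w a)) ^ 2 := by
  obtain ⟨C, hC, h⟩ := exists_Sob_mul_le m
  set B : ℝ := ((m + 1 : ℕ) + 2) * 3 ^ (m + 2) with hB
  refine ⟨9 * (C * B ^ 2), by positivity, fun w hw => ?_⟩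
  set y := ∑ a, nsq (m + 2) (w a)
  have hy : 0 ≤ y := Finset.sum_nonneg fun _ _ => nsq_nonneg _ _
  have l : ∀ a, Sob (m + 2) (w a) ≤ B * y := fun a =>
    (Sob_le_nsq_of_mean_zero (m + 1) (w a) (hw a)).trans (by
      have : nsq (m + 2) (w a) ≤ y :=
        Finset.single_le_sum (f := fun a => nsq (m + 2) (w a)) (fun _ _ => nsq_nonneg _ _)
          (Finset.mem_univ a)
      rw [hB]
      gcongr)
  have h2 : ∀ a j, nsq (m + 2) (w a * w j) ≤ C * B ^ 2 * y ^ 2 := by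
    intro a j
    refine ((nsq_le_Sob le_rfl _).trans (h _ _).1).trans ?_
    have := mul_le_mul (l a) (l j) (Sob_nonneg _ _) (by positivity)
    calc _ ≤ C * (B * y * (B * y)) := by gcongr
      _ = _ := by ring
  refine (Finset.sum_le_sum fun a _ => Finset.sum_le_sum fun j _ => h2 a j).trans ?_
  simp only [Finset.sum_const, Finset.card_univ, Fintype.card_fin, nsmul_eq_mul]
  push_cast
  exact le_of_eq (by ring)

namespace NSA

variable {S : Set ℝ} {P : ℝ → SPA} {u : Fin 3 → ℝ → SPA}

lemma eventually_bd_u (h : NSA (Ici 0) P u) : ∃ t1 ≥ 0, ∀ a, Bd (Ici t1) (u a) := by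
  set c : Fin 3 → ℝ := fun a => I (u a 0) with hc
  set w : Fin 3 → ℝ → SPA := fun a t => u a t - c a • 1 with hw
  have hwu : ∀ a t, u a t = w a t + c a • 1 := fun a t => by simp [hw]
  have hDw : ∀ a i t, D i (w a t) = D i (u a t) := fun a i t => by simp [hw, D_one]
  have hjs : ∀ a, JS univ (w a) := fun a => (h.jsu a).sub (JS.const _)
  have hI : ∀ a t, 0 ≤ t → I (w a t) = 0 := fun a t ht => by
    simp [hw, hc, I_one, h.mean_u a ht]
  have hdiv : ∀ t, 0 ≤ t → ∑ a, D a (w a t) = 0 := fun t ht => by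
    simp only [hDw]; exact h.div t ht
  have hdt : ∀ t, 0 ≤ t → ∀ a, dt (w a) t
      = -∑ j, D j ((w a t + c a • 1) * (w j t + c j • 1)) - D a (P t) + Lap (w a t) := by
    intro t ht a
    have e : dt (w a) t = dt (u a) t :=
      (hjs a).dt_eq isOpen_univ trivial fun x =>
        ((h.jsu a).hasDerivAt isOpen_univ trivial x).sub_const _
    have eL : Lap (w a t) = Lap (u a t) := by simp only [Lap_apply, hDw]
    rw [e, eL, h.mom t ht a]
    simp only [← hwu]
  choose K hK hKle using exists_sum_nsq_mul_le
  set Kf : ℕ → ℝ := fun m => match m with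
    | 0 => 1
    | 1 => 140000000
    | m + 2 => K m
  obtain ⟨t1, ht1, hb⟩ := exists_bound_of_hierarchy (y := fun m t => ∑ a, nsq m (w a t))
    (dy := fun m t => ∑ a, 2 * NB m (w a t) (dt (w a) t)) (K := Kf)
    (fun m => by
      match m with
      | 0 => exact one_pos
      | 1 => change (0 : ℝ) < 140000000; norm_num
      | m + 2 => exact hK m)
    (fun m t => Finset.sum_nonneg fun _ _ => nsq_nonneg _ _)
    (fun m t _ => HasDerivAt.fun_sum fun a _ => (hjs a).hasDerivAt_nsq m isOpen_univ trivial)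
    (fun t ht => by
      simp only [← Finset.mul_sum, hdt t ht]
      rw [sum_NB_flux 0 _ c _ (hdiv t ht), sum_I_transport _ (hdiv t ht)]
      exact le_of_eq (by ring))
    (fun t ht => by
      simp only [← Finset.mul_sum, hdt t ht]
      rw [sum_NB_flux 1 _ c _ (hdiv t ht)]
      have a := two_sum_NB_le 1 (fun a => w a t) (s := 1 / 2) (by norm_num)
      have b := sum_nsq_one_mul_le (fun a => w a t) (fun a => hI a t ht)
      change _ ≤ _ + 140000000 * _
      norm_num at a ⊢
      linarith)
    (fun t ht => by
      simp only [Finset.mul_sum]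
      exact Finset.sum_le_sum fun a _ => nsq_succ_le 0 _)
    (fun m t ht => by
      simp only [← Finset.mul_sum, hdt t ht]
      rw [sum_NB_flux (m + 2) _ c _ (hdiv t ht)]
      have a := two_sum_NB_le (m + 2) (fun a => w a t) one_pos
      have b := hKle m (fun a => w a t) (fun a => hI a t ht)
      change _ ≤ _ + K m * _
      rw [inv_one, one_mul, one_mul] at a
      linarith)
  refine ⟨t1, ht1, fun a => ?_⟩
  have hb2 : ∀ m, ∃ M, ∀ t ∈ Ici t1, nsq (m + 2) (w a t) ≤ M := fun m => by
    obtain ⟨M, hM⟩ := hb m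
    exact ⟨M, fun t ht => (Finset.single_le_sum (f := fun a => nsq (m + 2) (w a t))
      (fun _ _ => nsq_nonneg _ _) (Finset.mem_univ a)).trans (hM t ht)⟩
  have hwb : Bd (Ici t1) (w a) :=
    Bd.of_Lap (Bd.of_nsq fun m => by simpa only [nsq_Lap] using hb2 m)
      fun t ht => hI a t (ht1.trans ht)
  exact (hwb.add (Bd.const (c a • 1))).congr fun t _ => hwu a t

lemma Lap_P (h : NSA S P u) {t : ℝ} (ht : S ∈ 𝓝 t) :
    Lap (P t) = -∑ a, ∑ j, D a (D j (u a t * u j t)) := by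
  have h1 : ∑ a, D a (dt (u a) t) = 0 := by
    rw [Finset.sum_congr rfl fun a _ => ((h.jsu a).dt_D isOpen_univ trivial a).symm,
      ← JS.dt_sum (fun a => (h.jsu a).D isOpen_univ a) isOpen_univ trivial]
    have : (fun t => ∑ a, D a (u a t)) =ᶠ[𝓝 t] fun _ => 0 := by
      filter_upwards [ht] with s hs using h.div s hs
    rw [dt_congr this]
    exact (JS.const (O := univ) 0).dt_eq isOpen_univ trivial fun x => hasDerivAt_const t _
  have h2 : ∑ a, D a (Lap (u a t)) = 0 := by
    simp only [D_Lap]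
    rw [← map_sum, h.div t (mem_of_mem_nhds ht), map_zero]
  rw [Finset.sum_congr rfl fun a _ => by rw [h.mom t (mem_of_mem_nhds ht) a]] at h1
  simp only [map_add, map_sub, map_neg, map_sum, Finset.sum_add_distrib,
    Finset.sum_sub_distrib, Finset.sum_neg_distrib] at h1
  rw [h2, add_zero] at h1
  rw [Lap_apply]
  exact (sub_eq_zero.1 h1).symm

lemma bd_of_bd_u (h : NSA (Ici 0) P u) {t1 : ℝ} (ht1 : 0 < t1) (hb : ∀ a, Bd (Ici t1) (u a)) :
    Bd (Ici t1) (dt P) ∧ ∀ i j, Bd (Ici t1) (dt fun t => u i t * u j t - D j (u i t)) := by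
  have hn : ∀ t ∈ Ici t1, Ici (0 : ℝ) ∈ 𝓝 t := fun t ht => Ici_mem_nhds (ht1.trans_le ht)
  have hS : Ici t1 ⊆ Ici (0 : ℝ) := Ici_subset_Ici.2 ht1.le
  have hP : Bd (Ici t1) P := by
    refine Bd.of_Lap ?_ fun t ht => h.mean t (hS ht)
    refine Bd.congr (F := fun t => -∑ a, ∑ j, D a (D j (u a t * u j t))) ?_
      fun t ht => h.Lap_P (hn t ht)
    exact (Bd.sum fun a => Bd.sum fun j => ((((hb a).mul (hb j)).D j).D a)).neg
  have hdu : ∀ a, Bd (Ici t1) (dt (u a)) := fun a => by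
    refine Bd.congr (F := fun t => -∑ j, D j (u a t * u j t) - D a (P t) + Lap (u a t)) ?_
      fun t ht => h.mom t (hS ht) a
    exact ((Bd.sum fun j => ((hb a).mul (hb j)).D j).neg.sub (hP.D a)).add (hb a).Lap
  have hduu : ∀ i j, Bd (Ici t1) (dt fun t => u i t * u j t) := fun i j => by
    refine Bd.congr (F := fun t => dt (u i) t * u j t + u i t * dt (u j) t) ?_
      fun t _ => (h.jsu i).dt_mul (h.jsu j) isOpen_univ trivial
    exact ((hdu i).mul (hb j)).add ((hb i).mul (hdu j))
  refine ⟨?_, fun i j => ?_⟩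
  · have hjs : ∀ a j, JS univ fun t => u a t * u j t := fun a j => (h.jsu a).mul (h.jsu j)
    have hjs2 : ∀ a j, JS univ fun t => D a (D j (u a t * u j t)) := fun a j =>
      ((hjs a j).D isOpen_univ j).D isOpen_univ a
    refine Bd.of_Lap ?_ fun t ht => ?_
    · refine Bd.congr (F := fun t => (-1 : ℝ) •
        ∑ a, ∑ j, D a (D j (dt (fun t => u a t * u j t) t))) ?_ fun t ht => ?_
      · exact (Bd.sum fun a => Bd.sum fun j => ((hduu a j).D j).D a).smul _
      · have e1 : Lap (dt P t) = dt (fun t => Lap (P t)) t := by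
          have : (fun t => Lap (P t)) = fun t => ∑ i, D i (D i (P t)) :=
            funext fun t => Lap_apply _
          rw [this, JS.dt_sum (fun i => (h.jsP.D isOpen_univ i).D isOpen_univ i) isOpen_univ trivial,
            Lap_apply]
          exact Finset.sum_congr rfl fun i _ => by
            rw [(h.jsP.D isOpen_univ i).dt_D isOpen_univ trivial, h.jsP.dt_D isOpen_univ trivial]
        have e2 : (fun t => Lap (P t)) =ᶠ[𝓝 t]
            fun t => (-1 : ℝ) • ∑ a, ∑ j, D a (D j (u a t * u j t)) := by
          filter_upwards [Ioi_mem_nhds (ht1.trans_le ht)] with s hs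
          rw [h.Lap_P (Ici_mem_nhds hs), neg_one_smul]
        rw [e1, dt_congr e2, JS.dt_smul (JS.sum fun a => JS.sum fun j => hjs2 a j) _ isOpen_univ
          trivial, JS.dt_sum (fun a => JS.sum fun j => hjs2 a j) isOpen_univ trivial]
        congr 1
        refine Finset.sum_congr rfl fun a _ => ?_
        rw [JS.dt_sum (fun j => hjs2 a j) isOpen_univ trivial]
        exact Finset.sum_congr rfl fun j _ => by
          rw [((hjs a j).D isOpen_univ j).dt_D isOpen_univ trivial,
            (hjs a j).dt_D isOpen_univ trivial]
    · have h1 := h.jsP.hasDerivAt_I isOpen_univ (t := t) trivial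
      have h2 : (fun t => I (P t)) =ᶠ[𝓝 t] fun _ => 0 := by
        filter_upwards [hn t ht] with s hs using h.mean s hs
      exact h1.unique ((hasDerivAt_const t (0 : ℝ)).congr_of_eventuallyEq h2)
  · refine Bd.congr (F := fun t => dt (fun t => u i t * u j t) t - D j (dt (u i) t)) ?_
      fun t _ => ?_
    · exact (hduu i j).sub ((hdu i).D j)
    · rw [((h.jsu i).mul (h.jsu j)).dt_sub ((h.jsu i).D isOpen_univ j) isOpen_univ trivial,
        (h.jsu i).dt_D isOpen_univ trivial]

/-- A Navier–Stokes solution is bounded, with all the derivatives entering the energy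
estimate, uniformly on its whole (possibly infinite) time interval. -/
lemma uniform_bd {T0 : ℝ≥0∞} (h : NSA {t : ℝ | 0 ≤ t ∧ ENNReal.ofReal t ≤ T0} P u) :
    (∀ a, Bd {t : ℝ | 0 ≤ t ∧ ENNReal.ofReal t ≤ T0} (u a)) ∧
    Bd {t : ℝ | 0 ≤ t ∧ ENNReal.ofReal t ≤ T0} (dt P) ∧
    ∀ i j, Bd {t : ℝ | 0 ≤ t ∧ ENNReal.ofReal t ≤ T0}
      (dt fun t => u i t * u j t - D j (u i t)) := by
  have hcpt : ∀ {F : ℝ → SPA}, JS univ F → ∀ T, Bd (Icc 0 T) F := fun hF T =>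
    ((hF.cj isOpen_univ).mono (subset_univ _)).bd isCompact_Icc
  have hdtP := h.jsP.dt isOpen_univ
  have hdtS := fun i j => (h.jsStress i j).dt isOpen_univ
  rcases eq_or_ne T0 ⊤ with rfl | hT
  · have hS : {t : ℝ | 0 ≤ t ∧ ENNReal.ofReal t ≤ ⊤} = Ici 0 := by ext t; simp
    rw [hS] at h ⊢
    obtain ⟨t0, ht0, hb⟩ := h.eventually_bd_u
    have ht1 : 0 < t0 + 1 := by linarith
    have hb' : ∀ a, Bd (Ici (t0 + 1)) (u a) := fun a =>
      (hb a).mono (Ici_subset_Ici.2 (by linarith))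
    have hU : Icc 0 (t0 + 1) ∪ Ici (t0 + 1) = Ici (0 : ℝ) := Icc_union_Ici_eq_Ici ht1.le
    obtain ⟨b1, b2⟩ := h.bd_of_bd_u ht1 hb'
    rw [← hU]
    exact ⟨fun a => (hcpt (h.jsu a) _).union (hb' a), (hcpt hdtP _).union b1,
      fun i j => (hcpt (hdtS i j) _).union (b2 i j)⟩
  · have hS : {t : ℝ | 0 ≤ t ∧ ENNReal.ofReal t ≤ T0} ⊆ Icc 0 T0.toReal := fun t ht =>
      ⟨ht.1, (ENNReal.ofReal_le_iff_le_toReal hT).1 ht.2⟩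
    exact ⟨fun a => (hcpt (h.jsu a) _).mono hS, (hcpt hdtP _).mono hS,
      fun i j => (hcpt (hdtS i j) _).mono hS⟩

end NSA

/-- Nonnegative symmetric bilinear forms for which all partial derivatives are skew. -/
structure DForm (B : SPA →ₗ[ℝ] SPA →ₗ[ℝ] ℝ) : Prop where
  symm : ∀ f g, B f g = B g f
  skew : ∀ j f g, B f (D j g) = -B (D j f) g
  nonneg : ∀ f, 0 ≤ B f f

lemma NB_dForm (m : ℕ) : DForm (NB m) := ⟨NB_symm m, NB_D m, nsq_nonneg m⟩

namespace DForm

variable {B B' : SPA →ₗ[ℝ] SPA →ₗ[ℝ] ℝ}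

lemma add (h : DForm B) (h' : DForm B') : DForm (B + B') where
  symm f g := by simp only [LinearMap.add_apply, h.symm f, h'.symm f]
  skew j f g := by simp only [LinearMap.add_apply, h.skew, h'.skew]; ring
  nonneg f := add_nonneg (h.nonneg f) (h'.nonneg f)

lemma smul (h : DForm B) {c : ℝ} (hc : 0 ≤ c) : DForm (c • B) where
  symm f g := by simp only [LinearMap.smul_apply, h.symm f]
  skew j f g := by simp only [LinearMap.smul_apply, h.skew, smul_neg]
  nonneg f := mul_nonneg hc (h.nonneg f)

lemma sum {ι : Type*} {s : Finset ι} {B : ι → SPA →ₗ[ℝ] SPA →ₗ[ℝ] ℝ} (h : ∀ i, DForm (B i)) :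
    DForm (∑ i ∈ s, B i) where
  symm f g := by
    simp only [LinearMap.sum_apply]; exact Finset.sum_congr rfl fun i _ => (h i).symm f g
  skew j f g := by
    simp only [LinearMap.sum_apply, ← Finset.sum_neg_distrib]
    exact Finset.sum_congr rfl fun i _ => (h i).skew j f g
  nonneg f := by
    simp only [LinearMap.sum_apply]; exact Finset.sum_nonneg fun i _ => (h i).nonneg f

lemma add_self (h : DForm B) (f g : SPA) : B (f + g) (f + g) = B f f + 2 * B f g + B g g := by
  simp only [map_add, LinearMap.add_apply, h.symm g f]; ring

lemma quadratic_nonneg (h : DForm B) (f g : SPA) (s : ℝ) :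
    0 ≤ B g g * (s * s) + (2 * B f g) * s + B f f := by
  have := h.nonneg (f + s • g)
  rw [h.add_self] at this
  simp only [map_smul, LinearMap.smul_apply, smul_eq_mul] at this
  linarith

lemma le_sqrt (h : DForm B) (f g : SPA) : B f g ≤ √(B f f) * √(B g g) := by
  have := discrim_le_zero (h.quadratic_nonneg f g)
  unfold discrim at this
  rw [← Real.sqrt_mul (h.nonneg f)]
  exact (le_abs_self _).trans (Real.abs_le_sqrt (by nlinarith))

lemma mul_le (h : DForm B) (f g : SPA) (r : ℝ) : r * B f g ≤ r ^ 2 * B f f + 1 / 4 * B g g := by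
  have := h.quadratic_nonneg (r • f) g (-1 / 2)
  simp only [map_smul, LinearMap.smul_apply, smul_eq_mul] at this
  linarith

lemma add_le (h : DForm B) (f g : SPA) : B (f + g) (f + g) ≤ 2 * (B f f + B g g) := by
  have := h.quadratic_nonneg f g (-1)
  rw [h.add_self]
  linarith

lemma energy_identity (h : DForm B) (q : SPA) (v : Fin 3 → SPA) (V : Fin 3 → Fin 3 → SPA)
    (r s : ℝ) (fq : SPA) (G : Fin 3 → Fin 3 → SPA) :
    B q (-(s • ∑ b, D b (v b)) + fq) + ∑ b, B (v b) (-(r • ∑ j, D j (V b j)) - s • D b q)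
      + ∑ i, ∑ j, B (V i j) (-(r • D j (v i)) + G i j)
    = B q fq + ∑ i, ∑ j, B (V i j) (G i j) := by
  have e1 : B q (-(s • ∑ b, D b (v b)) + fq) = ∑ b, s * B (v b) (D b q) + B q fq := by
    simp only [map_add, map_neg, map_smul, map_sum, smul_eq_mul, h.skew _ q, Finset.mul_sum,
      ← Finset.sum_neg_distrib]
    congr 1
    exact Finset.sum_congr rfl fun b _ => by rw [h.symm]; ring
  have e2 : ∀ b, B (v b) (-(r • ∑ j, D j (V b j)) - s • D b q)
      = ∑ j, r * B (V b j) (D j (v b)) - s * B (v b) (D b q) := by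
    intro b
    simp only [map_sub, map_neg, map_smul, map_sum, smul_eq_mul, h.skew _ (v b) (V b _),
      Finset.mul_sum, ← Finset.sum_neg_distrib]
    congr 1
    exact Finset.sum_congr rfl fun j _ => by rw [h.symm]; ring
  have e3 : ∀ i, ∑ j, B (V i j) (-(r • D j (v i)) + G i j)
      = -∑ j, r * B (V i j) (D j (v i)) + ∑ j, B (V i j) (G i j) := by
    intro i
    simp only [map_add, map_neg, map_smul, smul_eq_mul, Finset.sum_add_distrib,
      Finset.sum_neg_distrib]
  rw [e1, Finset.sum_congr rfl fun b _ => e2 b, Finset.sum_congr rfl fun i _ => e3 i]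
  simp only [Finset.sum_add_distrib, Finset.sum_sub_distrib, Finset.sum_neg_distrib]
  ring

end DForm

/-- The weighted `H²` form `⟨f, g⟩_{H¹} + κ ⟨∇²f, ∇²g⟩`. -/
def NW (κ : ℝ) : SPA →ₗ[ℝ] SPA →ₗ[ℝ] ℝ := NB 0 + NB 1 + κ • NB 2

lemma NW_apply (κ : ℝ) (f g : SPA) : NW κ f g = NB 0 f g + NB 1 f g + κ * NB 2 f g := rfl

lemma NW_self (κ : ℝ) (f : SPA) : NW κ f f = nsq 0 f + nsq 1 f + κ * nsq 2 f := rfl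

lemma NW_dForm {κ : ℝ} (hκ : 0 ≤ κ) : DForm (NW κ) :=
  ((NB_dForm 0).add (NB_dForm 1)).add ((NB_dForm 2).smul hκ)

lemma NW_self_le_Sob {κ : ℝ} (hκ : κ ≤ 1) (f : SPA) : NW κ f f ≤ Sob 2 f := by
  rw [NW_self, Sob_two]
  nlinarith [nsq_nonneg 2 f]

lemma Bd.exists_Sob_mul_le {S : Set ℝ} {F : ℝ → SPA} (h : Bd S F) (m : ℕ) :
    ∃ C ≥ 0, ∀ t ∈ S, ∀ g, Sob m (F t * g) ≤ C * Sob m g := by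
  induction m generalizing F with
  | zero =>
    obtain ⟨M, hM⟩ := h []
    refine ⟨M ^ 2, sq_nonneg _, fun t ht g => ?_⟩
    simpa [Sob] using nsq_zero_mul_le (F t) g (hM t ht)
  | succ m ih =>
    obtain ⟨M, hM⟩ := h []
    obtain ⟨C, hC0, hC⟩ := ih h
    choose C' hC0' hC' using fun i => ih (h.D i)
    have hsum : 0 ≤ ∑ i, C' i := Finset.sum_nonneg fun i _ => hC0' i
    refine ⟨M ^ 2 + 2 * ∑ i, C' i + 2 * C, by positivity, fun t ht g => ?_⟩
    have h0 := nsq_zero_mul_le (F t) g (hM t ht)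
    have hi : ∀ i, Sob m (NSRelax.D i (F t * g)) ≤ 2 * C' i * Sob (m + 1) g + 2 * C * Sob m (NSRelax.D i g) := by
      intro i
      rw [D_mul]
      have a := Sob_add_le m (NSRelax.D i (F t) * g) (F t * NSRelax.D i g)
      have b := hC' i t ht g
      have c := hC t ht (NSRelax.D i g)
      have d := mul_le_mul_of_nonneg_left (Sob_mono m.le_succ g) (hC0' i)
      linarith
    have hs := Finset.sum_le_sum fun i (_ : i ∈ Finset.univ) => hi i
    rw [Finset.sum_add_distrib, ← Finset.sum_mul, ← Finset.mul_sum, ← Finset.mul_sum] at hs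
    have e := Sob_succ m g
    have p := nsq_nonneg 0 g
    have p2 : 0 ≤ ∑ i, Sob m (NSRelax.D i g) := Finset.sum_nonneg fun i _ => Sob_nonneg _ _
    rw [Sob_succ m (F t * g)]
    have q1 : M ^ 2 * nsq 0 g ≤ M ^ 2 * Sob (m + 1) g :=
      mul_le_mul_of_nonneg_left (by linarith) (sq_nonneg _)
    have q2 : C * ∑ i, Sob m (NSRelax.D i g) ≤ C * Sob (m + 1) g :=
      mul_le_mul_of_nonneg_left (by linarith) hC0
    linarith

lemma Bd.exists_NW_mul_le {S : Set ℝ} {F : ℝ → SPA} (h : Bd S F) :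
    ∃ C ≥ 0, ∀ t ∈ S, ∀ κ ∈ Icc (0 : ℝ) 1, ∀ g, NW κ (F t * g) (F t * g) ≤ C * NW κ g g := by
  obtain ⟨C0, h0, H0⟩ := h.exists_Sob_mul_le 0
  obtain ⟨C1, h1, H1⟩ := h.exists_Sob_mul_le 1
  obtain ⟨C2, h2, H2⟩ := h.exists_Sob_mul_le 2
  refine ⟨C0 + C1 + C2, by positivity, fun t ht κ hκ g => ?_⟩
  have a0 := (nsq_le_Sob le_rfl _).trans (H0 t ht g)
  have a1 := (nsq_le_Sob le_rfl _).trans (H1 t ht g)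
  have a2 := mul_le_mul_of_nonneg_left ((nsq_le_Sob le_rfl _).trans (H2 t ht g)) hκ.1
  have e0 : Sob 0 g = nsq 0 g := by simp [Sob]
  have e1 : Sob 1 g = nsq 0 g + nsq 1 g := by simp [Sob, Finset.sum_range_succ]
  rw [e0] at a0
  rw [e1] at a1
  rw [Sob_two] at a2
  rw [NW_self, NW_self]
  have p0 := nsq_nonneg 0 g
  have p1 := nsq_nonneg 1 g
  have p2 := mul_nonneg hκ.1 (nsq_nonneg 2 g)
  have b0 : C0 * nsq 0 g ≤ C0 * (nsq 0 g + nsq 1 g + κ * nsq 2 g) :=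
    mul_le_mul_of_nonneg_left (by linarith) h0
  have b1 : C1 * (nsq 0 g + nsq 1 g) ≤ C1 * (nsq 0 g + nsq 1 g + κ * nsq 2 g) :=
    mul_le_mul_of_nonneg_left (by linarith) h1
  have k0 : κ * (nsq 0 g + nsq 1 g) ≤ nsq 0 g + nsq 1 g :=
    mul_le_of_le_one_left (by positivity) hκ.2
  have b2 : C2 * (κ * (nsq 0 g + nsq 1 g + nsq 2 g)) ≤ C2 * (nsq 0 g + nsq 1 g + κ * nsq 2 g) :=
    mul_le_mul_of_nonneg_left (by linarith) h2
  linarith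

lemma NW_mul_le {R : ℝ} (hR : R ∈ Ioc (0 : ℝ) 1) (f g : SPA) {E : ℝ}
    (hf : NW (R ^ 2) f f ≤ E) (hg : NW (R ^ 2) g g ≤ E) :
    NW (R ^ 2) (f * g) (f * g) ≤ 400000 * (R⁻¹ * E ^ 2) := by
  have hE : 0 ≤ E := ((NW_dForm (sq_nonneg R)).nonneg f).trans hf
  have hRi : 0 < R⁻¹ := inv_pos.2 hR.1
  obtain ⟨A, hA2, hA⟩ : ∃ A, A ^ 2 = 500 * (R⁻¹ * E) ∧
      ∀ h : SPA, NW (R ^ 2) h h ≤ E → ∀ x, |h.1 x| ≤ A := by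
    refine ⟨√(500 * (R⁻¹ * E)), Real.sq_sqrt (by positivity), fun h hh x => ?_⟩
    refine Real.abs_le_sqrt ((sq_le_nsq h x hR).trans ?_)
    have : R⁻¹ * (nsq 0 h + nsq 1 h) + R * nsq 2 h = R⁻¹ * NW (R ^ 2) h h := by
      rw [NW_self]
      have := hR.1.ne'
      field_simp
    rw [this]
    gcongr
  have a0 := nsq_mul_le (m := 0) (by norm_num) f g (hA f hf) (hA g hg)
  have a1 := nsq_mul_le (m := 1) (by norm_num) f g (hA f hf) (hA g hg)
  have a2 := mul_le_mul_of_nonneg_left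
    (nsq_mul_le (m := 2) (by norm_num) f g (hA f hf) (hA g hg)) (sq_nonneg R)
  calc NW (R ^ 2) (f * g) (f * g) ≤ 400 * (A ^ 2 * (NW (R ^ 2) g g + NW (R ^ 2) f f)) := by
        simp only [NW_self]; linarith
    _ ≤ 400 * (A ^ 2 * (E + E)) := by gcongr
    _ = _ := by rw [hA2]; ring

lemma exists_static_estimate {S : Set ℝ} {u : Fin 3 → ℝ → SPA} {gp : ℝ → SPA}
    {gS : Fin 3 → Fin 3 → ℝ → SPA} (hu : ∀ a, Bd S (u a)) (hp : Bd S gp)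
    (hS : ∀ i j, Bd S (gS i j)) :
    ∃ C > 0, ∀ t ∈ S, ∀ ε δ R r : ℝ, 0 < ε → 0 < δ → R ∈ Ioc (0 : ℝ) 1 →
      ∀ (q : SPA) (v : Fin 3 → SPA) (V : Fin 3 → Fin 3 → SPA) (E : ℝ),
      E = NW (R ^ 2) q q + ∑ b, NW (R ^ 2) (v b) (v b) + ∑ i, ∑ j, NW (R ^ 2) (V i j) (V i j) →
      2 * (NW (R ^ 2) q (-(√ε • gp t)) + ∑ i, ∑ j, NW (R ^ 2) (V i j)
        (r • (u i t * v j + u j t * v i + v i * v j) - (r ^ 2) • V i j - √δ • gS i j t))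
      ≤ C * (√((ε + δ) * E) + E + R⁻¹ * E ^ 2) := by
  choose C hC0 hC using fun a => (hu a).exists_NW_mul_le
  obtain ⟨M, hM⟩ := hp.Sob_le 2
  choose N hN using fun i j => (hS i j).Sob_le 2
  set C1 := ∑ a, C a with hC1
  set M1 := |M| + ∑ i, ∑ j, |N i j| with hM1
  have hC1a : ∀ a, C a ≤ C1 := fun a =>
    Finset.single_le_sum (f := C) (fun a _ => hC0 a) (Finset.mem_univ a)
  have hC10 : 0 ≤ C1 := (hC0 0).trans (hC1a 0)
  have hNs : 0 ≤ ∑ i, ∑ j, |N i j| :=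
    Finset.sum_nonneg fun i _ => Finset.sum_nonneg fun j _ => abs_nonneg _
  have hMM : M ≤ M1 := (le_abs_self M).trans (by linarith)
  have hNM : ∀ i j, N i j ≤ M1 := fun i j => by
    have h1 := Finset.single_le_sum (f := fun j => |N i j|) (fun j _ => abs_nonneg _)
      (Finset.mem_univ j)
    have h2 := Finset.single_le_sum (f := fun i => ∑ j, |N i j|)
      (fun i _ => Finset.sum_nonneg fun j _ => abs_nonneg _) (Finset.mem_univ i)
    have h3 := le_abs_self (N i j)
    have h4 := abs_nonneg M
    linarith
  clear_value C1 M1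
  refine ⟨20 * √M1 + 36 * C1 + 7200000, by positivity, ?_⟩
  intro t ht ε δ R r hε hδ hR q v V E hE
  have hB := NW_dForm (sq_nonneg R)
  have hκ : R ^ 2 ∈ Icc (0 : ℝ) 1 := ⟨sq_nonneg R, pow_le_one₀ hR.1.le hR.2⟩
  have hv0 : 0 ≤ ∑ b, NW (R ^ 2) (v b) (v b) := Finset.sum_nonneg fun b _ => hB.nonneg _
  have hV0 : 0 ≤ ∑ i, ∑ j, NW (R ^ 2) (V i j) (V i j) :=
    Finset.sum_nonneg fun i _ => Finset.sum_nonneg fun j _ => hB.nonneg _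
  have hq0 := hB.nonneg q
  have hE0 : 0 ≤ E := by linarith
  have hqE : NW (R ^ 2) q q ≤ E := by linarith
  have hvE : ∀ b, NW (R ^ 2) (v b) (v b) ≤ E := fun b => by
    have := Finset.single_le_sum (f := fun b => NW (R ^ 2) (v b) (v b))
      (fun b _ => hB.nonneg _) (Finset.mem_univ b)
    linarith
  have hVE : ∀ i j, NW (R ^ 2) (V i j) (V i j) ≤ E := fun i j => by
    have h1 := Finset.single_le_sum (f := fun j => NW (R ^ 2) (V i j) (V i j))
      (fun j _ => hB.nonneg _) (Finset.mem_univ j)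
    have h2 := Finset.single_le_sum (f := fun i => ∑ j, NW (R ^ 2) (V i j) (V i j))
      (fun i _ => Finset.sum_nonneg fun j _ => hB.nonneg _) (Finset.mem_univ i)
    linarith
  have hforce : ∀ (c : ℝ) (f g : SPA), 0 ≤ c → c ≤ ε + δ → NW (R ^ 2) f f ≤ E → Sob 2 g ≤ M1 →
      NW (R ^ 2) f (-(√c • g)) ≤ √M1 * √((ε + δ) * E) := by
    intro c f g hc hc' hf hg
    refine (hB.le_sqrt _ _).trans ?_
    have e : NW (R ^ 2) (-(√c • g)) (-(√c • g)) = c * NW (R ^ 2) g g := by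
      simp only [map_neg, LinearMap.neg_apply, map_smul, LinearMap.smul_apply,
        smul_eq_mul]
      have := Real.mul_self_sqrt hc
      linear_combination NW (R ^ 2) g g * this
    have hg' := (NW_self_le_Sob hκ.2 g).trans hg
    have hM0 : 0 ≤ M1 := (Sob_nonneg _ _).trans hg
    rw [e, ← Real.sqrt_mul (hB.nonneg f), ← Real.sqrt_mul hM0]
    refine Real.sqrt_le_sqrt ?_
    have := hB.nonneg g
    calc NW (R ^ 2) f f * (c * NW (R ^ 2) g g) ≤ E * ((ε + δ) * M1) := by gcongr
      _ = _ := by ring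
  have hF : ∀ i j, NW (R ^ 2) (u i t * v j + u j t * v i + v i * v j)
      (u i t * v j + u j t * v i + v i * v j) ≤ 8 * C1 * E + 800000 * (R⁻¹ * E ^ 2) := by
    intro i j
    have a1 := hB.add_le (u i t * v j + u j t * v i) (v i * v j)
    have a2 := hB.add_le (u i t * v j) (u j t * v i)
    have b1 := (hC i t ht _ hκ (v j)).trans (mul_le_mul (hC1a i) (hvE j) (hB.nonneg _) hC10)
    have b2 := (hC j t ht _ hκ (v i)).trans (mul_le_mul (hC1a j) (hvE i) (hB.nonneg _) hC10)
    have b3 := NW_mul_le hR (v i) (v j) (hvE i) (hvE j)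
    linarith
  have hqf := hforce ε q (gp t) hε.le (by linarith) hqE ((hM t ht).trans hMM)
  have hVf : ∀ i j, NW (R ^ 2) (V i j)
      (r • (u i t * v j + u j t * v i + v i * v j) - (r ^ 2) • V i j - √δ • gS i j t)
      ≤ 2 * C1 * E + 200000 * (R⁻¹ * E ^ 2) + √M1 * √((ε + δ) * E) := by
    intro i j
    have a := hforce δ (V i j) (gS i j t) hδ.le (by linarith) (hVE i j)
      ((hN i j t ht).trans (hNM i j))
    have b := hB.mul_le (V i j) (u i t * v j + u j t * v i + v i * v j) r
    have c := hF i j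
    have e : NW (R ^ 2) (V i j)
        (r • (u i t * v j + u j t * v i + v i * v j) - (r ^ 2) • V i j - √δ • gS i j t)
        = r * NW (R ^ 2) (V i j) (u i t * v j + u j t * v i + v i * v j)
          - r ^ 2 * NW (R ^ 2) (V i j) (V i j) + NW (R ^ 2) (V i j) (-(√δ • gS i j t)) := by
      rw [map_sub, map_sub, map_neg, map_smul, map_smul (NW (R ^ 2) (V i j)) (r ^ 2), smul_eq_mul,
        smul_eq_mul]
      ring
    linarith
  have hs := Finset.sum_le_sum fun i (_ : i ∈ (Finset.univ : Finset (Fin 3))) =>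
    Finset.sum_le_sum fun j (_ : j ∈ (Finset.univ : Finset (Fin 3))) => hVf i j
  simp only [Finset.sum_const, Finset.card_univ, Fintype.card_fin, nsmul_eq_mul] at hs
  push_cast at hs
  have hRi : 0 < R⁻¹ := inv_pos.2 hR.1
  have p1 : 0 ≤ √M1 := Real.sqrt_nonneg _
  have p2 : 0 ≤ √((ε + δ) * E) := Real.sqrt_nonneg _
  have p3 : 0 ≤ R⁻¹ * E ^ 2 := by positivity
  set T := √((ε + δ) * E)
  set Q := R⁻¹ * E ^ 2
  nlinarith [mul_nonneg p1 hE0, mul_nonneg p1 p3, mul_nonneg hC10 p2, mul_nonneg hC10 p3,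
    mul_nonneg p1 p2, mul_nonneg hC10 hE0]

lemma Cj.of_bd {S : Set ℝ} {F : ℝ → SPA} (h : Bd S F)
    (hc : ContinuousOn (fun z : ℝ × Spc 3 => (F z.1).1 z.2) (S ×ˢ univ)) : Cj S F := by
  intro l z hz
  obtain ⟨t, x⟩ := z
  have ht : t ∈ S := hz.1
  have hb : Bd S fun s => F s - F t := h.sub (Bd.const _)
  have h0 : Tendsto (fun s => nsq 0 (F s - F t)) (𝓝[S] t) (𝓝 0) := by
    rw [Metric.tendsto_nhds]
    intro e he
    obtain ⟨v, hv, hv'⟩ := isCompact_cube.mem_uniformity_of_prod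
      (f := fun t x => (F t).1 x) (s := S) (q := t)
      (hc.mono (prod_mono_right (subset_univ _))) ht
      (Metric.dist_mem_uniformity (Real.sqrt_pos.2 (half_pos he)))
    filter_upwards [hv] with s hs
    have hb : ∀ x, |(F s - F t).1 x| ≤ √(e / 2) := fun x => by
      obtain ⟨y, hy, hxy⟩ := SPA.exists_mem_cube x
      rw [hxy]
      exact (show dist _ _ < _ from hv' s hs y hy).le
    have := nsq_zero_mul_le (F s - F t) 1 hb
    rw [mul_one, nsq_zero 1, mul_one, I_one, mul_one, Real.sq_sqrt (half_pos he).le] at this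
    rw [Real.dist_eq, sub_zero, abs_of_nonneg (nsq_nonneg _ _)]
    exact this.trans_lt (half_lt_self he)
  have hm : ∀ m, Tendsto (fun s => nsq m (F s - F t)) (𝓝[S] t) (𝓝 0) := by
    intro m
    induction m with
    | zero => exact h0
    | succ m ih =>
      obtain ⟨M, hM⟩ := hb.nsq_le (m + 2)
      have h1 : Tendsto (fun s => √(nsq m (F s - F t)) * √M) (𝓝[S] t) (𝓝 0) := by
        simpa using (ih.sqrt).mul_const (√M)
      refine tendsto_of_tendsto_of_tendsto_of_le_of_le' tendsto_const_nhds h1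
        (Eventually.of_forall fun s => nsq_nonneg _ _) ?_
      filter_upwards [self_mem_nhdsWithin] with s hs
      have h2 := neg_abs_le (NB m (F s - F t) (NSRelax.Lap (F s - F t)))
      have h3 := abs_NB_le m (F s - F t) (NSRelax.Lap (F s - F t))
      rw [nsq_Lap] at h3
      have h4 := NB_Lap m (F s - F t) (F s - F t)
      have h5 := mul_le_mul_of_nonneg_left (Real.sqrt_le_sqrt (hM s hs))
        (Real.sqrt_nonneg (nsq m (F s - F t)))
      change NB (m + 1) _ _ ≤ _
      linarith
  have hl : ∀ l m, Tendsto (fun s => nsq m (NSRelax.ds l (F s - F t))) (𝓝[S] t) (𝓝 0) := by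
    intro l
    induction l with
    | nil => exact hm
    | cons i l ih =>
      exact fun m => tendsto_of_tendsto_of_tendsto_of_le_of_le tendsto_const_nhds (ih (m + 1))
        (fun s => nsq_nonneg _ _) (fun s => nsq_D_le _ _ _)
  have hs : Tendsto (fun s => √(500 * Sob 2 (NSRelax.ds l (F s - F t)))) (𝓝[S] t) (𝓝 0) := by
    have : Tendsto (fun s => Sob 2 (NSRelax.ds l (F s - F t))) (𝓝[S] t) (𝓝 0) := by
      simpa [Sob] using tendsto_finsetSum (Finset.range 3) fun m _ => hl l m
    simpa using (this.const_mul 500).sqrt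
  have hfst : Tendsto (fun z : ℝ × Spc 3 => z.1) (𝓝[S ×ˢ univ] (t, x)) (𝓝[S] t) :=
    tendsto_nhdsWithin_of_tendsto_nhds_of_eventually_within _
      (continuous_fst.continuousWithinAt) (eventually_mem_nhdsWithin.mono fun z hz => hz.1)
  have k1 : Tendsto (fun z : ℝ × Spc 3 => (NSRelax.ds l (F z.1 - F t)).1 z.2)
      (𝓝[S ×ˢ univ] (t, x)) (𝓝 0) :=
    squeeze_zero_norm (fun z => abs_le_sqrt_Sob _ _) (hs.comp hfst)
  have k2 : Tendsto (fun z : ℝ × Spc 3 => (NSRelax.ds l (F t)).1 z.2)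
      (𝓝[S ×ˢ univ] (t, x)) (𝓝 ((NSRelax.ds l (F t)).1 x)) :=
    (((SPA.continuous _).comp continuous_snd).tendsto (t, x)).mono_left nhdsWithin_le_nhds
  have k3 := k1.add k2
  rw [zero_add] at k3
  refine k3.congr fun z => ?_
  rw [map_sub, SPA.sub_val]
  ring

lemma DForm.hasDerivAt_energy {B : SPA →ₗ[ℝ] SPA →ₗ[ℝ] ℝ} (h : DForm B) {O : Set ℝ} {t : ℝ}
    (hd : ∀ F, JS O F → HasDerivAt (fun s => B (F s) (F s)) (2 * B (F t) (dt F t)) t)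
    {q : ℝ → SPA} {v : Fin 3 → ℝ → SPA} {V : Fin 3 → Fin 3 → ℝ → SPA} {r s : ℝ} {fq : SPA}
    {G : Fin 3 → Fin 3 → SPA} (hq : JS O q) (hv : ∀ b, JS O (v b)) (hV : ∀ i j, JS O (V i j))
    (eq : dt q t = -(s • ∑ b, D b (v b t)) + fq)
    (ev : ∀ b, dt (v b) t = -(r • ∑ j, D j (V b j t)) - s • D b (q t))
    (eV : ∀ i j, dt (V i j) t = -(r • D j (v i t)) + G i j) :
    HasDerivAt (fun s => B (q s) (q s) + ∑ b, B (v b s) (v b s)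
        + ∑ i, ∑ j, B (V i j s) (V i j s))
      (2 * (B (q t) fq + ∑ i, ∑ j, B (V i j t) (G i j))) t := by
  have := ((hd q hq).add (HasDerivAt.fun_sum fun b (_ : b ∈ Finset.univ) => hd _ (hv b))).add
    (HasDerivAt.fun_sum fun i (_ : i ∈ Finset.univ) =>
      HasDerivAt.fun_sum fun j (_ : j ∈ Finset.univ) => hd _ (hV i j))
  refine this.congr_deriv ?_
  rw [← h.energy_identity (q t) (fun b => v b t) (fun i j => V i j t) r s, ← eq]
  simp only [← ev, ← eV, ← Finset.mul_sum]
  ring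

/-- The bilinear form of `Sob k`. -/
def SB (k : ℕ) : SPA →ₗ[ℝ] SPA →ₗ[ℝ] ℝ := ∑ m ∈ Finset.range (k + 1), NB m

lemma SB_self (k : ℕ) (f : SPA) : SB k f f = Sob k f := by
  simp only [SB, LinearMap.sum_apply]; rfl

lemma SB_dForm (k : ℕ) : DForm (SB k) := DForm.sum NB_dForm

lemma JS.hasDerivAt_SB {O : Set ℝ} {F : ℝ → SPA} {t : ℝ} (k : ℕ) (h : JS O F) (hO : IsOpen O)
    (ht : t ∈ O) : HasDerivAt (fun s => SB k (F s) (F s)) (2 * SB k (F t) (NSRelax.dt F t)) t := by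
  simp only [SB, LinearMap.sum_apply, Finset.mul_sum]
  exact HasDerivAt.fun_sum fun m _ => h.hasDerivAt_nsq m hO ht

lemma JS.hasDerivAt_NW {O : Set ℝ} {F : ℝ → SPA} {t : ℝ} (κ : ℝ) (h : JS O F) (hO : IsOpen O)
    (ht : t ∈ O) : HasDerivAt (fun s => NW κ (F s) (F s)) (2 * NW κ (F t) (NSRelax.dt F t)) t := by
  simp only [NW_apply]
  refine (((h.hasDerivAt_nsq 0 hO ht).add (h.hasDerivAt_nsq 1 hO ht)).add
    ((h.hasDerivAt_nsq 2 hO ht).const_mul κ)).congr_deriv ?_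
  ring

/-- Solutions of the relaxation system on an open set of times. -/
structure RXA (ε δ : ℝ) (O : Set ℝ) (P : ℝ → SPA) (u : Fin 3 → ℝ → SPA)
    (U : Fin 3 → Fin 3 → ℝ → SPA) : Prop where
  jsP : JS O P
  jsu : ∀ a, JS O (u a)
  jsU : ∀ i j, JS O (U i j)
  mass : ∀ t ∈ O, ε • dt P t + ∑ b, D b (u b t) = 0
  mom : ∀ t ∈ O, ∀ a, dt (u a) t + ∑ j, D j (U a j t) + D a (P t) = 0
  str : ∀ t ∈ O, ∀ i j, δ • dt (U i j) t + D j (u i t) = u i t * u j t - U i j t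

lemma RXA.dt_q {ε δ : ℝ} {O : Set ℝ} {P u U} (h : RXA ε δ O P u U) (hε : 0 < ε) {t : ℝ}
    (ht : t ∈ O) : √ε • dt P t = -((√ε)⁻¹ • ∑ b, D b (u b t)) := by
  have e := h.mass t ht
  have hs := (Real.sqrt_pos.2 hε).ne'
  have : ∑ b, D b (u b t) = -(ε • dt P t) := by rw [eq_neg_iff_add_eq_zero, add_comm, e]
  rw [this, smul_neg, neg_neg, smul_smul]
  congr 1
  rw [eq_inv_mul_iff_mul_eq₀ hs, Real.mul_self_sqrt hε.le]

lemma RXA.dt_V {ε δ : ℝ} {O : Set ℝ} {P u U} (h : RXA ε δ O P u U) (hδ : 0 < δ) {t : ℝ}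
    (ht : t ∈ O) (i j : Fin 3) : √δ • dt (U i j) t
      = (√δ)⁻¹ • (u i t * u j t - U i j t - D j (u i t)) := by
  have hs := (Real.sqrt_pos.2 hδ).ne'
  rw [← h.str t ht, add_sub_cancel_right, smul_smul]
  congr 1
  rw [eq_inv_mul_iff_mul_eq₀ hs, Real.mul_self_sqrt hδ.le]

lemma le_exp_mul_of_hasDerivAt {z z' : ℝ → ℝ} {C b : ℝ} (hC : 0 ≤ C)
    (h : ∀ t ∈ Ioc 0 b, HasDerivAt z (z' t) t) (h' : ∀ t ∈ Ioc 0 b, -(C * z t) ≤ z' t)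
    (h0 : ∀ t ∈ Ioc 0 b, 0 ≤ z t) : ∀ t ∈ Ioc 0 b, z t ≤ Real.exp (C * b) * z b := by
  intro t ht
  have hd : ∀ s ∈ Ioc 0 b, HasDerivAt (fun s => Real.exp (C * s) * z s)
      (Real.exp (C * s) * (C * 1) * z s + Real.exp (C * s) * z' s) s := fun s hs =>
    (((hasDerivAt_id s).const_mul C).exp).mul (h s hs)
  have hm : MonotoneOn (fun s => Real.exp (C * s) * z s) (Ioc 0 b) := by
    refine monotoneOn_of_deriv_nonneg (convex_Ioc 0 b)
      (fun s hs => (hd s hs).continuousAt.continuousWithinAt)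
      (fun s hs => (hd s (interior_subset hs)).differentiableAt.differentiableWithinAt)
      fun s hs => ?_
    rw [(hd s (interior_subset hs)).deriv]
    have := h' s (interior_subset hs)
    have e : Real.exp (C * s) * (C * 1) * z s + Real.exp (C * s) * z' s
      = Real.exp (C * s) * (C * z s + z' s) := by ring
    rw [e]
    exact mul_nonneg (Real.exp_pos _).le (by linarith)
  have h1 := hm ht ⟨ht.1.trans_le ht.2, le_rfl⟩ ht.2
  have h2 : 1 ≤ Real.exp (C * t) := Real.one_le_exp (mul_nonneg hC ht.1.le)
  exact (le_mul_of_one_le_left (h0 t ht) h2).trans h1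

lemma RXA.Sob_bd_step {ε δ : ℝ} {O : Set ℝ} {P u U} (h : RXA ε δ O P u U) (hε : 0 < ε)
    (hδ : 0 < δ) (hO : IsOpen O) {b : ℝ} (hb : Ioc 0 b ⊆ O) (k : ℕ) {K : ℝ} (hK : 0 ≤ K)
    (hF : ∀ t ∈ Ioc 0 b, ∀ i j, Sob k (u i t * u j t) ≤ K * (Sob k (u i t) + Sob k (u j t))) :
    ∃ M, ∀ t ∈ Ioc 0 b, Sob k (√ε • P t) + ∑ b, Sob k (u b t)
      + ∑ i, ∑ j, Sob k (√δ • U i j t) ≤ M := by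
  have hB := SB_dForm k
  simp only [← SB_self] at hF ⊢
  set r := (√δ)⁻¹ with hr
  have hrδ : r * √δ = 1 := inv_mul_cancel₀ (Real.sqrt_pos.2 hδ).ne'
  have hd : ∀ t ∈ Ioc 0 b, HasDerivAt (fun t => SB k (√ε • P t) (√ε • P t)
      + ∑ b, SB k (u b t) (u b t) + ∑ i, ∑ j, SB k (√δ • U i j t) (√δ • U i j t))
      (2 * (SB k (√ε • P t) 0 + ∑ i, ∑ j, SB k (√δ • U i j t)
        (r • (u i t * u j t) - (r ^ 2) • √δ • U i j t))) t := by
    intro t ht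
    have hs : (√ε)⁻¹ * √ε = 1 := inv_mul_cancel₀ (Real.sqrt_pos.2 hε).ne'
    refine hB.hasDerivAt_energy (O := O) (r := r) (s := (√ε)⁻¹)
      (fun F hF => hF.hasDerivAt_SB k hO (hb ht))
      (h.jsP.smul _) h.jsu (fun i j => (h.jsU i j).smul _) ?_ (fun a => ?_) fun i j => ?_
    · rw [h.jsP.dt_smul _ hO (hb ht), h.dt_q hε (hb ht), add_zero]
    · simp only [map_smul, ← Finset.smul_sum, smul_smul, hs, hrδ, one_smul]
      rw [← sub_eq_zero, ← h.mom t (hb ht) a]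
      abel
    · rw [(h.jsU i j).dt_smul _ hO (hb ht), h.dt_V hδ (hb ht), smul_smul (r ^ 2), pow_two,
        mul_assoc, hrδ, mul_one]
      simp only [smul_sub]
      abel
  refine ⟨_, le_exp_mul_of_hasDerivAt (C := 4 * r ^ 2 + 9 * K) (by positivity) hd
    (fun t ht => ?_) fun t ht => ?_⟩
  · set Z := SB k (√ε • P t) (√ε • P t)
      + ∑ b, SB k (u b t) (u b t) + ∑ i, ∑ j, SB k (√δ • U i j t) (√δ • U i j t) with hZ
    have p1 := hB.nonneg (√ε • P t)
    have p2 : 0 ≤ ∑ b, SB k (u b t) (u b t) := Finset.sum_nonneg fun _ _ => hB.nonneg _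
    have p3 : 0 ≤ ∑ i, ∑ j, SB k (√δ • U i j t) (√δ • U i j t) :=
      Finset.sum_nonneg fun _ _ => Finset.sum_nonneg fun _ _ => hB.nonneg _
    have hu : ∀ i, SB k (u i t) (u i t) ≤ Z := fun i => by
      have := Finset.single_le_sum (f := fun b => SB k (u b t) (u b t))
        (fun b _ => hB.nonneg _) (Finset.mem_univ i)
      linarith
    have hij : ∀ i j, -(2 * r ^ 2 * SB k (√δ • U i j t) (√δ • U i j t) + 1 / 2 * (K * Z)) ≤
        SB k (√δ • U i j t) (r • (u i t * u j t) - (r ^ 2) • √δ • U i j t) := by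
      intro i j
      have e : SB k (√δ • U i j t) (r • (u i t * u j t) - (r ^ 2) • √δ • U i j t)
        = r * SB k (√δ • U i j t) (u i t * u j t)
          - r ^ 2 * SB k (√δ • U i j t) (√δ • U i j t) := by
        rw [map_sub, map_smul, map_smul _ (r ^ 2), smul_eq_mul, smul_eq_mul]
      rw [e]
      have a1 := hB.mul_le (√δ • U i j t) (u i t * u j t) (-r)
      have a2 := hF t ht i j
      have a3 := mul_le_mul_of_nonneg_left (add_le_add (hu i) (hu j)) hK
      have a4 : (-r) ^ 2 = r ^ 2 := by ring
      rw [a4] at a1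
      linarith
    have hsum := Finset.sum_le_sum fun i (_ : i ∈ Finset.univ) =>
      Finset.sum_le_sum fun j (_ : j ∈ Finset.univ) => hij i j
    simp only [Finset.sum_neg_distrib, Finset.sum_add_distrib, ← Finset.mul_sum,
      Finset.sum_const, Finset.card_univ, Fintype.card_fin, nsmul_eq_mul] at hsum
    rw [map_zero]
    have : r ^ 2 * ∑ i, ∑ j, SB k (√δ • U i j t) (√δ • U i j t) ≤ r ^ 2 * Z :=
      mul_le_mul_of_nonneg_left (by linarith) (sq_nonneg _)
    push_cast at hsum
    linarith
  · have p1 := hB.nonneg (√ε • P t)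
    have p2 : 0 ≤ ∑ b, SB k (u b t) (u b t) := Finset.sum_nonneg fun _ _ => hB.nonneg _
    have p3 : 0 ≤ ∑ i, ∑ j, SB k (√δ • U i j t) (√δ • U i j t) :=
      Finset.sum_nonneg fun _ _ => Finset.sum_nonneg fun _ _ => hB.nonneg _
    linarith

lemma RXA.bd {ε δ : ℝ} {O : Set ℝ} {P u U} (h : RXA ε δ O P u U) (hε : 0 < ε)
    (hδ : 0 < δ) (hO : IsOpen O) {b A : ℝ} (hb : Ioc 0 b ⊆ O)
    (hA : ∀ t ∈ Ioc 0 b, ∀ a x, |(u a t).1 x| ≤ A) :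
    Bd (Ioc 0 b) P ∧ (∀ a, Bd (Ioc 0 b) (u a)) ∧ ∀ i j, Bd (Ioc 0 b) (U i j) := by
  have hM : ∀ k, ∃ M, ∀ t ∈ Ioc 0 b, Sob (k + 2) (√ε • P t) + ∑ b, Sob (k + 2) (u b t)
      + ∑ i, ∑ j, Sob (k + 2) (√δ • U i j t) ≤ M := by
    intro k
    induction k with
    | zero =>
      refine h.Sob_bd_step hε hδ hO hb 2 (K := 400 * A ^ 2) (by positivity) fun t ht i j => ?_
      exact (Sob_two_mul_le _ _ (hA t ht i) (hA t ht j)).trans (le_of_eq (by ring))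
    | succ k ih =>
      obtain ⟨M, hM⟩ := ih
      obtain ⟨C, hC, hC'⟩ := exists_Sob_mul_le k
      refine h.Sob_bd_step hε hδ hO hb (k + 3) (K := C * |M|) (by positivity) fun t ht i j => ?_
      have hu : ∀ i, Sob (k + 2) (u i t) ≤ |M| := fun i => by
        have p1 := Sob_nonneg (k + 2) (√ε • P t)
        have p3 : 0 ≤ ∑ i, ∑ j, Sob (k + 2) (√δ • U i j t) :=
          Finset.sum_nonneg fun _ _ => Finset.sum_nonneg fun _ _ => Sob_nonneg _ _
        have := Finset.single_le_sum (f := fun b => Sob (k + 2) (u b t))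
          (fun b _ => Sob_nonneg _ _) (Finset.mem_univ i)
        linarith [hM t ht, le_abs_self M]
      refine (hC' (u i t) (u j t)).2.trans ?_
      have a1 := mul_le_mul_of_nonneg_left (hu j) (Sob_nonneg (k + 3) (u i t))
      have a2 := mul_le_mul_of_nonneg_right (hu i) (Sob_nonneg (k + 3) (u j t))
      calc _ ≤ C * (Sob (k + 3) (u i t) * |M| + |M| * Sob (k + 3) (u j t)) := by gcongr
        _ = _ := by ring
  have key : ∀ k, ∃ M, ∀ t ∈ Ioc 0 b, Sob k (√ε • P t) ≤ M ∧ (∀ a, Sob k (u a t) ≤ M) ∧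
      ∀ i j, Sob k (√δ • U i j t) ≤ M := by
    intro k
    obtain ⟨M, hM⟩ := hM k
    have hk : k ≤ k + 2 := by omega
    refine ⟨M, fun t ht => ?_⟩
    have p1 := Sob_nonneg (k + 2) (√ε • P t)
    have p2 : 0 ≤ ∑ b, Sob (k + 2) (u b t) := Finset.sum_nonneg fun _ _ => Sob_nonneg _ _
    have p3 : 0 ≤ ∑ i, ∑ j, Sob (k + 2) (√δ • U i j t) :=
      Finset.sum_nonneg fun _ _ => Finset.sum_nonneg fun _ _ => Sob_nonneg _ _
    have m := hM t ht
    refine ⟨(Sob_mono hk _).trans (by linarith), fun a => (Sob_mono hk _).trans ?_,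
      fun i j => (Sob_mono hk _).trans ?_⟩
    · have := Finset.single_le_sum (f := fun b => Sob (k + 2) (u b t))
        (fun b _ => Sob_nonneg _ _) (Finset.mem_univ a)
      linarith
    · have h1 := Finset.single_le_sum (f := fun j => Sob (k + 2) (√δ • U i j t))
        (fun b _ => Sob_nonneg _ _) (Finset.mem_univ j)
      have h2 := Finset.single_le_sum (f := fun i => ∑ j, Sob (k + 2) (√δ • U i j t))
        (fun _ _ => Finset.sum_nonneg fun _ _ => Sob_nonneg _ _) (Finset.mem_univ i)
      linarith
  choose M hM using key
  have unsc : ∀ {c : ℝ} {F : ℝ → SPA}, 0 < c → Bd (Ioc 0 b) (fun t => √c • F t) →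
      Bd (Ioc 0 b) F := by
    intro c F hc hF
    have := hF.smul (√c)⁻¹
    simpa only [smul_smul, inv_mul_cancel₀ (Real.sqrt_pos.2 hc).ne', one_smul] using this
  exact ⟨unsc hε (Bd.of_Sob fun k => ⟨M k, fun t ht => (hM k t ht).1⟩),
    fun a => Bd.of_Sob fun k => ⟨M k, fun t ht => (hM k t ht).2.1 a⟩,
    fun i j => unsc hδ (Bd.of_Sob fun k => ⟨M k, fun t ht => (hM k t ht).2.2 i j⟩)⟩

section Energy

variable {ι : Type*} [Fintype ι]

lemma L2sq_eq (g : ι → SPA) : L2sq (fun x a => (g a).1 x) = ∑ a, nsq 0 (g a) := by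
  have e : ∑ a, nsq 0 (g a) = I (∑ a, g a * g a) := by rw [map_sum]; rfl
  rw [e, I_def]
  simp only [L2sq, ptsq, pow_two, SPA.sum_val, SPA.mul_val]

lemma D1L2sq_eq (g : ι → SPA) : D1L2sq (fun x a => (g a).1 x) = ∑ a, nsq 1 (g a) := by
  have e : ∑ a, nsq 1 (g a) = I (∑ a, ∑ i, D i (g a) * D i (g a)) := by
    simp only [nsq_one, map_sum]
  rw [e, I_def]
  simp only [D1L2sq, ptsqD1, pow_two, SPA.sum_val, SPA.mul_val, D_val]

lemma D2L2sq_eq (g : ι → SPA) : D2L2sq (fun x a => (g a).1 x) = ∑ a, nsq 2 (g a) := by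
  have e : ∑ a, nsq 2 (g a) = I (∑ a, ∑ i, ∑ j, D i (D j (g a)) * D i (D j (g a))) := by
    simp only [nsq_two, map_sum]
    exact Finset.sum_congr rfl fun a _ => Finset.sum_comm
  rw [e, I_def]
  simp only [D2L2sq, ptsqD2, pow_two, SPA.sum_val, SPA.mul_val, D_val]

end Energy

lemma resEnergyH1_eq {a ε δ : ℝ} {p : ℝ → Spc 3 → ℝ} {u : ℝ → Spc 3 → Vec 3}
    {pe : ℝ → Spc 3 → ℝ} {ue : ℝ → Spc 3 → Vec 3} {Ue : ℝ → Spc 3 → Fin 3 → Fin 3 → ℝ} {t : ℝ}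
    {q : SPA} {v : Fin 3 → SPA} {V : Fin 3 → Fin 3 → SPA}
    (hq : ∀ x, q.1 x = √ε * (pe t x - p t x)) (hv : ∀ b x, (v b).1 x = ue t x b - u t x b)
    (hV : ∀ i j x, (V i j).1 x = √δ * (Ue t x i j - stress u t x i j)) :
    resEnergyH1 a ε δ p u pe ue Ue t = NW ((ε + δ) ^ a) q q
      + ∑ b, NW ((ε + δ) ^ a) (v b) (v b)
      + ∑ i, ∑ j, NW ((ε + δ) ^ a) (V i j) (V i j) := by
  have e1 : (sc fun x => √ε * (pe t x - p t x)) = fun x (_ : Fin 1) => q.1 x := by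
    funext x _; simp only [sc, hq]
  have e2 : (fun x (b : Fin 3) => ue t x b - u t x b) = fun x b => (v b).1 x := by
    funext x b; rw [hv]
  have e3 : (mtx fun x i j => √δ * (Ue t x i j - stress u t x i j))
      = fun x (ij : Fin 3 × Fin 3) => (V ij.1 ij.2).1 x := by
    funext x ij; simp only [mtx, hV]
  rw [resEnergyH1, e1, e2, e3]
  simp only [H1sq]
  rw [L2sq_eq (fun _ : Fin 1 => q), D1L2sq_eq (fun _ : Fin 1 => q), D2L2sq_eq (fun _ : Fin 1 => q),
    L2sq_eq v, D1L2sq_eq v, D2L2sq_eq v, L2sq_eq (fun ij : Fin 3 × Fin 3 => V ij.1 ij.2),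
    D1L2sq_eq (fun ij : Fin 3 × Fin 3 => V ij.1 ij.2),
    D2L2sq_eq (fun ij : Fin 3 × Fin 3 => V ij.1 ij.2)]
  simp only [Fintype.sum_prod_type, NW_self, Finset.sum_add_distrib, ← Finset.mul_sum,
    Finset.univ_unique, Finset.sum_singleton]
  ring

lemma isOpen_lifespan (Tl : ℝ≥0∞) : IsOpen {t : ℝ | 0 < t ∧ ENNReal.ofReal t < Tl} :=
  isOpen_Ioi.inter (isOpen_Iio.preimage ENNReal.continuous_ofReal)

lemma deriv_val_eq {O : Set ℝ} (hO : IsOpen O) {F : ℝ → SPA} {f : ℝ → Spc 3 → ℝ} {t : ℝ}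
    (hF : JS O F) (ht : t ∈ O) (e : ∀ s ∈ O, (F s).1 = f s) (x : Spc 3) :
    (dt F t).1 x = deriv (fun s => f s x) t := by
  rw [hF.dt_val hO ht]
  refine Filter.EventuallyEq.deriv_eq ?_
  filter_upwards [hO.mem_nhds ht] with s hs
  rw [e s hs]

lemma IsRelax.coord {ε δ : ℝ} {Tl : ℝ≥0∞} {p : ℝ → Spc 3 → ℝ} {u : ℝ → Spc 3 → Vec 3}
    {U : ℝ → Spc 3 → Fin 3 → Fin 3 → ℝ} (h : IsRelax 3 ε δ Tl p u U)
    (L : (ℝ × Vec 3 × (Fin 3 → Fin 3 → ℝ)) →L[ℝ] ℝ) {f : ℝ → Spc 3 → ℝ}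
    (hf : ∀ t x, f t x = L (p t x, u t x, U t x)) :
    (∀ t ∈ Itv Tl, (toA (f t)).1 = f t) ∧
      JS {t | 0 < t ∧ ENNReal.ofReal t < Tl} (fun t => toA (f t)) ∧
      ContinuousOn (fun z : ℝ × Spc 3 => (toA (f z.1)).1 z.2) (Itv Tl ×ˢ univ) := by
  obtain rfl : f = fun t x => L (p t x, u t x, U t x) := funext fun t => funext (hf t)
  have hv : ∀ t ∈ Itv Tl, (toA fun x => L (p t x, u t x, U t x)).1
      = fun x => L (p t x, u t x, U t x) := by
    intro t ht
    refine toA_val ?_ fun x k => ?_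
    · rcases ht.1.eq_or_lt with rfl | h0
      · exact L.contDiff.comp h.init_smooth
      · refine contDiff_iff_contDiffAt.2 fun x => ?_
        exact L.contDiff.contDiffAt.comp x
          ((h.smooth t ht h0 x).comp x (contDiff_prodMk_right t).contDiffAt)
    · simp only [h.per_p t ht x k, h.per_u t ht x k, h.per_U t ht x k]
  refine ⟨hv, ?_, ?_⟩
  · rintro ⟨t, x⟩ ⟨ht, -⟩
    have : ContDiffAt ℝ (⊤ : ℕ∞)
        (fun z : ℝ × Spc 3 => L (p z.1 z.2, u z.1 z.2, U z.1 z.2)) (t, x) :=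
      L.contDiff.contDiffAt.comp (t, x) (h.smooth t ⟨ht.1.le, ht.2⟩ ht.1 x)
    refine this.contDiffWithinAt.congr_of_mem (fun z hz => ?_) ⟨ht, trivial⟩
    rw [hv z.1 ⟨hz.1.1.le, hz.1.2⟩]
  · exact (L.continuous.comp_continuousOn h.cont).congr fun z hz => by
      simp only [hv z.1 hz.1]; rfl

lemma IsRelax.exists_rxa {ε δ : ℝ} {Tl : ℝ≥0∞} {p : ℝ → Spc 3 → ℝ} {u : ℝ → Spc 3 → Vec 3}
    {U : ℝ → Spc 3 → Fin 3 → Fin 3 → ℝ} (h : IsRelax 3 ε δ Tl p u U) (hε : 0 < ε) (hδ : 0 < δ) :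
    ∃ (P : ℝ → SPA) (u' : Fin 3 → ℝ → SPA) (U' : Fin 3 → Fin 3 → ℝ → SPA),
      RXA ε δ {t | 0 < t ∧ ENNReal.ofReal t < Tl} P u' U' ∧
      (∀ t ∈ Itv Tl, (∀ x, (P t).1 x = p t x) ∧ (∀ a x, (u' a t).1 x = u t x a) ∧
        ∀ i j x, (U' i j t).1 x = U t x i j) ∧
      ∀ b ∈ Itv Tl, Cj (Icc 0 b) P ∧ (∀ a, Cj (Icc 0 b) (u' a)) ∧
        ∀ i j, Cj (Icc 0 b) (U' i j) := by
  have hO := isOpen_lifespan Tl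
  have hsub : {t : ℝ | 0 < t ∧ ENNReal.ofReal t < Tl} ⊆ Itv Tl := fun t ht => ⟨ht.1.le, ht.2⟩
  obtain ⟨p1, p2, p3⟩ := h.coord (ContinuousLinearMap.fst ℝ _ _) (f := p) (fun _ _ => rfl)
  have hu := fun a => h.coord ((ContinuousLinearMap.proj (R := ℝ) a).comp
    ((ContinuousLinearMap.fst ℝ (Vec 3) (Fin 3 → Fin 3 → ℝ)).comp
      (ContinuousLinearMap.snd ℝ ℝ (Vec 3 × (Fin 3 → Fin 3 → ℝ)))))
    (f := fun t x => u t x a) (fun _ _ => rfl)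
  have hU := fun i j => h.coord (((ContinuousLinearMap.proj (R := ℝ) (φ := fun _ => ℝ) j).comp
    (ContinuousLinearMap.proj (R := ℝ) (φ := fun _ => Fin 3 → ℝ) i)).comp
    ((ContinuousLinearMap.snd ℝ (Vec 3) (Fin 3 → Fin 3 → ℝ)).comp
      (ContinuousLinearMap.snd ℝ ℝ (Vec 3 × (Fin 3 → Fin 3 → ℝ)))))
    (f := fun t x => U t x i j) (fun _ _ => rfl)
  have hR : RXA ε δ {t | 0 < t ∧ ENNReal.ofReal t < Tl} (fun t => toA (p t))
      (fun a t => toA fun x => u t x a) (fun i j t => toA fun x => U t x i j) := by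
    refine ⟨p2, fun a => (hu a).2.1, fun i j => (hU i j).2.1, fun t ht => ?_, fun t ht a => ?_,
      fun t ht i j => ?_⟩
    · refine SPA.ext' fun x => ?_
      have := h.mass t (hsub ht) ht.1 x
      simp only [SPA.add_val, SPA.smul_val, SPA.sum_val, SPA.zero_val, D_val,
        deriv_val_eq hO p2 ht (fun s hs => p1 s (hsub hs)), fun b => (hu b).1 t (hsub ht)]
      exact this
    · refine SPA.ext' fun x => ?_
      have := h.momentum t (hsub ht) ht.1 x a
      simp only [SPA.add_val, SPA.sum_val, SPA.zero_val, D_val,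
        deriv_val_eq hO (hu a).2.1 ht (fun s hs => (hu a).1 s (hsub hs)),
        fun j => (hU a j).1 t (hsub ht), p1 t (hsub ht)]
      exact this
    · refine SPA.ext' fun x => ?_
      have := h.stress_eq t (hsub ht) ht.1 x i j
      simp only [SPA.add_val, SPA.sub_val, SPA.mul_val, SPA.smul_val, D_val,
        deriv_val_eq hO (hU i j).2.1 ht (fun s hs => (hU i j).1 s (hsub hs)),
        fun b => (hu b).1 t (hsub ht), (hU i j).1 t (hsub ht)]
      exact this
  refine ⟨_, _, _, hR, fun t ht => ⟨fun x => congrFun (p1 t ht) x,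
    fun a x => congrFun ((hu a).1 t ht) x, fun i j x => congrFun ((hU i j).1 t ht) x⟩,
    fun b hb => ?_⟩
  have hI : Icc 0 b ⊆ Itv Tl := fun t ht =>
    ⟨ht.1, (ENNReal.ofReal_le_ofReal ht.2).trans_lt hb.2⟩
  have hIo : Ioc 0 b ⊆ {t : ℝ | 0 < t ∧ ENNReal.ofReal t < Tl} := fun t ht =>
    ⟨ht.1, (hI ⟨ht.1.le, ht.2⟩).2⟩
  have hA : ∀ a, ∃ A, ∀ t ∈ Icc 0 b, ∀ x, |(toA fun x => u t x a).1 x| ≤ A := by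
    intro a
    obtain ⟨M, hM⟩ := (isCompact_Icc.prod isCompact_cube).exists_bound_of_continuousOn
      ((hu a).2.2.mono (prod_mono hI (subset_univ _)))
    refine ⟨M, fun t ht x => ?_⟩
    obtain ⟨y, hy, e⟩ := SPA.exists_mem_cube x
    rw [e]
    exact hM (t, y) ⟨ht, hy⟩
  choose A hA using hA
  obtain ⟨b1, b2, b3⟩ := hR.bd hε hδ hO hIo (A := ∑ a, |A a|) fun t ht a x =>
    (hA a t (Ioc_subset_Icc_self ht) x).trans ((le_abs_self _).trans
      (Finset.single_le_sum (f := fun a => |A a|) (fun _ _ => abs_nonneg _) (Finset.mem_univ a)))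
  have up : ∀ {F : ℝ → SPA}, Bd (Ioc 0 b) F →
      ContinuousOn (fun z : ℝ × Spc 3 => (F z.1).1 z.2) (Itv Tl ×ˢ univ) → Cj (Icc 0 b) F := by
    intro F hF hc
    refine Cj.of_bd ((hF.union (S' := {0}) ((Bd.const (F 0)).congr fun t ht => ?_)).mono ?_)
      (hc.mono (prod_mono_left hI))
    · rw [mem_singleton_iff.1 ht]
    · rintro t ⟨h0, h1⟩
      rcases h0.eq_or_lt with rfl | h0
      · exact Or.inr rfl
      · exact Or.inl ⟨h0, h1⟩
  exact ⟨up b1 p3, fun a => up (b2 a) (hu a).2.2, fun i j => up (b3 i j) (hU i j).2.2⟩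

lemma IsNS.exists_nsa {S : Set ℝ} {p : ℝ → Spc 3 → ℝ} {u : ℝ → Spc 3 → Vec 3}
    (h : IsNS 3 S p u) : ∃ (P : ℝ → SPA) (u' : Fin 3 → ℝ → SPA), NSA S P u' ∧
      (∀ t x, (P t).1 x = p t x) ∧ ∀ a t x, (u' a t).1 x = u t x a := by
  have hs : ∀ {f : ℝ → Spc 3 → ℝ}, SmoothS f → (∀ t, Per (f t)) →
      ∃ F : ℝ → SPA, JS univ F ∧ ∀ t, (F t).1 = f t := by
    intro f hf hp
    refine ⟨fun t => ⟨f t, ContDiff.comp (g := fun z : ℝ × Spc 3 => f z.1 z.2) hf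
      (contDiff_prodMk_right t), hp t⟩, ?_, fun t => rfl⟩
    exact ContDiff.contDiffOn hf
  obtain ⟨P, hP, eP⟩ := hs h.smooth_p h.per_p
  have hu : ∀ a, ∃ F : ℝ → SPA, JS univ F ∧ ∀ t, (F t).1 = fun x => u t x a := fun a =>
    hs (f := fun t x => u t x a) (contDiff_pi.1 h.smooth_u a) fun t x k => by
      simp only [h.per_u t x k]
  choose u' hu' eu using hu
  refine ⟨P, u', ⟨hP, hu', fun t ht => ?_, fun t ht a => ?_, fun t ht => ?_⟩,
    fun t x => congrFun (eP t) x, fun a t x => congrFun (eu a t) x⟩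
  · refine SPA.ext' fun x => ?_
    simp only [SPA.sum_val, D_val, eu, SPA.zero_val]
    exact h.div_free t ht x
  · refine SPA.ext' fun x => ?_
    have := h.momentum t ht x a
    have e : ∀ j, (u' a t * u' j t).1 = fun x => u t x a * u t x j := fun j => by
      funext y; rw [SPA.mul_val, eu, eu]
    simp only [SPA.sub_val, SPA.add_val, SPA.neg_val, Lap_apply, SPA.sum_val, D_val, e, eP, eu,
      deriv_val_eq isOpen_univ (hu' a) trivial (fun s _ => eu a s)]
    simp only [dtV, divM, tens, lapV, lapS] at this
    linarith
  · rw [I_def, eP]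
    exact h.mean_zero t ht

/-- The rescaled residual of the stress. -/
def resV (δ : ℝ) (u : Fin 3 → ℝ → SPA) (Ue : Fin 3 → Fin 3 → ℝ → SPA) (i j : Fin 3) (t : ℝ) : SPA :=
  √δ • (Ue i j t - (u i t * u j t - D j (u i t)))

/-- The forcing in the equation of the rescaled residual of the stress. -/
def resG (δ : ℝ) (u ue : Fin 3 → ℝ → SPA) (Ue : Fin 3 → Fin 3 → ℝ → SPA) (i j : Fin 3) (t : ℝ) :
    SPA :=
  (√δ)⁻¹ • (u i t * (ue j t - u j t) + u j t * (ue i t - u i t)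
    + (ue i t - u i t) * (ue j t - u j t)) - ((√δ)⁻¹ ^ 2) • resV δ u Ue i j t
    - √δ • dt (fun t => u i t * u j t - D j (u i t)) t

/-- The energy of the rescaled residual. -/
def resE (κ ε δ : ℝ) (P : ℝ → SPA) (u : Fin 3 → ℝ → SPA) (Pe : ℝ → SPA) (ue : Fin 3 → ℝ → SPA)
    (Ue : Fin 3 → Fin 3 → ℝ → SPA) (t : ℝ) : ℝ :=
  NW κ (√ε • (Pe t - P t)) (√ε • (Pe t - P t)) + ∑ b, NW κ (ue b t - u b t) (ue b t - u b t)
    + ∑ i, ∑ j, NW κ (resV δ u Ue i j t) (resV δ u Ue i j t)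

/-- The time derivative of the energy of the rescaled residual. -/
def resE' (κ ε δ : ℝ) (P : ℝ → SPA) (u : Fin 3 → ℝ → SPA) (Pe : ℝ → SPA) (ue : Fin 3 → ℝ → SPA)
    (Ue : Fin 3 → Fin 3 → ℝ → SPA) (t : ℝ) : ℝ :=
  2 * (NW κ (√ε • (Pe t - P t)) (-(√ε • dt P t))
    + ∑ i, ∑ j, NW κ (resV δ u Ue i j t) (resG δ u ue Ue i j t))

section Residual

variable {ε δ κ : ℝ} {S O : Set ℝ} {P Pe : ℝ → SPA} {u ue : Fin 3 → ℝ → SPA}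
  {Ue : Fin 3 → Fin 3 → ℝ → SPA}

lemma hasDerivAt_resE (hA : NSA S P u) (hR : RXA ε δ O Pe ue Ue) (hε : 0 < ε) (hδ : 0 < δ)
    (hO : IsOpen O) (hκ : 0 ≤ κ) {t : ℝ} (htS : t ∈ S) (htO : t ∈ O) :
    HasDerivAt (resE κ ε δ P u Pe ue Ue) (resE' κ ε δ P u Pe ue Ue t) t := by
  have jP := hA.jsP.mono (subset_univ O)
  have ju := fun a => (hA.jsu a).mono (subset_univ O)
  have jS := fun i j => (hA.jsStress i j).mono (subset_univ O)
  have hs : (√ε)⁻¹ * √ε = 1 := inv_mul_cancel₀ (Real.sqrt_pos.2 hε).ne'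
  have hr : (√δ)⁻¹ * √δ = 1 := inv_mul_cancel₀ (Real.sqrt_pos.2 hδ).ne'
  refine (NW_dForm hκ).hasDerivAt_energy (O := O) (r := (√δ)⁻¹) (s := (√ε)⁻¹)
    (fun F hF => hF.hasDerivAt_NW κ hO htO) ((hR.jsP.sub jP).smul _)
    (fun a => (hR.jsu a).sub (ju a)) (fun i j => ((hR.jsU i j).sub (jS i j)).smul _)
    ?_ (fun a => ?_) fun i j => ?_
  · rw [(hR.jsP.sub jP).dt_smul _ hO htO, hR.jsP.dt_sub jP hO htO, smul_sub, hR.dt_q hε htO]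
    simp only [map_sub, Finset.sum_sub_distrib, hA.div t htS, sub_zero]
    abel
  · have h1 := hR.mom t htO a
    have h2 := hA.mom t htS a
    rw [(hR.jsu a).dt_sub (ju a) hO htO, h2]
    simp only [resV, map_smul, ← Finset.smul_sum, smul_smul, hs, hr, one_smul, map_sub,
      Finset.sum_sub_distrib]
    have h3 : ∑ j, D j (D j (u a t)) = Lap (u a t) := (Lap_apply _).symm
    rw [h3, ← sub_eq_zero, ← h1]
    abel
  · have h1 : dt (resV δ u Ue i j) t = √δ • dt (Ue i j) t
        - √δ • dt (fun t => u i t * u j t - D j (u i t)) t := by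
      rw [show resV δ u Ue i j = fun t => √δ • (Ue i j t - (u i t * u j t - D j (u i t)))
        from rfl, ((hR.jsU i j).sub (jS i j)).dt_smul _ hO htO,
        (hR.jsU i j).dt_sub (jS i j) hO htO, smul_sub]
    rw [h1, hR.dt_V hδ htO, resG, resV, smul_smul ((√δ)⁻¹ ^ 2), pow_two, mul_assoc, hr, mul_one,
      map_sub]
    have h2 : ue i t * ue j t - Ue i j t - D j (ue i t) = -(D j (ue i t) - D j (u i t))
        + (u i t * (ue j t - u j t) + u j t * (ue i t - u i t)
          + (ue i t - u i t) * (ue j t - u j t)) - (Ue i j t - (u i t * u j t - D j (u i t))) := by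
      ring
    rw [h2, smul_sub, smul_add, smul_neg]
    abel

lemma Cj.continuousOn_NW {F G : ℝ → SPA} (κ : ℝ) (h : Cj S F) (h' : Cj S G) :
    ContinuousOn (fun t => NW κ (F t) (G t)) S :=
  ((h.continuousOn_NB 0 h').add (h.continuousOn_NB 1 h')).add
    ((h.continuousOn_NB 2 h').const_smul κ)

lemma continuousOn_resE (hA : NSA S P u) (hP : Cj O Pe) (hu : ∀ a, Cj O (ue a))
    (hU : ∀ i j, Cj O (Ue i j)) :
    ContinuousOn (resE κ ε δ P u Pe ue Ue) O ∧ ContinuousOn (resE' κ ε δ P u Pe ue Ue) O := by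
  have cj : ∀ {F : ℝ → SPA}, JS univ F → Cj O F := fun h =>
    (h.cj isOpen_univ).mono (subset_univ O)
  have cu := fun a => cj (hA.jsu a)
  have cq := (hP.sub (cj hA.jsP)).smul (√ε)
  have cv := fun a => (hu a).sub (cu a)
  have cV : ∀ i j, Cj O (resV δ u Ue i j) := fun i j =>
    ((hU i j).sub (cj (hA.jsStress i j))).smul (√δ)
  have cG : ∀ i j, Cj O (resG δ u ue Ue i j) := fun i j =>
    (((((((cu i).mul (cv j)).add ((cu j).mul (cv i))).add ((cv i).mul (cv j)))).smul _).sub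
      ((cV i j).smul _)).sub ((cj ((hA.jsStress i j).dt isOpen_univ)).smul _)
  have cdP := ((cj (hA.jsP.dt isOpen_univ)).smul (√ε)).neg
  refine ⟨((cq.continuousOn_NW κ cq).add (continuousOn_finsetSum _ fun b _ =>
      (cv b).continuousOn_NW κ (cv b))).add (continuousOn_finsetSum _ fun i _ =>
        continuousOn_finsetSum _ fun j _ => (cV i j).continuousOn_NW κ (cV i j)), ?_⟩
  exact continuousOn_const.mul ((cq.continuousOn_NW κ cdP).add (continuousOn_finsetSum _ fun i _ =>
    continuousOn_finsetSum _ fun j _ => (cV i j).continuousOn_NW κ (cG i j)))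

end Residual

lemma hasDerivWithinAt_Ici_of_continuousOn {f f' : ℝ → ℝ} {b : ℝ} (hb : 0 < b)
    (hf : ContinuousOn f (Icc 0 b)) (hf' : ContinuousOn f' (Icc 0 b))
    (h : ∀ t ∈ Ioc 0 b, HasDerivAt f (f' t) t) : HasDerivWithinAt f (f' 0) (Ici 0) 0 := by
  have hsub : Ioc 0 b ⊆ Icc 0 b := Ioc_subset_Icc_self
  have h0 : (0 : ℝ) ∈ Icc 0 b := ⟨le_rfl, hb.le⟩
  refine hasDerivWithinAt_Ici_of_tendsto_deriv (s := Ioc 0 b)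
    (fun t ht => (h t ht).differentiableAt.differentiableWithinAt)
    ((hf 0 h0).mono hsub) (Ioc_mem_nhdsGT hb) ?_
  have : Tendsto f' (𝓝[>] 0) (𝓝 (f' 0)) := by
    rw [← nhdsWithin_Ioc_eq_nhdsGT hb]
    exact (hf' 0 h0).mono hsub
  refine this.congr' ?_
  filter_upwards [Ioc_mem_nhdsGT hb] with t ht
  exact (h t ht).deriv.symm

end

/-- energy estimate (3.2) of the paper: differential inequality for the
`H¹`-type energy of the rescaled residual. -/
theorem residual_energy_estimate_H1
    (T0 : ℝ≥0∞) (hT0 : 0 < T0)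
    (p : ℝ → Spc 3 → ℝ) (u : ℝ → Spc 3 → Vec 3)
    (hNS : IsNS 3 {t : ℝ | 0 ≤ t ∧ ENNReal.ofReal t ≤ T0} p u)
    (pe : ℝ → ℝ → ℝ → Spc 3 → ℝ) (ue : ℝ → ℝ → ℝ → Spc 3 → Vec 3)
    (Ue : ℝ → ℝ → ℝ → Spc 3 → Fin 3 → Fin 3 → ℝ) (Tl : ℝ → ℝ → ℝ≥0∞)
    (hRel : ∀ ε δ : ℝ, 0 < ε → 0 < δ →
      IsMaxRelax 3 ε δ (Tl ε δ) (pe ε δ) (ue ε δ) (Ue ε δ))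
    (a : ℝ) (ha0 : 0 ≤ a) (ha2 : a < 2) :
    ∃ C > (0:ℝ), ∃ η > (0:ℝ), ∀ ε δ : ℝ, 0 < ε → 0 < δ → ε + δ < η →
      ∀ t : ℝ, 0 ≤ t → ENNReal.ofReal t ≤ T0 → ENNReal.ofReal t < Tl ε δ →
        ∃ E' : ℝ,
          HasDerivWithinAt
            (resEnergyH1 a ε δ p u (pe ε δ) (ue ε δ) (Ue ε δ)) E' (Set.Ici t) t ∧
          (0 < t → HasDerivAt
            (resEnergyH1 a ε δ p u (pe ε δ) (ue ε δ) (Ue ε δ)) E' t) ∧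
          E' ≤ C * (Real.sqrt ((ε + δ) *
                resEnergyH1 a ε δ p u (pe ε δ) (ue ε δ) (Ue ε δ) t)
              + resEnergyH1 a ε δ p u (pe ε δ) (ue ε δ) (Ue ε δ) t
              + (ε + δ) ^ (-(a/2)) *
                (resEnergyH1 a ε δ p u (pe ε δ) (ue ε δ) (Ue ε δ) t) ^ 2) := by
  obtain ⟨P, u', hA, eP, eu⟩ := hNS.exists_nsa
  obtain ⟨bu, bp, bS⟩ := hA.uniform_bd
  obtain ⟨C, hC, hest⟩ := exists_static_estimate bu bp bS
  refine ⟨C, hC, 1, one_pos, fun ε δ hε hδ hεδ t ht0 htT htl => ?_⟩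
  obtain ⟨Pe, ue', Ue', hR, hval, hcj⟩ := (hRel ε δ hε hδ).1.exists_rxa hε hδ
  have hO := isOpen_lifespan (Tl ε δ)
  have hs : 0 < ε + δ := add_pos hε hδ
  have hκ : 0 ≤ (ε + δ) ^ a := (Real.rpow_pos_of_pos hs a).le
  set E := resE ((ε + δ) ^ a) ε δ P u' Pe ue' Ue' with hE
  set E' := resE' ((ε + δ) ^ a) ε δ P u' Pe ue' Ue' with hE'
  have hres : ∀ s ∈ Itv (Tl ε δ),
      resEnergyH1 a ε δ p u (pe ε δ) (ue ε δ) (Ue ε δ) s = E s := by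
    intro s hs
    obtain ⟨v1, v2, v3⟩ := hval s hs
    refine resEnergyH1_eq (fun x => ?_) (fun b x => ?_) (fun i j x => ?_)
    · rw [SPA.smul_val, SPA.sub_val, v1, eP]
    · rw [SPA.sub_val, v2, eu]
    · rw [resV, SPA.smul_val, SPA.sub_val, SPA.sub_val, SPA.mul_val, v3, eu, eu, D_val, stress]
      congr 4
      exact funext fun y => eu i s y
  have htI : t ∈ Itv (Tl ε δ) := ⟨ht0, htl⟩
  have hder : ∀ s, 0 < s → ENNReal.ofReal s ≤ T0 → ENNReal.ofReal s < Tl ε δ →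
      HasDerivAt E (E' s) s := fun s h0 hT hl =>
    hasDerivAt_resE hA hR hε hδ hO hκ ⟨h0.le, hT⟩ ⟨h0, hl⟩
  have hderiv : 0 < t → HasDerivAt
      (resEnergyH1 a ε δ p u (pe ε δ) (ue ε δ) (Ue ε δ)) (E' t) t := fun h0 => by
    refine (hder t h0 htT htl).congr_of_eventuallyEq ?_
    filter_upwards [hO.mem_nhds ⟨h0, htl⟩] with s hs
    exact hres s ⟨hs.1.le, hs.2⟩
  refine ⟨E' t, ?_, hderiv, ?_⟩
  · rcases ht0.eq_or_lt with rfl | h0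
    · obtain ⟨c, hc0, hc⟩ := ENNReal.lt_iff_exists_nnreal_btwn.1
        (lt_min hT0 (hRel ε δ hε hδ).1.pos)
      have hc0' : (0 : ℝ) < c := by exact_mod_cast hc0
      have hcT : ENNReal.ofReal (c : ℝ) ≤ T0 := by
        rw [ENNReal.ofReal_coe_nnreal]; exact (hc.trans_le (min_le_left _ _)).le
      have hcl : ENNReal.ofReal (c : ℝ) < Tl ε δ := by
        rw [ENNReal.ofReal_coe_nnreal]; exact hc.trans_le (min_le_right _ _)
      obtain ⟨c1, c2, c3⟩ := hcj c ⟨hc0'.le, hcl⟩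
      obtain ⟨k1, k2⟩ := continuousOn_resE (ε := ε) (δ := δ) (κ := (ε + δ) ^ a) hA c1 c2 c3
      have hle : ∀ s ≤ (c : ℝ), ENNReal.ofReal s ≤ ENNReal.ofReal c := fun s h =>
        ENNReal.ofReal_le_ofReal h
      have := hasDerivWithinAt_Ici_of_continuousOn hc0' k1 k2 fun s hs =>
        hder s hs.1 ((hle s hs.2).trans hcT) ((hle s hs.2).trans_lt hcl)
      refine this.congr_of_eventuallyEq_of_mem ?_ (le_refl (0 : ℝ))
      filter_upwards [Icc_mem_nhdsGE hc0'] with s hs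
      exact hres s ⟨hs.1, (hle s hs.2).trans_lt hcl⟩
    · exact (hderiv h0).hasDerivWithinAt
  · rw [hres t htI]
    have e1 : ((ε + δ) ^ (a / 2)) ^ 2 = (ε + δ) ^ a := by
      rw [← Real.rpow_natCast, ← Real.rpow_mul hs.le]; norm_num
    have e2 : ((ε + δ) ^ (a / 2))⁻¹ = (ε + δ) ^ (-(a / 2)) := (Real.rpow_neg hs.le _).symm
    have := hest t ⟨ht0, htT⟩ ε δ ((ε + δ) ^ (a / 2)) (√δ)⁻¹ hε hδ
      ⟨Real.rpow_pos_of_pos hs _, Real.rpow_le_one hs.le hεδ.le (by positivity)⟩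
      (√ε • (Pe t - P t)) (fun b => ue' b t - u' b t) (fun i j => resV δ u' Ue' i j t) (E t)
      (by rw [e1]; rfl)
    rw [e1, e2] at this
    exact this

end NSRelax
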